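/- If y ≥ 1 and x ≥ 18·3^y, then |𝒰(x)| ≥ (x/ln x) · ∫_1^y |𝒰(v)|/v² dv. -/

import Mathlib

/-- `N ∈ 𝒰` iff `N ≥ 1` and `∑_{n=1}^{N-1} w_n/n ≠ 1/N` for all `w_n ∈ {-1,0,1}`. -/
def memU (N : ℕ) : Prop :=
  1 ≤ N ∧ ∀ w : ℕ → ℤ, (∀ n, w n = -1 ∨ w n = 0 ∨ w n = 1) →
    ∑ n ∈ Finset.Icc 1 (N - 1), (w n : ℚ) / (n : ℚ) ≠ 1 / (N : ℚ)

open scoped Classical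

/-- `|𝒰(x)|`: the number of elements of `𝒰` not exceeding `x`. -/
noncomputable def countU (x : ℝ) : ℕ :=
  ((Finset.Icc 1 ⌊x⌋₊).filter (fun m => memU m)).card


section
open Complex Metric Set Filter Topology MeasureTheory

theorem pj_log {h : ℂ → ℂ} {r R : ℝ} (hr : 0 < r) (hR : r < R) (hd : DifferentiableOn ℂ h (ball 0 R)) :
    deriv h 0 = (1 / (Real.pi * r) : ℝ) * ∫ θ in (0:ℝ)..2 * Real.pi, h (circleMap 0 r θ) * (Real.cos θ : ℂ) := by
  have hpi := Real.pi_pos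
  have hpi' : (Real.pi : ℂ) ≠ 0 := by exact_mod_cast hpi.ne'
  have hr' : (r : ℂ) ≠ 0 := by exact_mod_cast hr.ne'
  have hsub : closedBall (0:ℂ) r ⊆ ball 0 R := closedBall_subset_ball hR
  have hdc : DiffContOnCl ℂ h (ball 0 r) :=
    DifferentiableOn.diffContOnCl (by rw [closure_ball _ hr.ne']; exact hd.mono hsub)
  have h1 := hdc.deriv_eq_smul_circleIntegral hr
  have h2 : (∮ z in C(0, r), h z) = 0 :=
    hdc.circleIntegral_eq_zero hr.le
  have hc : Continuous fun θ : ℝ => h (circleMap 0 r θ) := by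
    refine ContinuousOn.comp_continuous (hd.mono hsub).continuousOn (continuous_circleMap 0 r) ?_
    intro x; exact circleMap_mem_closedBall 0 hr.le x
  simp only [circleIntegral, deriv_circleMap, circleMap_zero, smul_eq_mul, sub_zero] at h1 h2
  have e1 : ∀ θ : ℝ, (r * cexp (θ * I) * I * (1 / (r * cexp (θ * I)) ^ 2 * h (r * cexp (θ * I))))
      = (I / r) * (cexp (-(θ * I)) * h (r * cexp (θ * I))) := by
    intro θ
    rw [Complex.exp_neg]
    have := Complex.exp_ne_zero (θ * I)
    field_simp
  have e2 : ∀ θ : ℝ, (r * cexp (θ * I) * I * h (r * cexp (θ * I)))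
      = (r * I) * (cexp (θ * I) * h (r * cexp (θ * I))) := by intro θ; ring
  have h1' : deriv h 0 = (2 * Real.pi * I)⁻¹ * ((I / r) * ∫ θ in (0:ℝ)..2 * Real.pi, cexp (-(θ * I)) * h (r * cexp (θ * I))) := by
    simp only [e1, intervalIntegral.integral_const_mul] at h1
    rw [h1]; field_simp
  simp only [e2, intervalIntegral.integral_const_mul] at h2
  have h3 : (∫ θ in (0:ℝ)..2 * Real.pi, cexp (θ * I) * h (r * cexp (θ * I))) = 0 := by
    rcases mul_eq_zero.1 h2 with h | h
    · simp [hr.ne'] at h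
    · exact h
  simp only [circleMap_zero] at hc ⊢
  have h4 : (∫ θ in (0:ℝ)..2 * Real.pi, h (r * cexp (θ * I)) * (Real.cos θ : ℂ)) =
     2⁻¹ * ((∫ θ in (0:ℝ)..2 * Real.pi, cexp (θ * I) * h (r * cexp (θ * I))) +
      ∫ θ in (0:ℝ)..2 * Real.pi, cexp (-(θ * I)) * h (r * cexp (θ * I))) := by
    rw [← intervalIntegral.integral_add, ← intervalIntegral.integral_const_mul]
    · congr 1; funext θ; rw [Complex.ofReal_cos, Complex.cos]; ring_nf
    · exact Continuous.intervalIntegrable (Continuous.mul (by fun_prop) hc) _ _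
    · exact Continuous.intervalIntegrable (Continuous.mul (by fun_prop) hc) _ _
  rw [h4, h3, h1']; push_cast
  field_simp; ring

theorem pj_nonvan {g : ℂ → ℂ} {r : ℝ} (hr : 0 < r) (hg : AnalyticOnNhd ℂ g (closedBall 0 r))
    (hn : ∀ z ∈ closedBall (0:ℂ) r, g z ≠ 0) :
    (logDeriv g 0).re = (1 / (Real.pi * r) : ℝ) *
      ∫ θ in (0:ℝ)..2 * Real.pi, Real.log ‖g (circleMap 0 r θ)‖ * Real.cos θ := by
  obtain ⟨δ, hδ, hsub⟩ : ∃ δ, 0 < δ ∧ thickening δ (closedBall (0:ℂ) r) ⊆ {z | AnalyticAt ℂ g z ∧ g z ≠ 0} := by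
    refine (isCompact_closedBall 0 r).exists_thickening_subset_open ?_ fun z hz => ⟨hg z hz, hn z hz⟩
    rw [isOpen_iff_mem_nhds]
    rintro z ⟨h1, h2⟩
    exact (h1.eventually_analyticAt).and (h1.continuousAt.eventually_ne h2)
  rw [thickening_closedBall hδ hr.le] at hsub
  set R := δ + r with hRd
  have hR : r < R := by linarith
  have hD : DifferentiableOn ℂ g (ball 0 R) := fun z hz => (hsub hz).1.differentiableAt.differentiableWithinAt
  have hD' : DifferentiableOn ℂ (logDeriv g) (ball 0 R) := by
    unfold logDeriv
    exact (hD.deriv isOpen_ball).div hD fun z hz => (hsub hz).2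
  obtain ⟨h, hh⟩ := hD'.isExactOn_ball
  have h0 : (0:ℂ) ∈ ball (0:ℂ) R := mem_ball_self (by linarith)
  -- g * exp(-h) constant
  have hconst : ∀ z ∈ ball (0:ℂ) R, g z * cexp (- h z) = g 0 * cexp (- h 0) := by
    intro z hz
    have hder : ∀ w ∈ ball (0:ℂ) R, HasDerivAt (fun z => g z * cexp (- h z)) 0 w := by
      intro w hw
      have a := (hsub hw).1.differentiableAt.hasDerivAt.mul ((hh w hw).neg.cexp)
      have h2 := (hsub hw).2
      have e : deriv g w * cexp ((-h) w) + g w * (cexp ((-h) w) * -logDeriv g w) = 0 := by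
        rw [logDeriv_apply]; field_simp; ring
      rw [e] at a; exact a
    refine (isOpen_ball.is_const_of_deriv_eq_zero (convex_ball 0 R).isPreconnected (f := fun z => g z * cexp (- h z)) ?_ ?_ hz h0)
    · exact fun w hw => (hder w hw).differentiableAt.differentiableWithinAt
    · exact fun w hw => (hder w hw).deriv
  have hg0 : g 0 * cexp (- h 0) ≠ 0 := mul_ne_zero (hsub h0).2 (Complex.exp_ne_zero _)
  set C := g 0 * cexp (- h 0) with hC
  have hlog : ∀ z ∈ ball (0:ℂ) R, Real.log ‖g z‖ = (h z).re + Real.log ‖C‖ := by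
    intro z hz
    have : g z = C * cexp (h z) := by
      rw [← hconst z hz, mul_assoc, ← Complex.exp_add]; simp
    rw [this, norm_mul, Real.log_mul (by simpa using hg0) (by simp), Complex.norm_exp, Real.log_exp]; ring
  have key := pj_log hr hR (h := fun z => h z + Real.log ‖C‖) (by
    intro w hw; exact ((hh w hw).differentiableAt.add_const _).differentiableWithinAt)
  have hc : Continuous fun θ : ℝ => (h (circleMap 0 r θ) + Real.log ‖C‖) * (Real.cos θ : ℂ) := by
    refine Continuous.mul (Continuous.add (ContinuousOn.comp_continuous (s := closedBall 0 r) ?_ (continuous_circleMap 0 r) ?_) (by fun_prop)) (by fun_prop)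
    · exact fun w hw => (hh w (closedBall_subset_ball hR hw)).continuousAt.continuousWithinAt
    · intro x; exact circleMap_mem_closedBall 0 hr.le x
  rw [deriv_add_const, (hh 0 h0).deriv] at key
  rw [key, Complex.re_ofReal_mul]
  congr 1
  rw [← Complex.reCLM_apply, ← Complex.reCLM.intervalIntegral_comp_comm (hc.intervalIntegrable 0 (2*Real.pi))]
  congr 1; funext θ
  rw [hlog _ (closedBall_subset_ball hR (circleMap_mem_closedBall 0 hr.le θ)), Complex.reCLM_apply, Complex.re_mul_ofReal]
  simp

/-- contribution of a zero -/
noncomputable def zc (r : ℝ) (u : ℂ) : ℝ := u.re * (1 / r ^ 2 - 1 / ‖u‖ ^ 2)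

theorem zc_nonneg {r : ℝ} {u : ℂ} (h0 : u ≠ 0) (hu : ‖u‖ ≤ r) (hre : u.re ≤ 0) : 0 ≤ zc r u := by
  unfold zc
  refine mul_nonneg_of_nonpos_of_nonpos hre ?_
  have : 0 < ‖u‖ := norm_pos_iff.2 h0
  rw [sub_nonpos]; gcongr

theorem pj_fac {f g : ℂ → ℂ} {r : ℝ} (hr : 0 < r) (s : Finset ℂ) (n : ℂ → ℕ)
    (hs : ∀ u ∈ s, u ∈ ball (0:ℂ) r ∧ u ≠ 0)
    (hg : AnalyticOnNhd ℂ g (closedBall 0 r)) (hn : ∀ z ∈ closedBall (0:ℂ) r, g z ≠ 0)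
    (hf : ∀ z ∈ closedBall (0:ℂ) r, f z = (∏ u ∈ s, (z - u) ^ n u) * g z) :
    (logDeriv f 0).re = (1 / (Real.pi * r) : ℝ) *
      (∫ θ in (0:ℝ)..2 * Real.pi, Real.log ‖f (circleMap 0 r θ)‖ * Real.cos θ) + ∑ u ∈ s, n u * zc r u := by
  have hrc : (r : ℂ) ≠ 0 := by exact_mod_cast hr.ne'
  set B : ℂ → ℂ → ℂ := fun u z => (r ^ 2 - (starRingEnd ℂ) u * z) / r with hB
  have hBd : ∀ u z, DifferentiableAt ℂ (B u) z := by intro u z; simp only [hB]; fun_prop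
  have hB0 : ∀ u ∈ s, ∀ z ∈ closedBall (0:ℂ) r, B u z ≠ 0 := by
    intro u hu z hz
    have h1 := (hs u hu).1
    simp only [mem_ball_zero_iff, mem_closedBall_zero_iff] at h1 hz
    refine div_ne_zero ?_ hrc
    intro h
    have h2 : ‖(r:ℂ) ^ 2‖ = ‖(starRingEnd ℂ) u * z‖ := by rw [sub_eq_zero.1 h]
    rw [norm_mul, RCLike.norm_conj, norm_pow, Complex.norm_real, Real.norm_of_nonneg hr.le] at h2
    nlinarith [norm_nonneg u, norm_nonneg z]
  set G : ℂ → ℂ := fun z => (∏ u ∈ s, (B u z) ^ n u) * g z with hG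
  have hGa : AnalyticOnNhd ℂ G (closedBall 0 r) := by
    intro z hz
    refine AnalyticAt.mul ?_ (hg z hz)
    refine Finset.analyticAt_fun_prod _ fun u _ => AnalyticAt.fun_pow ?_ _
    simp only [hB]; fun_prop (disch := exact hrc)
  have hGn : ∀ z ∈ closedBall (0:ℂ) r, G z ≠ 0 := by
    intro z hz
    exact mul_ne_zero (Finset.prod_ne_zero_iff.2 fun u hu => pow_ne_zero _ (hB0 u hu z hz)) (hn z hz)
  have hm0 : (0:ℂ) ∈ closedBall (0:ℂ) r := mem_closedBall_self hr.le
  have key := pj_nonvan hr hGa hGn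
  have hnorm : ∀ θ : ℝ, ‖G (circleMap 0 r θ)‖ = ‖f (circleMap 0 r θ)‖ := by
    intro θ
    rw [hf _ (circleMap_mem_closedBall 0 hr.le θ)]
    simp only [hG, norm_mul, norm_prod, norm_pow]
    congr 1
    refine Finset.prod_congr rfl fun u _ => ?_
    congr 1
    set z := circleMap 0 r θ with hz
    have hzn : ‖z‖ = r := by simp [hz, abs_of_pos hr]
    have e : (r:ℂ) ^ 2 - (starRingEnd ℂ) u * z = z * (starRingEnd ℂ) (z - u) := by
      have : (r:ℂ)^2 = z * (starRingEnd ℂ) z := by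
        rw [Complex.mul_conj, Complex.normSq_eq_norm_sq, hzn]; push_cast; ring
      rw [this, map_sub]; ring
    simp only [hB]
    rw [e, norm_div, norm_mul, RCLike.norm_conj, hzn, Complex.norm_real, Real.norm_of_nonneg hr.le]
    field_simp
  simp only [hnorm] at key
  rw [← key]
  have hfe : f =ᶠ[𝓝 0] fun z => (∏ u ∈ s, (z - u) ^ n u) * g z := by
    filter_upwards [closedBall_mem_nhds (0:ℂ) hr] with z hz using hf z hz
  have hu0 : ∀ u ∈ s, (0:ℂ) - u ≠ 0 := by intro u hu; simpa using (hs u hu).2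
  have l1 : logDeriv f 0 = (∑ u ∈ s, (n u : ℂ) * (-1 / u)) + logDeriv g 0 := by
    rw [show logDeriv f 0 = logDeriv (fun z => (∏ u ∈ s, (z - u) ^ n u) * g z) 0 by
      rw [logDeriv_apply, logDeriv_apply, hfe.deriv_eq, hfe.eq_of_nhds], logDeriv_mul (f := fun z => ∏ u ∈ s, (z - u) ^ n u), logDeriv_prod]
    · congr 1
      refine Finset.sum_congr rfl fun u hu => ?_
      rw [logDeriv_fun_pow (by fun_prop), logDeriv_apply]
      have := hu0 u hu
      simp
      ring
    · exact fun u hu => pow_ne_zero _ (hu0 u hu)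
    · intro u hu; fun_prop
    · exact Finset.prod_ne_zero_iff.2 fun u hu => pow_ne_zero _ (hu0 u hu)
    · exact hn 0 hm0
    · fun_prop
    · exact (hg 0 hm0).differentiableAt
  have l2 : logDeriv G 0 = (∑ u ∈ s, (n u : ℂ) * (-(starRingEnd ℂ) u / r ^ 2)) + logDeriv g 0 := by
    rw [hG, logDeriv_mul (f := fun z => ∏ u ∈ s, (B u z) ^ n u), logDeriv_prod]
    · congr 1
      refine Finset.sum_congr rfl fun u hu => ?_
      rw [logDeriv_fun_pow (hBd u 0), logDeriv_apply]
      have hd : HasDerivAt (B u) ((0 - (starRingEnd ℂ) u * 1) / r) 0 :=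
        ((hasDerivAt_const _ _).sub ((hasDerivAt_id _).const_mul _)).div_const _
      rw [hd.deriv]
      simp only [hB]
      congr 1
      field_simp; ring
    · exact fun u hu => pow_ne_zero _ (hB0 u hu 0 hm0)
    · intro u hu; exact (hBd u 0).fun_pow _
    · exact Finset.prod_ne_zero_iff.2 fun u hu => pow_ne_zero _ (hB0 u hu 0 hm0)
    · exact hn 0 hm0
    · exact DifferentiableAt.fun_finsetProd fun u hu => (hBd u 0).fun_pow _
    · exact (hg 0 hm0).differentiableAt
  rw [l1, l2]
  simp only [Complex.add_re, Complex.re_sum]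
  have : ∀ u ∈ s, ((n u : ℂ) * (-1 / u)).re = ((n u : ℂ) * (-(starRingEnd ℂ) u / r ^ 2)).re + n u * zc r u := by
    intro u hu
    have hu' := (hs u hu).2
    rw [← Complex.ofReal_natCast, Complex.re_ofReal_mul, Complex.re_ofReal_mul, ← mul_add]
    congr 1
    unfold zc
    rw [← Complex.ofReal_pow, Complex.div_ofReal_re, Complex.neg_re, Complex.conj_re, ← Complex.normSq_eq_norm_sq]
    rw [neg_div, Complex.neg_re, one_div, Complex.inv_re]
    ring
  rw [Finset.sum_congr rfl this, Finset.sum_add_distrib]; ring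

theorem exists_fac {f : ℂ → ℂ} {r : ℝ} (hr : 0 < r) (hf : AnalyticOnNhd ℂ f (closedBall 0 r)) (h0 : f 0 ≠ 0) :
    ∃ (s : Finset ℂ) (n : ℂ → ℕ) (g : ℂ → ℂ), AnalyticOnNhd ℂ g (closedBall 0 r) ∧
     (∀ z ∈ closedBall (0:ℂ) r, g z ≠ 0) ∧ (∀ u ∈ s, u ∈ closedBall (0:ℂ) r ∧ n u ≠ 0) ∧
     (∀ z ∈ closedBall (0:ℂ) r, f z = (∏ u ∈ s, (z - u) ^ n u) * g z) := by
  set U := closedBall (0:ℂ) r with hU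
  have hm0 : (0:ℂ) ∈ U := mem_closedBall_self hr.le
  have hpre : IsPreconnected U := (convex_closedBall 0 r).isPreconnected
  have hmer : MeromorphicOn f U := hf.meromorphicOn
  have hord : ∀ u : U, meromorphicOrderAt f u ≠ ⊤ := by
    have h00 : meromorphicOrderAt f (0:ℂ) ≠ ⊤ := by
      have : meromorphicOrderAt f (0:ℂ) = 0 := by
        rw [(hf 0 hm0).meromorphicOrderAt_eq, (hf 0 hm0).analyticOrderAt_eq_zero.2 h0]; rfl
      rw [this]; exact WithTop.zero_ne_top
    intro u
    exact hmer.meromorphicOrderAt_ne_top_of_isPreconnected hpre hm0 u.2 h00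
  have hfin : (MeromorphicOn.divisor f U).support.Finite := 
    (MeromorphicOn.divisor f U).finiteSupport (isCompact_closedBall 0 r)
  obtain ⟨g, hg, hgn, hfg⟩ := hmer.extract_zeros_poles hord hfin
  have hnn : ∀ u, 0 ≤ MeromorphicOn.divisor f U u := fun u => MeromorphicOn.AnalyticOnNhd.divisor_nonneg hf u
  have hprod : (∏ᶠ u, (fun z : ℂ => z - u) ^ (MeromorphicOn.divisor f U u)) =
      fun z => ∏ u ∈ hfin.toFinset, (z - u) ^ (MeromorphicOn.divisor f U u).toNat := by
    rw [finprod_eq_prod_of_mulSupport_subset (s := hfin.toFinset)]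
    · funext z
      rw [Finset.prod_apply]
      refine Finset.prod_congr rfl fun u _ => ?_
      rw [Pi.pow_apply, ← zpow_natCast, Int.toNat_of_nonneg (hnn u)]
    · intro u hu
      simp only [Finite.coe_toFinset, Function.mem_support]
      intro h; apply hu; simp [h]
  refine ⟨hfin.toFinset, fun u => (MeromorphicOn.divisor f U u).toNat, g, hg, fun z hz => hgn ⟨z, hz⟩, ?_, ?_⟩
  · intro u hu
    rw [Finite.mem_toFinset] at hu
    refine ⟨(MeromorphicOn.divisor f U).supportWithinDomain hu, ?_⟩
    have := hnn u
    rw [Function.mem_support] at hu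
    simp only []
    omega
  · rw [hprod] at hfg
    have hPa : AnalyticOnNhd ℂ (fun z => (∏ u ∈ hfin.toFinset, (z - u) ^ (MeromorphicOn.divisor f U u).toNat) * g z) U := by
      intro z hz
      exact AnalyticAt.mul (by fun_prop) (hg z hz)
    have hacc : AccPt (0:ℂ) (𝓟 U) := by
      have : U ∈ 𝓝 (0:ℂ) := closedBall_mem_nhds _ hr
      rw [accPt_iff_frequently_nhdsNE]
      exact Filter.Eventually.frequently (mem_nhdsWithin_of_mem_nhds this)
    have := (hf 0 hm0).meromorphicAt.eventuallyEq_nhdsNE_of_eventuallyEq_codiscreteWithin (hPa 0 hm0).meromorphicAt hm0 hacc hfg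
    exact hf.eqOn_of_preconnected_of_frequently_eq hPa hpre hm0 this.frequently

theorem pj {f : ℂ → ℂ} {r : ℝ} (hr : 0 < r) (hf : AnalyticOnNhd ℂ f (closedBall 0 r)) (h0 : f 0 ≠ 0)
    (hs : ∀ z ∈ sphere (0:ℂ) r, f z ≠ 0) (hz : ∀ z ∈ ball (0:ℂ) r, f z = 0 → z.re ≤ 0) :
    (1 / (Real.pi * r) : ℝ) * (∫ θ in (0:ℝ)..2 * Real.pi, Real.log ‖f (circleMap 0 r θ)‖ * Real.cos θ)
      ≤ (logDeriv f 0).re ∧ ∀ ρ ∈ ball (0:ℂ) r, f ρ = 0 →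
    (1 / (Real.pi * r) : ℝ) * (∫ θ in (0:ℝ)..2 * Real.pi, Real.log ‖f (circleMap 0 r θ)‖ * Real.cos θ)
      + zc r ρ ≤ (logDeriv f 0).re := by
  obtain ⟨s, n, g, hg, hgn, hsu, hfg⟩ := exists_fac hr hf h0
  have hzero : ∀ u ∈ s, f u = 0 := by
    intro u hu
    rw [hfg u (hsu u hu).1, Finset.prod_eq_zero hu (by simp [(hsu u hu).2]), zero_mul]
  have hsb : ∀ u ∈ s, u ∈ ball (0:ℂ) r ∧ u ≠ 0 := by
    intro u hu
    constructor
    · rcases (ball_union_sphere (x := (0:ℂ)) (ε := r)).symm ▸ (hsu u hu).1 with h | h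
      · exact h
      · exact absurd (hzero u hu) (hs u h)
    · rintro rfl; exact h0 (hzero _ hu)
  have key := pj_fac hr s n hsb hg hgn hfg
  have hnn : ∀ u ∈ s, 0 ≤ n u * zc r u := by
    intro u hu
    have h1 := hsb u hu
    exact mul_nonneg (Nat.cast_nonneg _) (zc_nonneg h1.2 (mem_ball_zero_iff.1 h1.1).le (hz u h1.1 (hzero u hu)))
  rw [key]
  refine ⟨by linarith [Finset.sum_nonneg hnn], fun ρ hρ hρ0 => ?_⟩
  have hmem : ρ ∈ s := by
    have h1 := hfg ρ (ball_subset_closedBall hρ)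
    rw [hρ0] at h1
    rcases mul_eq_zero.1 h1.symm with h | h
    · obtain ⟨u, hu, h2⟩ := Finset.prod_eq_zero_iff.1 h
      have := eq_zero_of_pow_eq_zero h2
      rw [sub_eq_zero.1 this]; exact hu
    · exact absurd h (hgn ρ (ball_subset_closedBall hρ))
  have h2 := Finset.single_le_sum hnn hmem
  have h3 : (1:ℝ) ≤ n ρ := by exact_mod_cast Nat.one_le_iff_ne_zero.2 (hsu ρ hmem).2
  have h4 : 0 ≤ zc r ρ := zc_nonneg (hsb ρ hmem).2 (mem_ball_zero_iff.1 hρ).le (hz ρ hρ hρ0)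
  nlinarith
end

section
open Complex Metric Set Filter Topology MeasureTheory

noncomputable def qf (u : ℝ) : ℝ := Int.fract u - 1 / 2
noncomputable def Jz (s : ℂ) : ℂ := ∫ u in Ioi (1:ℝ), (qf u : ℂ) * (u : ℂ) ^ (-(s + 1))
noncomputable def Fz (s : ℂ) : ℂ := (s + 1) / (2 * s) - (s - 1) * Jz s

theorem qf_abs (u : ℝ) : |qf u| ≤ 1 / 2 := by
  unfold qf; rw [abs_le]
  constructor <;> linarith [Int.fract_nonneg u, (Int.fract_lt_one u).le]

theorem qf_meas : Measurable qf := by unfold qf; exact measurable_fract.sub_const _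

theorem Jz_norm {s : ℂ} (hs : 0 < s.re) : ‖Jz s‖ ≤ 1 / (2 * s.re) := by
  unfold Jz
  have h1 : ∀ u ∈ Ioi (1:ℝ), ‖(qf u : ℂ) * (u : ℂ) ^ (-(s + 1))‖ ≤ 1 / 2 * u ^ (-(s.re + 1)) := by
    intro u hu
    have hu0 : (0:ℝ) < u := lt_trans one_pos hu
    rw [norm_mul, Complex.norm_real, Complex.norm_cpow_eq_rpow_re_of_pos hu0]
    simp only [neg_add_rev, Complex.add_re, Complex.neg_re, Complex.one_re, Real.norm_eq_abs]
    gcongr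
    exact qf_abs u
  have hi : IntegrableOn (fun u : ℝ => 1 / 2 * u ^ (-(s.re + 1))) (Ioi 1) :=
    (integrableOn_Ioi_rpow_of_lt (by linarith) one_pos).const_mul _
  calc _ ≤ ∫ u in Ioi (1:ℝ), 1 / 2 * u ^ (-(s.re + 1)) :=
        norm_integral_le_of_norm_le hi ((ae_restrict_iff' measurableSet_Ioi).2 (ae_of_all _ h1))
    _ = _ := by
      rw [integral_const_mul, integral_Ioi_rpow_of_lt (by linarith) one_pos]
      simp; field_simp

theorem Fz_norm {s : ℂ} (hs : 0 < s.re) : ‖Fz s‖ ≤ ‖s + 1‖ / (2 * ‖s‖) + ‖s - 1‖ / (2 * s.re) := by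
  unfold Fz
  refine (norm_sub_le _ _).trans ?_
  rw [norm_div, norm_mul, norm_mul, div_eq_mul_one_div ‖s - 1‖]
  simp only [Complex.norm_ofNat]
  gcongr
  exact Jz_norm hs

theorem Jz_diff {s : ℂ} (hs : 0 < s.re) : DifferentiableAt ℂ Jz s := by
  have e : Jz = fun s => mellin (indicator (Ioi (1:ℝ)) fun u => (qf u : ℂ)) (-s) := by
    funext s
    unfold Jz mellin
    rw [← integral_indicator measurableSet_Ioi, ← integral_indicator measurableSet_Ioi]
    congr 1; funext u
    by_cases hu : u ∈ Ioi (1:ℝ)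
    · have : u ∈ Ioi (0:ℝ) := mem_Ioi.2 (lt_trans one_pos hu)
      simp only [indicator_of_mem hu, indicator_of_mem this, smul_eq_mul]
      rw [mul_comm]; congr 2; ring
    · rw [indicator_of_notMem hu]
      by_cases h0 : u ∈ Ioi (0:ℝ)
      · rw [indicator_of_mem h0, indicator_of_notMem hu]; simp
      · rw [indicator_of_notMem h0]
  have hb : ∀ u, ‖(indicator (Ioi (1:ℝ)) (fun u => (qf u : ℂ))) u‖ ≤ 1 / 2 := by
    intro u
    refine (norm_indicator_le_norm_self _ _).trans ?_
    rw [Complex.norm_real]; exact qf_abs u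
  rw [e]
  refine DifferentiableAt.comp (g := mellin ((Ioi (1:ℝ)).indicator fun u => (qf u : ℂ))) s (f := fun s : ℂ => -s) ?_ differentiable_neg.differentiableAt
  refine mellin_differentiableAt_of_isBigO_rpow (a := 0) (b := -s.re - 1) ?_ ?_ ?_ ?_ ?_
  · refine LocallyIntegrable.locallyIntegrableOn ?_ _
    refine (locallyIntegrable_const (1/2:ℝ)).mono ?_ (ae_of_all _ fun u => ?_)
    · exact ((Complex.measurable_ofReal.comp qf_meas).indicator measurableSet_Ioi).aestronglyMeasurable
    · simpa using hb u
  · simp only [neg_zero, Real.rpow_zero]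
    exact Asymptotics.isBigO_of_le' (c := 1/2) _ fun u => by simpa using hb u
  · simpa using hs
  · refine Filter.EventuallyEq.trans_isBigO (f₂ := fun _ => 0) ?_ (Asymptotics.isBigO_zero _ _)
    filter_upwards [nhdsWithin_le_nhds (Iio_mem_nhds (show (0:ℝ) < 1 by norm_num))] with u hu
    rw [indicator_of_notMem]; simp only [mem_Ioi, not_lt]; exact (mem_Iio.1 hu).le
  · simp

theorem Fz_diff {s : ℂ} (hs : 0 < s.re) : DifferentiableAt ℂ Fz s := by
  have h0 : s ≠ 0 := by rintro rfl; simp at hs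
  unfold Fz
  have := Jz_diff hs
  fun_prop (disch := simpa using h0)

theorem Fz_analytic {s : ℂ} (hs : 0 < s.re) : AnalyticAt ℂ Fz s := by
  have ho : IsOpen {z : ℂ | 0 < z.re} := isOpen_lt continuous_const Complex.continuous_re
  exact DifferentiableOn.analyticAt (s := {z : ℂ | 0 < z.re}) (fun z hz => (Fz_diff hz).differentiableWithinAt) (ho.mem_nhds hs)

theorem Fz_eq {s : ℂ} (hs : 1 < s.re) : Fz s = riemannZeta s * (s - 1) / s := by
  have h0 : s ≠ 0 := by rintro rfl; simp at hs; linarith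
  have h1 : s - 1 ≠ 0 := by intro h; rw [sub_eq_zero.1 h] at hs; simp at hs
  have hz : riemannZeta s = s * ∫ t in Ioi (1:ℝ), ((⌊t⌋₊ : ℝ) : ℂ) * (t:ℂ) ^ (-(s + 1)) := by
    rw [← LSeries_one_eq_riemannZeta hs, LSeries_eq_mul_integral' 1 zero_le_one hs]
    · simp
    · simp only [Pi.one_apply, norm_one, Finset.sum_const, Nat.card_Icc, nsmul_eq_mul, Real.rpow_one]
      simpa using Asymptotics.isBigO_refl _ _
  have hi1 : IntegrableOn (fun t : ℝ => (t:ℂ) ^ (-s)) (Ioi 1) :=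
    integrableOn_Ioi_cpow_of_lt (by simpa using hs) one_pos
  have hi2 : IntegrableOn (fun t : ℝ => (1/2:ℂ) * (t:ℂ) ^ (-(s+1))) (Ioi 1) :=
    (integrableOn_Ioi_cpow_of_lt (by simp; linarith) one_pos).const_mul _
  have hi3 : IntegrableOn (fun t : ℝ => (qf t : ℂ) * (t:ℂ) ^ (-(s+1))) (Ioi 1) := by
    have := (integrableOn_Ioi_cpow_of_lt (a := -(s+1)) (by simp; linarith) one_pos)
    refine Integrable.bdd_mul (c := 1/2) this ?_ (ae_of_all _ fun u => ?_)
    · exact (Complex.measurable_ofReal.comp qf_meas).aestronglyMeasurable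
    · rw [Complex.norm_real]; exact qf_abs u
  have : (∫ t in Ioi (1:ℝ), ((⌊t⌋₊ : ℝ) : ℂ) * (t:ℂ) ^ (-(s + 1))) =
      (∫ t in Ioi (1:ℝ), (t:ℂ) ^ (-s)) - (∫ t in Ioi (1:ℝ), (1/2:ℂ) * (t:ℂ) ^ (-(s+1))) - Jz s := by
    unfold Jz
    rw [← integral_sub hi1 hi2, ← integral_sub (f := fun t : ℝ => (t:ℂ) ^ (-s) - (1/2:ℂ) * (t:ℂ) ^ (-(s+1))) (hi1.sub hi2) hi3]
    refine setIntegral_congr_fun measurableSet_Ioi fun t ht => ?_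
    have ht0 : (0:ℝ) < t := lt_trans one_pos ht
    have htc : (t:ℂ) ≠ 0 := by exact_mod_cast ht0.ne'
    have e : (t:ℂ) ^ (-s) = t * (t:ℂ) ^ (-(s+1)) := by
      rw [show -s = 1 + (-(s+1)) by ring, Complex.cpow_add _ _ htc, Complex.cpow_one]
    have fl : (⌊t⌋₊ : ℝ) = t - Int.fract t := by
      rw [natCast_floor_eq_intCast_floor ht0.le]; linarith [Int.floor_add_fract t]
    beta_reduce
    rw [e, fl]; unfold qf; push_cast; ring
  rw [this, integral_Ioi_cpow_of_lt (by simpa using hs) one_pos, integral_const_mul, integral_Ioi_cpow_of_lt (by simp; linarith) one_pos] at hz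
  rw [hz]; unfold Fz
  have h2 : -s + 1 ≠ 0 := by intro h; apply h1; linear_combination -h
  have h3 : -(s+1) + 1 ≠ 0 := by intro h; apply h0; linear_combination -h
  simp only [Complex.ofReal_one, Complex.one_cpow]
  field_simp
  ring
end

section
open Complex Metric Set Filter Topology MeasureTheory
open scoped LSeries.notation ArithmeticFunction.vonMangoldt ArithmeticFunction.Moebius

noncomputable def Kz (s : ℂ) : ℂ := LSeries (fun n => (Λ n : ℂ)) s

theorem Fz_real_le {x : ℝ} (hx : 1 < x) : ‖riemannZeta x‖ ≤ x / (x - 1) := by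
  have h := Fz_norm (s := x) (by simp; linarith)
  rw [Fz_eq (by simpa using hx)] at h
  have e1 : ‖(x:ℂ) - 1‖ = x - 1 := by
    rw [show (x:ℂ) - 1 = ((x - 1 : ℝ) : ℂ) by push_cast; ring, Complex.norm_real, Real.norm_of_nonneg (by linarith)]
  have e2 : ‖(x:ℂ) + 1‖ = x + 1 := by
    rw [show (x:ℂ) + 1 = ((x + 1 : ℝ) : ℂ) by push_cast; ring, Complex.norm_real, Real.norm_of_nonneg (by linarith)]
  have e3 : ‖(x:ℂ)‖ = x := by rw [Complex.norm_real, Real.norm_of_nonneg (by linarith)]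
  rw [norm_div, norm_mul, e1, e2, e3, Complex.ofReal_re] at h
  have h1 : 0 < x - 1 := by linarith
  rw [le_div_iff₀ h1]
  have : (x + 1) / (2 * x) + (x - 1) / (2 * x) = 1 := by field_simp; ring
  rw [this, div_le_iff₀ (by linarith)] at h
  linarith

theorem zeta_lower {s : ℂ} (hs : 1 < s.re) : (s.re - 1) / s.re ≤ ‖riemannZeta s‖ := by
  have h1 : ‖(LSeries (fun n => ((μ n : ℤ) : ℂ)) s)‖ ≤ s.re / (s.re - 1) := by
    refine le_trans ?_ (Fz_real_le hs)
    have hs' : 1 < (s.re : ℂ).re := by simpa using hs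
    have e : ‖riemannZeta s.re‖ = ∑' n, ‖LSeries.term 1 s n‖ := by
      rw [← LSeries_one_eq_riemannZeta hs', LSeries]
      have : ∀ n, LSeries.term 1 (s.re : ℂ) n = ((‖LSeries.term 1 s n‖ : ℝ) : ℂ) := by
        intro n
        rcases Nat.eq_zero_or_pos n with rfl | hn
        · simp
        · rw [LSeries.norm_term_eq, LSeries.term_of_ne_zero hn.ne', if_neg hn.ne']
          simp only [Pi.one_apply, norm_one]
          push_cast
          rw [Complex.ofReal_cpow (Nat.cast_nonneg n)]; simp
      simp_rw [this]
      rw [← Complex.ofReal_tsum, Complex.norm_real, Real.norm_of_nonneg (tsum_nonneg fun _ => norm_nonneg _)]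
    rw [e, LSeries]
    have hs1 := (LSeriesSummable_one_iff.2 hs).norm
    refine tsum_of_norm_bounded hs1.hasSum fun n => ?_
    refine LSeries.norm_term_le s ?_
    simp only [Pi.one_apply, norm_one]
    have := ArithmeticFunction.abs_moebius_le_one (n := n)
    rw [Complex.norm_intCast]; exact_mod_cast this
  have h2 : riemannZeta s * LSeries (fun n => ((μ n : ℤ) : ℂ)) s = 1 := by
    rw [← ArithmeticFunction.LSeries_zeta_eq_riemannZeta hs]
    exact ArithmeticFunction.LSeries_zeta_mul_Lseries_moebius hs
  have h3 : ‖riemannZeta s‖ * ‖LSeries (fun n => ((μ n : ℤ) : ℂ)) s‖ = 1 := by rw [← norm_mul, h2, norm_one]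
  have h4 : 0 < s.re - 1 := by linarith
  rw [div_le_iff₀ (by linarith)]
  have : 1 ≤ ‖riemannZeta s‖ * (s.re / (s.re - 1)) := by
    refine h3.ge.trans ?_; gcongr
  rw [← mul_div_assoc, le_div_iff₀ h4] at this
  linarith

theorem Fz_ne_right {s : ℂ} (hs : 1 < s.re) : Fz s ≠ 0 := by
  rw [Fz_eq hs]
  have h0 : s ≠ 0 := by rintro rfl; simp at hs; linarith
  have h1 : s - 1 ≠ 0 := by intro h; rw [sub_eq_zero.1 h] at hs; simp at hs
  exact div_ne_zero (mul_ne_zero (riemannZeta_ne_zero_of_one_lt_re hs) h1) h0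

theorem Kz_eq {s : ℂ} (hs : 1 < s.re) : Kz s = - logDeriv Fz s + 1 / (s - 1) - 1 / s := by
  have h0 : s ≠ 0 := by rintro rfl; simp at hs; linarith
  have h1 : s - 1 ≠ 0 := by intro h; rw [sub_eq_zero.1 h] at hs; simp at hs
  have hz := riemannZeta_ne_zero_of_one_lt_re hs
  have hd : DifferentiableAt ℂ riemannZeta s := differentiableAt_riemannZeta (sub_ne_zero.1 h1)
  have he : Fz =ᶠ[𝓝 s] fun s => riemannZeta s * (s - 1) / s := by
    filter_upwards [(isOpen_lt continuous_const Complex.continuous_re).mem_nhds hs] with z hz using Fz_eq hz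
  have hD : HasDerivAt (fun s => riemannZeta s * (s - 1) / s)
     (((deriv riemannZeta s * (s - 1) + riemannZeta s * 1) * s - riemannZeta s * (s - 1) * 1) / s ^ 2) s :=
    (hd.hasDerivAt.mul ((hasDerivAt_id s).sub_const 1)).div (hasDerivAt_id s) h0
  unfold Kz
  rw [ArithmeticFunction.LSeries_vonMangoldt_eq_deriv_riemannZeta_div hs, logDeriv_apply, he.deriv_eq, he.eq_of_nhds, hD.deriv]
  field_simp; ring

theorem trig_pos (x : ℝ) : 0 ≤ 5 + 8 * Real.cos x + 4 * Real.cos (2 * x) + Real.cos (3 * x) := by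
  rw [Real.cos_two_mul, Real.cos_three_mul]
  have h := Real.neg_one_le_cos x
  nlinarith [mul_nonneg (by linarith : 0 ≤ 1 + Real.cos x) (sq_nonneg (1 + 2 * Real.cos x))]

theorem Kz_trig {x : ℝ} (hx : 1 < x) (t : ℝ) :
    0 ≤ 5 * (Kz x).re + 8 * (Kz (x + t * I)).re + 4 * (Kz (x + (2 * t : ℝ) * I)).re + (Kz (x + (3 * t : ℝ) * I)).re := by
  have key : ∀ u : ℝ, HasSum (fun n : ℕ => if n = 0 then 0 else Λ n * (n:ℝ) ^ (-x) * Real.cos (u * Real.log n)) (Kz (x + u * I)).re := by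
    intro u
    have h := (ArithmeticFunction.LSeriesSummable_vonMangoldt (s := x + u * I) (by simpa using hx)).hasSum
    have h2 := Complex.hasSum_re h
    have hfun : ∀ n, (if n = 0 then 0 else Λ n * (n:ℝ) ^ (-x) * Real.cos (u * Real.log n)) = (LSeries.term (fun n => (Λ n : ℂ)) (x + u * I) n).re := ?_
    · rw [funext hfun]; exact h2
    intro n; symm
    rcases Nat.eq_zero_or_pos n with rfl | hn
    · simp
    · have hn0 : (0:ℝ) < n := by exact_mod_cast hn
      have hnc : (n:ℂ) ≠ 0 := by exact_mod_cast hn.ne'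
      rw [LSeries.term_of_ne_zero hn.ne', if_neg hn.ne', div_eq_mul_inv, ← Complex.cpow_neg, Complex.re_ofReal_mul, mul_assoc]
      congr 1
      rw [Complex.cpow_def_of_ne_zero hnc, Complex.exp_re, ← Complex.natCast_log, Real.rpow_def_of_pos hn0]
      simp only [neg_add_rev, Complex.mul_re, Complex.mul_im, Complex.ofReal_re, Complex.ofReal_im, Complex.add_re, Complex.add_im, Complex.neg_re, Complex.neg_im, Complex.I_re, Complex.I_im]
      congr 1
      · congr 1; ring
      · rw [← Real.cos_neg]; congr 1; ring
  have h0 := key 0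
  have h1 := key t
  have h2 := key (2 * t)
  have h3 := key (3 * t)
  rw [Complex.ofReal_zero, zero_mul, add_zero] at h0
  have := (((h0.mul_left 5).add (h1.mul_left 8)).add (h2.mul_left 4)).add h3
  refine this.nonneg fun n => ?_
  rcases Nat.eq_zero_or_pos n with rfl | hn
  · simp
  · simp only [if_neg hn.ne']
    have hp := trig_pos (t * Real.log n)
    have hl : 0 ≤ Λ n * (n:ℝ) ^ (-x) := mul_nonneg ArithmeticFunction.vonMangoldt_nonneg (by positivity)
    have e2 : 2 * t * Real.log n = 2 * (t * Real.log n) := by ring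
    have e3 : 3 * t * Real.log n = 3 * (t * Real.log n) := by ring
    rw [e2, e3, zero_mul, Real.cos_zero]
    nlinarith [mul_nonneg hl hp]

theorem Jz_deriv_norm {s : ℂ} (hs : 1 ≤ s.re) : ‖deriv Jz s‖ ≤ 2 := by
  have hh : ∀ z ∈ closedBall s (1/2), 1 / 2 ≤ z.re := by
    intro z hz
    have := (Complex.abs_re_le_norm (z - s)).trans (by simpa [dist_eq_norm] using hz)
    rw [Complex.sub_re, abs_le] at this; linarith [this.1]
  have := Complex.norm_deriv_le_of_forall_mem_sphere_norm_le (c := s) (R := 1/2) (C := 1) (f := Jz) (by norm_num) ?_ ?_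
  · simpa using this
  · refine DifferentiableOn.diffContOnCl fun z hz => (Jz_diff ?_).differentiableWithinAt
    rw [closure_ball _ (by norm_num)] at hz
    linarith [hh z hz]
  · intro z hz
    have h1 := hh z (sphere_subset_closedBall hz)
    refine (Jz_norm (by linarith)).trans ?_
    rw [div_le_one (by linarith)]; linarith

theorem Fz_deriv {s : ℂ} (hs : 0 < s.re) : deriv Fz s = - 1 / (2 * s ^ 2) - Jz s - (s - 1) * deriv Jz s := by
  have h0 : s ≠ 0 := by rintro rfl; simp at hs
  have : HasDerivAt Fz ((1 * (2 * s) - (s + 1) * (2 * 1)) / (2 * s) ^ 2 - (1 * Jz s + (s - 1) * deriv Jz s)) s :=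
    (((hasDerivAt_id s).add_const 1).div ((hasDerivAt_id s).const_mul 2) (by simpa using h0)).sub
      (((hasDerivAt_id s).sub_const 1).mul (Jz_diff hs).hasDerivAt)
  rw [this.deriv]; field_simp; ring

theorem Kz_real {d : ℝ} (hd : 0 < d) (hd1 : d ≤ 1 / 10) : (Kz (1 + d : ℝ)).re ≤ 1 / d + 6 * d := by
  rw [Kz_eq (by simpa using hd), logDeriv_apply]
  set s : ℂ := ((1 + d : ℝ) : ℂ) with hs
  have hre : s.re = 1 + d := by simp [hs]
  have hs1 : s - 1 = (d : ℂ) := by rw [hs]; push_cast; ring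
  have hnd : ‖(d:ℂ)‖ = d := by rw [Complex.norm_real, Real.norm_of_nonneg hd.le]
  have hns : ‖s‖ = 1 + d := by rw [hs, Complex.norm_real, Real.norm_of_nonneg (by linarith)]
  have hJ := Jz_norm (s := s) (by rw [hre]; linarith)
  have hJ' := Jz_deriv_norm (s := s) (by rw [hre]; linarith)
  have hJ2 : ‖Jz s‖ ≤ 1 / 2 := hJ.trans (by rw [hre, div_le_div_iff₀ (by linarith) (by norm_num)]; linarith)
  have h1 : ‖deriv Fz s‖ ≤ 1 + 2 * d := by
    rw [Fz_deriv (by rw [hre]; linarith), hs1]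
    refine (norm_sub_le _ _).trans ?_
    refine (add_le_add (norm_sub_le _ _) le_rfl).trans ?_
    rw [norm_mul, norm_div, norm_mul, norm_pow, hns, hnd]
    have : ‖(-1:ℂ)‖ / (‖(2:ℂ)‖ * (1 + d) ^ 2) ≤ 1 / 2 := by
      simp only [norm_neg, norm_one, Complex.norm_ofNat]
      rw [div_le_div_iff₀ (by positivity) (by norm_num)]; nlinarith
    nlinarith
  have h2 : 1 - d ≤ ‖Fz s‖ := by
    have hF : Fz s = (((d + 2) / (2 * (1 + d)) : ℝ) : ℂ) - d * Jz s := by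
      unfold Fz; rw [hs1, hs]; push_cast; ring
    rw [hF]
    refine le_trans ?_ (norm_sub_norm_le _ _)
    rw [Complex.norm_real, Real.norm_of_nonneg (by positivity), norm_mul, hnd]
    have : 1 - d / 2 ≤ (d + 2) / (2 * (1 + d)) := by rw [le_div_iff₀ (by positivity)]; nlinarith
    nlinarith
  have h3 : ‖deriv Fz s / Fz s‖ ≤ (1 + 2 * d) / (1 - d) := by
    rw [norm_div]
    have : 0 < 1 - d := by linarith
    gcongr
  have h4 : -(deriv Fz s / Fz s).re ≤ (1 + 2 * d) / (1 - d) :=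
    (neg_le_abs _).trans ((Complex.abs_re_le_norm _).trans h3)
  have e1 : (1 / (s - 1)).re = 1 / d := by
    rw [hs1, show (1:ℂ) / d = ((1 / d : ℝ) : ℂ) by push_cast; ring, Complex.ofReal_re]
  have e2 : (1 / s).re = 1 / (1 + d) := by
    rw [hs, show (1:ℂ) / ((1 + d : ℝ) : ℂ) = ((1 / (1 + d) : ℝ) : ℂ) by push_cast; ring, Complex.ofReal_re]
  rw [Complex.sub_re, Complex.add_re, Complex.neg_re, e1, e2]
  have h5 : (1 + 2 * d) / (1 - d) - 1 / (1 + d) ≤ 6 * d := by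
    rw [div_sub_div _ _ (by linarith) (by linarith), div_le_iff₀ (by nlinarith)]
    nlinarith [mul_pos hd hd]
  linarith

theorem Fz_ne_low {s : ℂ} (hs : 9 / 10 ≤ s.re) (hs1 : s.re ≤ 1) (ht : |s.im| ≤ 27 / 20) (hs2 : 49/50 ≤ s.re) : Fz s ≠ 0 := by
  intro h
  have h1 : (s + 1) / (2 * s) = (s - 1) * Jz s := by rw [← sub_eq_zero]; exact h
  have h0 : s ≠ 0 := by rintro rfl; simp at hs; linarith
  have h2 : ‖s + 1‖ / (2 * ‖s‖) ≤ ‖s - 1‖ * (1 / (2 * s.re)) := by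
    have : ‖(s + 1) / (2 * s)‖ = ‖(s - 1) * Jz s‖ := by rw [h1]
    rw [norm_div, norm_mul, norm_mul, Complex.norm_ofNat] at this
    rw [this]; gcongr; exact Jz_norm (by linarith)
  have hp : 0 < ‖s‖ := norm_pos_iff.2 h0
  have h3 : ‖s + 1‖ * s.re ≤ ‖s - 1‖ * ‖s‖ := by
    rw [mul_one_div, div_le_div_iff₀ (by positivity) (by linarith)] at h2; linarith
  have h4 : (‖s + 1‖ * s.re) ^ 2 ≤ (‖s - 1‖ * ‖s‖) ^ 2 := by gcongr
  rw [mul_pow, mul_pow, ← Complex.normSq_eq_norm_sq, ← Complex.normSq_eq_norm_sq, ← Complex.normSq_eq_norm_sq, Complex.normSq_apply, Complex.normSq_apply, Complex.normSq_apply] at h4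
  simp only [Complex.add_re, Complex.sub_re, Complex.one_re, Complex.add_im, Complex.sub_im, Complex.one_im, add_zero, sub_zero] at h4
  have ht2 : s.im * s.im ≤ 1.8225 := by
    rw [← abs_mul_abs_self]; nlinarith [abs_nonneg s.im]
  set a := s.re
  set b := s.im * s.im with hb
  have hb0 : 0 ≤ b := mul_self_nonneg _
  have i1 : (a - 1) * (a - 1) ≤ 0.0004 := by nlinarith
  have i2 : a * a ≤ 1 := by nlinarith
  have i3 : 0.96 ≤ a * a := by nlinarith
  have i4 : (3.92 + b) * 0.96 ≤ ((a + 1) * (a + 1) + b) * a ^ 2 := by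
    have : 3.92 ≤ (a+1)*(a+1) := by nlinarith
    have h6 : 0.96 ≤ a ^ 2 := by nlinarith
    gcongr
  have i5 : ((a - 1) * (a - 1) + b) * (a * a + b) ≤ (0.0004 + b) * (1 + b) := by gcongr
  nlinarith
end

section
open Complex Metric Set Filter Topology MeasureTheory

theorem phi_bd {c : ℝ} (hc : 0 < c) : c * Real.log (1 + 1 / (0.88 * c)) ≤ 0.368 * c + 0.4182 := by
  have he := Real.exp_one_gt_d9
  have h1 : Real.log (1 + 1 / (0.88 * c)) ≤ (1 + 1 / (0.88 * c)) / Real.exp 1 := by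
    have hy : 0 < 1 + 1 / (0.88 * c) := by positivity
    have := Real.log_le_sub_one_of_pos (div_pos hy (Real.exp_pos 1))
    rw [Real.log_div hy.ne' (Real.exp_pos 1).ne', Real.log_exp] at this
    linarith
  have h2 : (1 + 1 / (0.88 * c)) / Real.exp 1 ≤ (1 + 1 / (0.88 * c)) / 2.7182818 := by gcongr; linarith
  calc c * Real.log (1 + 1 / (0.88 * c)) ≤ c * ((1 + 1 / (0.88 * c)) / 2.7182818) := by gcongr; linarith
    _ = c / 2.7182818 + 1 / (0.88 * 2.7182818) := by field_simp
    _ ≤ _ := by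
      have : c / 2.7182818 ≤ 0.368 * c := by rw [div_le_iff₀ (by norm_num)]; nlinarith
      have : (1:ℝ) / (0.88 * 2.7182818) ≤ 0.4182 := by norm_num
      linarith

theorem exists_r {f : ℂ → ℂ} (hf : AnalyticOnNhd ℂ f (closedBall 0 0.9)) (h0 : f 0 ≠ 0) :
    ∃ r : ℝ, 0.88 < r ∧ r < 0.9 ∧ ∀ z ∈ sphere (0:ℂ) r, f z ≠ 0 := by
  obtain ⟨s, n, g, -, hgn, -, hfg⟩ := exists_fac (by norm_num) hf h0
  have hinf : (Ioo (0.88:ℝ) 0.9).Infinite := Ioo_infinite (by norm_num)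
  obtain ⟨r, hr, hrn⟩ := hinf.exists_notMem_finset (s.image fun z => ‖z‖)
  refine ⟨r, hr.1, hr.2, fun z hz h => ?_⟩
  have hz1 : ‖z‖ = r := by simpa using hz
  have hzb : z ∈ closedBall (0:ℂ) 0.9 := by simp; rw [hz1]; have := hr.2; norm_num at this ⊢; linarith
  rw [hfg z hzb, mul_eq_zero, or_iff_left (hgn z hzb), Finset.prod_eq_zero_iff] at h
  obtain ⟨u, hu, hu0⟩ := h
  have := sub_eq_zero.1 (eq_zero_of_pow_eq_zero hu0)
  exact hrn (Finset.mem_image.2 ⟨u, hu, by rw [← this, hz1]⟩)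

theorem circ_left {s : ℂ} {τ δ : ℝ} (hd : 0 < δ) (hd1 : δ ≤ 0.02) (hτ : 1.35 ≤ |τ|)
   {z : ℂ} (hz : ‖z‖ ≤ 0.9) (hs : s = (1 + δ : ℝ) + τ * I + z) : ‖Fz s‖ ≤ 5 * |τ| + 7 := by
  have hre := (Complex.abs_re_le_norm z).trans hz
  have him := (Complex.abs_im_le_norm z).trans hz
  have e1 : s.re = 1 + δ + z.re := by rw [hs]; simp
  have e2 : s.im = τ + z.im := by rw [hs]; simp
  have h1 : 0.1 ≤ s.re := by rw [e1]; have := (abs_le.1 hre).1; linarith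
  have h2 : 0.45 ≤ ‖s‖ := by
    refine le_trans ?_ (Complex.abs_im_le_norm s)
    rw [e2]
    have := abs_sub_abs_le_abs_sub τ (-z.im)
    rw [abs_neg, sub_neg_eq_add] at this; linarith
  have h3 : ‖s - 1‖ ≤ |τ| + 0.92 := by
    have : s - 1 = (δ : ℂ) + τ * I + z := by rw [hs]; push_cast; ring
    rw [this]
    refine (norm_add₃_le).trans ?_
    rw [norm_mul, Complex.norm_I, Complex.norm_real, Complex.norm_real, Real.norm_of_nonneg hd.le, Real.norm_eq_abs]
    linarith
  refine (Fz_norm (by linarith)).trans ?_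
  have h4 : ‖s + 1‖ / (2 * ‖s‖) ≤ 1.62 := by
    rw [div_le_iff₀ (by linarith)]
    have := norm_add_le s 1
    rw [norm_one] at this; linarith
  have h5 : ‖s - 1‖ / (2 * s.re) ≤ 5 * (|τ| + 0.92) := by
    rw [div_le_iff₀ (by linarith)]; nlinarith [abs_nonneg τ]
  linarith

theorem circ_right {s : ℂ} {τ δ c k r : ℝ} (hd : 0 < δ) (hc : 0 < c) (hr : 0.88 < r) (hr9 : r < 0.9) (hk0 : 0 < k)
    (hk : ∀ u t : ℝ, 0 ≤ u → |t - τ| ≤ 0.9 → k * ((1 + u) ^ 2 + t ^ 2) ≤ u ^ 2 + t ^ 2)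
    (e1 : s.re = 1 + δ + r * c) (e2 : |s.im - τ| ≤ 0.9) :
    -(0.368 * c + 0.4182) - Real.log (1 / k) / 2 * c ≤ Real.log ‖Fz s‖ * c := by
  have hrc : 0.88 * c ≤ r * c := by gcongr
  have hs : 1 < s.re := by rw [e1]; nlinarith
  have h0 : s ≠ 0 := by rintro rfl; simp at hs; linarith
  have h1 : s - 1 ≠ 0 := by intro h; rw [sub_eq_zero.1 h] at hs; simp at hs
  rw [Fz_eq hs, norm_div, norm_mul]
  have hz : 0 < ‖riemannZeta s‖ := norm_pos_iff.2 (riemannZeta_ne_zero_of_one_lt_re hs)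
  have n0 := norm_pos_iff.2 h0
  have n1 := norm_pos_iff.2 h1
  rw [Real.log_div (by positivity) n0.ne', Real.log_mul hz.ne' n1.ne']
  have a1 : -Real.log (1 + 1 / (0.88 * c)) ≤ Real.log ‖riemannZeta s‖ := by
    rw [← Real.log_inv]
    refine Real.log_le_log (by positivity) (le_trans ?_ (zeta_lower hs))
    rw [show (1 + 1 / (0.88 * c))⁻¹ = 0.88 * c / (0.88 * c + 1) by field_simp]
    rw [div_le_div_iff₀ (by positivity) (by linarith), e1]
    nlinarith
  have a2 : -(Real.log (1 / k) / 2) ≤ Real.log ‖s - 1‖ - Real.log ‖s‖ := by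
    have := hk (s.re - 1) s.im (by linarith) e2
    have e3 : ‖s‖ ^ 2 = (1 + (s.re - 1)) ^ 2 + s.im ^ 2 := by
      rw [← Complex.normSq_eq_norm_sq, Complex.normSq_apply]; ring
    have e4 : ‖s - 1‖ ^ 2 = (s.re - 1) ^ 2 + s.im ^ 2 := by
      rw [← Complex.normSq_eq_norm_sq, Complex.normSq_apply]; simp; ring
    rw [← e3, ← e4] at this
    have := Real.log_le_log (by positivity) this
    rw [Real.log_mul hk0.ne' (by positivity), Real.log_pow, Real.log_pow] at this
    rw [one_div, Real.log_inv]; push_cast at this; linarith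
  have := phi_bd hc
  nlinarith

theorem circ_int {f : ℝ → ℝ} (hf : Continuous f) {lM lk : ℝ}
   (h1 : ∀ θ, 0 < Real.cos θ → -(0.368 * Real.cos θ + 0.4182) - lk / 2 * Real.cos θ ≤ f θ)
   (h2 : ∀ θ, Real.cos θ ≤ 0 → lM * Real.cos θ ≤ f θ) :
   -(2 * lM + 2.05 + lk) ≤ ∫ θ in (0:ℝ)..2 * Real.pi, f θ := by
  have hpi := Real.pi_pos
  have hi : ∀ a b, IntervalIntegrable f volume a b := fun a b => hf.intervalIntegrable a b
  have h1' : ∀ θ, 0 ≤ Real.cos θ → Real.cos θ = 0 → -(0.368 * Real.cos θ + 0.4182) - lk / 2 * Real.cos θ ≤ f θ := by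
    intro θ _ h; have := h2 θ h.le; rw [h] at this ⊢; linarith
  have h1'' : ∀ θ, 0 ≤ Real.cos θ → -(0.368 * Real.cos θ + 0.4182) - lk / 2 * Real.cos θ ≤ f θ := by
    intro θ h; rcases h.eq_or_lt with h' | h'
    · exact h1' θ h h'.symm
    · exact h1 θ h'
  have s1 : (∫ θ in (0:ℝ)..2 * Real.pi, f θ) = (∫ θ in (0:ℝ)..Real.pi/2, f θ) + (∫ θ in (Real.pi/2)..(3*Real.pi/2), f θ) + ∫ θ in (3*Real.pi/2)..2*Real.pi, f θ := by
    rw [intervalIntegral.integral_add_adjacent_intervals (hi _ _) (hi _ _), intervalIntegral.integral_add_adjacent_intervals (hi _ _) (hi _ _)]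
  have cg : Continuous fun θ => -(0.368 * Real.cos θ + 0.4182) - lk / 2 * Real.cos θ := by fun_prop
  have ev : ∀ a b : ℝ, ∫ θ in a..b, (-(0.368 * Real.cos θ + 0.4182) - lk / 2 * Real.cos θ) = -(0.368 + lk / 2) * (Real.sin b - Real.sin a) - 0.4182 * (b - a) := by
    intro a b
    have : ∀ θ, -(0.368 * Real.cos θ + 0.4182) - lk / 2 * Real.cos θ = -(0.368 + lk / 2) * Real.cos θ - 0.4182 := fun θ => by ring
    simp_rw [this]
    rw [intervalIntegral.integral_sub (by apply Continuous.intervalIntegrable; fun_prop) (by simp), intervalIntegral.integral_const_mul, integral_cos, intervalIntegral.integral_const, smul_eq_mul]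
    ring
  have sin3 : Real.sin (3 * Real.pi / 2) = -1 := by
    rw [show 3 * Real.pi / 2 = Real.pi / 2 + Real.pi by ring, Real.sin_add_pi, Real.sin_pi_div_two]
  have b1 : (∫ θ in (0:ℝ)..Real.pi/2, (-(0.368 * Real.cos θ + 0.4182) - lk / 2 * Real.cos θ)) ≤ ∫ θ in (0:ℝ)..Real.pi/2, f θ := by
    refine intervalIntegral.integral_mono_on (by linarith) (cg.intervalIntegrable _ _) (hi _ _) fun θ hθ => h1'' θ ?_
    exact Real.cos_nonneg_of_neg_pi_div_two_le_of_le (by linarith [hθ.1]) hθ.2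
  have b2 : (∫ θ in (Real.pi/2)..(3*Real.pi/2), lM * Real.cos θ) ≤ ∫ θ in (Real.pi/2)..(3*Real.pi/2), f θ := by
    refine intervalIntegral.integral_mono_on (by linarith) (Continuous.intervalIntegrable (by fun_prop) _ _) (hi _ _) fun θ hθ => h2 θ ?_
    exact Real.cos_nonpos_of_pi_div_two_le_of_le hθ.1 (by linarith [hθ.2])
  have b3 : (∫ θ in (3*Real.pi/2)..2*Real.pi, (-(0.368 * Real.cos θ + 0.4182) - lk / 2 * Real.cos θ)) ≤ ∫ θ in (3*Real.pi/2)..2*Real.pi, f θ := by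
    refine intervalIntegral.integral_mono_on (by linarith) (cg.intervalIntegrable _ _) (hi _ _) fun θ hθ => h1'' θ ?_
    rw [← Real.cos_sub_two_pi]
    exact Real.cos_nonneg_of_neg_pi_div_two_le_of_le (by linarith [hθ.1]) (by linarith [hθ.2])
  rw [ev, Real.sin_pi_div_two, Real.sin_zero] at b1
  rw [intervalIntegral.integral_const_mul, integral_cos, sin3, Real.sin_pi_div_two] at b2
  rw [ev, sin3, Real.sin_two_pi] at b3
  rw [s1]
  have := Real.pi_lt_d4
  linarith

theorem circ {τ δ k : ℝ} (hd : 0 < δ) (hd1 : δ ≤ 0.02) (hτ : 1.35 ≤ |τ|) (hk0 : 0 < k) (hk1 : k ≤ 1)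
    (hk : ∀ u t : ℝ, 0 ≤ u → |t - τ| ≤ 0.9 → k * ((1 + u) ^ 2 + t ^ 2) ≤ u ^ 2 + t ^ 2) :
    -(logDeriv Fz ((1 + δ : ℝ) + τ * I)).re ≤ (2 * Real.log (5 * |τ| + 7) + 2.05 + Real.log (1 / k)) / 2.76 ∧
    ∀ w : ℝ, 0 < w → w ≤ 0.8 → Fz ((1 + δ - w : ℝ) + τ * I) = 0 →
    -(logDeriv Fz ((1 + δ : ℝ) + τ * I)).re ≤ (2 * Real.log (5 * |τ| + 7) + 2.05 + Real.log (1 / k)) / 2.76 - 1 / w + 1.3 * w := by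
  set s1 : ℂ := (1 + δ : ℝ) + τ * I with hs1
  have hs1re : s1.re = 1 + δ := by simp [hs1]
  have hs1im : s1.im = τ := by simp [hs1]
  set f : ℂ → ℂ := fun z => Fz (s1 + z) with hfdef
  have hre : ∀ z ∈ closedBall (0:ℂ) 0.9, 0 < (s1 + z).re := by
    intro z hz
    have hz' : ‖z‖ ≤ 0.9 := by simpa using hz
    have := (abs_le.1 ((Complex.abs_re_le_norm z).trans hz')).1
    rw [Complex.add_re, hs1re]; linarith
  have hfa : AnalyticOnNhd ℂ f (closedBall 0 0.9) := by
    intro z hz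
    have := Fz_analytic (hre z hz)
    exact this.comp_of_eq (by fun_prop) rfl
  have h0 : f 0 ≠ 0 := by
    simp only [hfdef, add_zero]; exact Fz_ne_right (by rw [hs1re]; linarith)
  obtain ⟨r, hr1, hr2, hrz⟩ := exists_r hfa h0
  have hr : 0 < r := by linarith
  have hsub : closedBall (0:ℂ) r ⊆ closedBall 0 0.9 := closedBall_subset_closedBall hr2.le
  have hpj := pj hr (hfa.mono hsub) h0 hrz (by
    intro z hz hfz
    by_contra hcon; push Not at hcon
    exact Fz_ne_right (by rw [Complex.add_re, hs1re]; linarith) hfz)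
  have hld : logDeriv f 0 = logDeriv Fz s1 := by
    simp only [logDeriv_apply, hfdef, add_zero]
    rw [deriv_comp_const_add, add_zero]
  rw [hld] at hpj
  set lM := Real.log (5 * |τ| + 7)
  set lk := Real.log (1 / k)
  have hlk : 0 ≤ lk := Real.log_nonneg (by rw [le_div_iff₀ hk0]; linarith)
  have hlM : 0 ≤ lM := Real.log_nonneg (by linarith)
  have hcm : ∀ θ, ‖circleMap 0 r θ‖ = r := by intro θ; simp [abs_of_pos hr]
  have hcmre : ∀ θ, (circleMap 0 r θ).re = r * Real.cos θ := by intro θ; simp [circleMap, Complex.exp_ofReal_mul_I_re]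
  have hcms : ∀ θ, circleMap 0 r θ ∈ sphere (0:ℂ) r := fun θ => circleMap_mem_sphere 0 hr.le θ
  have hint : -(2 * lM + 2.05 + lk) ≤ ∫ θ in (0:ℝ)..2 * Real.pi, Real.log ‖f (circleMap 0 r θ)‖ * Real.cos θ := by
    refine circ_int ?_ ?_ ?_
    · refine Continuous.mul ?_ Real.continuous_cos
      refine Continuous.log ?_ fun θ => norm_ne_zero_iff.2 (hrz _ (hcms θ))
      refine continuous_norm.comp ?_
      rw [continuous_iff_continuousAt]
      intro θ
      have := (hfa _ (hsub (sphere_subset_closedBall (hcms θ)))).continuousAt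
      exact this.comp (continuous_circleMap 0 r).continuousAt
    · intro θ hθ
      refine circ_right hd hθ hr1 hr2 hk0 hk ?_ ?_
      · rw [Complex.add_re, hs1re, hcmre]
      · rw [Complex.add_im, hs1im, add_sub_cancel_left]
        refine (Complex.abs_im_le_norm _).trans ?_; rw [hcm]; exact hr2.le
    · intro θ hθ
      have h := circ_left (s := s1 + circleMap 0 r θ) hd hd1 hτ (z := circleMap 0 r θ) (by rw [hcm]; exact hr2.le) rfl
      have := Real.log_le_log (norm_pos_iff.2 (hrz _ (hcms θ))) h
      exact mul_le_mul_of_nonpos_right this hθ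
  set II := ∫ θ in (0:ℝ)..2 * Real.pi, Real.log ‖f (circleMap 0 r θ)‖ * Real.cos θ
  have hpr : 2.76 ≤ Real.pi * r := by nlinarith [Real.pi_gt_d4]
  have hb : -((2 * lM + 2.05 + lk) / 2.76) ≤ 1 / (Real.pi * r) * II := by
    have : (2 * lM + 2.05 + lk) / (Real.pi * r) ≤ (2 * lM + 2.05 + lk) / 2.76 := by gcongr
    have h2 : 1 / (Real.pi * r) * (-(2 * lM + 2.05 + lk)) ≤ 1 / (Real.pi * r) * II := by gcongr
    have h3 : 1 / (Real.pi * r) * (-(2 * lM + 2.05 + lk)) = -((2 * lM + 2.05 + lk) / (Real.pi * r)) := by ring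
    linarith
  refine ⟨by linarith [hpj.1], fun w hw hw1 hz => ?_⟩
  have hρ := hpj.2 (-(w:ℂ)) (by simp [abs_of_pos hw]; linarith) (by
    simp only [hfdef]; rw [← hz]; congr 1; rw [hs1]; push_cast; ring)
  have hzc : zc r (-(w:ℂ)) = 1 / w - w / r ^ 2 := by
    unfold zc
    rw [norm_neg, Complex.norm_real, Real.norm_of_nonneg hw.le, Complex.neg_re, Complex.ofReal_re]
    field_simp; ring
  rw [hzc] at hρ
  have hr3 : 0.7744 ≤ r ^ 2 := by nlinarith
  have : w / r ^ 2 ≤ 1.3 * w := by rw [div_le_iff₀ (by positivity)]; nlinarith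
  linarith

theorem k1 {τ : ℝ} (hτ : 1.35 ≤ |τ|) (u t : ℝ) (_hu : 0 ≤ u) (ht : |t - τ| ≤ 0.9) :
    0.14 * ((1 + u) ^ 2 + t ^ 2) ≤ u ^ 2 + t ^ 2 := by
  have h1 : 0.45 ≤ |t| := by have := abs_sub_abs_le_abs_sub τ t; rw [abs_sub_comm] at this; linarith
  have h2 : 0.2025 ≤ t ^ 2 := by rw [← sq_abs]; nlinarith
  nlinarith [sq_nonneg (u - 0.163)]

theorem k2 {τ : ℝ} (hτ : 3 ≤ |τ|) (u t : ℝ) (_hu : 0 ≤ u) (ht : |t - τ| ≤ 0.9) :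
    0.6 * ((1 + u) ^ 2 + t ^ 2) ≤ u ^ 2 + t ^ 2 := by
  have h1 : 2.1 ≤ |t| := by have := abs_sub_abs_le_abs_sub τ t; rw [abs_sub_comm] at this; linarith
  have h2 : 4.41 ≤ t ^ 2 := by rw [← sq_abs]; nlinarith
  nlinarith [sq_nonneg (u - 1.5)]

theorem pole_le {δ τ : ℝ} (hd : 0 < δ) (hd1 : δ ≤ 0.02) (hτ : 1.35 ≤ |τ|) :
    (1 / (((1 + δ : ℝ) : ℂ) + τ * I - 1) - 1 / (((1 + δ : ℝ) : ℂ) + τ * I)).re ≤ 0 := by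
  have e : ((1 + δ : ℝ) : ℂ) + τ * I - 1 = δ + τ * I := by push_cast; ring
  rw [e, Complex.sub_re, one_div, one_div, Complex.inv_re, Complex.inv_re, Complex.normSq_add_mul_I, Complex.normSq_add_mul_I]
  simp only [Complex.add_re, Complex.ofReal_re, Complex.mul_re, Complex.I_re, Complex.I_im, Complex.ofReal_im, mul_zero, mul_one, sub_zero, add_zero]
  have h2 : 1.8 ≤ τ ^ 2 := by rw [← sq_abs]; nlinarith
  rw [sub_nonpos, div_le_div_iff₀ (by positivity) (by positivity)]
  nlinarith

theorem Kz_up {δ τ k : ℝ} (hd : 0 < δ) (hd1 : δ ≤ 0.02) (hτ : 1.35 ≤ |τ|) (hk0 : 0 < k) (hk1 : k ≤ 1)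
    (hk : ∀ u t : ℝ, 0 ≤ u → |t - τ| ≤ 0.9 → k * ((1 + u) ^ 2 + t ^ 2) ≤ u ^ 2 + t ^ 2) :
    (Kz ((1 + δ : ℝ) + τ * I)).re ≤ (2 * Real.log (5 * |τ| + 7) + 2.05 + Real.log (1 / k)) / 2.76 ∧
    ∀ w : ℝ, 0 < w → w ≤ 0.8 → Fz ((1 + δ - w : ℝ) + τ * I) = 0 →
    (Kz ((1 + δ : ℝ) + τ * I)).re ≤ (2 * Real.log (5 * |τ| + 7) + 2.05 + Real.log (1 / k)) / 2.76 - 1 / w + 1.3 * w := by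
  have h := circ hd hd1 hτ hk0 hk1 hk
  have hp := pole_le hd hd1 hτ
  rw [Kz_eq (by simp; linarith), add_sub_assoc, Complex.add_re, Complex.neg_re]
  exact ⟨by linarith [h.1], fun w h1 h2 h3 => by linarith [h.2 w h1 h2 h3]⟩

theorem log57 {T : ℝ} (hT : 100 ≤ T) : 6 ≤ Real.log (5 * T + 7) := by
  rw [Real.le_log_iff_exp_le (by linarith)]
  have h : Real.exp 6 = Real.exp 1 ^ 6 := by rw [← Real.exp_nat_mul]; norm_num
  rw [h]
  have := Real.exp_one_lt_d9
  have : Real.exp 1 ^ 6 ≤ 2.7182818286 ^ 6 := by gcongr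
  norm_num at this; linarith

theorem Kz_up' {T δ τ : ℝ} (hT : 100 ≤ T) {j τ' : ℝ} (hj : 1 ≤ j) (hj3 : j ≤ 3) (hd : 0 < δ) (hd1 : δ ≤ 0.02) (hτ : 1.35 ≤ |τ|)
    (hτT : |τ| ≤ T) (hτ' : |τ'| = j * |τ|) :
    (Kz ((1 + δ : ℝ) + τ' * I)).re ≤ (2 * (Real.log (5 * T + 7) + Real.log j) + 2.561) / 2.76 ∧
    ∀ w : ℝ, 0 < w → w ≤ 0.8 → Fz ((1 + δ - w : ℝ) + τ' * I) = 0 →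
    (Kz ((1 + δ : ℝ) + τ' * I)).re ≤ (2 * (Real.log (5 * T + 7) + Real.log j) + 2.561) / 2.76 - 1 / w + 1.3 * w := by
  have hL := log57 hT
  have hj0 : 0 ≤ Real.log j := Real.log_nonneg hj
  have hge : |τ| ≤ |τ'| := by rw [hτ']; nlinarith
  suffices ∃ k : ℝ, 0 < k ∧ k ≤ 1 ∧ (∀ u t : ℝ, 0 ≤ u → |t - τ'| ≤ 0.9 → k * ((1 + u) ^ 2 + t ^ 2) ≤ u ^ 2 + t ^ 2) ∧
      2 * Real.log (5 * |τ'| + 7) + 2.05 + Real.log (1 / k) ≤ 2 * (Real.log (5 * T + 7) + Real.log j) + 2.561 by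
    obtain ⟨k, hk0, hk1, hk, hb⟩ := this
    have h := Kz_up hd hd1 (hτ.trans hge) hk0 hk1 hk
    have hb2 : (2 * Real.log (5 * |τ'| + 7) + 2.05 + Real.log (1 / k)) / 2.76 ≤ (2 * (Real.log (5 * T + 7) + Real.log j) + 2.561) / 2.76 := by gcongr
    exact ⟨by linarith [h.1], fun w h1 h2 h3 => by linarith [h.2 w h1 h2 h3]⟩
  by_cases h3 : 3 ≤ |τ|
  · refine ⟨0.6, by norm_num, by norm_num, k2 (h3.trans hge), ?_⟩
    have h5 : Real.log (1 / 0.6) ≤ 0.511 := by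
      rw [Real.log_le_iff_le_exp (by norm_num)]
      refine le_trans ?_ (Real.sum_le_exp_of_nonneg (by norm_num) 6)
      norm_num [Finset.sum_range_succ, Nat.factorial]
    have : Real.log (5 * |τ'| + 7) ≤ Real.log (5 * T + 7) + Real.log j := by
      rw [← Real.log_mul (by linarith) (by linarith)]
      refine Real.log_le_log (by positivity) ?_
      rw [hτ']; nlinarith
    linarith
  · push Not at h3
    refine ⟨0.14, by norm_num, by norm_num, k1 (hτ.trans hge), ?_⟩
    have h5 : Real.log (1 / 0.14) ≤ 2 := by
      rw [Real.log_le_iff_le_exp (by norm_num)]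
      refine le_trans ?_ (Real.sum_le_exp_of_nonneg (by norm_num) 8)
      norm_num [Finset.sum_range_succ, Nat.factorial]
    have : Real.log (5 * |τ'| + 7) ≤ 4 := by
      rw [Real.log_le_iff_le_exp (by positivity)]
      refine le_trans ?_ (Real.sum_le_exp_of_nonneg (by norm_num) 12)
      have : |τ'| ≤ 9 := by rw [hτ']; nlinarith
      norm_num [Finset.sum_range_succ, Nat.factorial]
      linarith
    linarith

theorem zfree {T : ℝ} (hT : 100 ≤ T) {s : ℂ} (him : |s.im| ≤ T)
    (hre : 1 - 0.0268 / ((2 * Real.log (5 * T + 7) + 3.6) / 2.76) ≤ s.re) : Fz s ≠ 0 := by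
  intro hz
  have hL := log57 hT
  set L := Real.log (5 * T + 7)
  set A := (2 * L + 3.6) / 2.76 with hA
  have hA4 : 5.65 ≤ A := by rw [hA, le_div_iff₀ (by norm_num)]; linarith
  have hs1 : s.re ≤ 1 := by by_contra h; push Not at h; exact Fz_ne_right h hz
  have hA5 : 0.0268 / A ≤ 0.02 := by rw [div_le_iff₀ (by linarith)]; linarith
  have hτ : 1.35 ≤ |s.im| := by
    by_contra h; push Not at h
    exact Fz_ne_low (by linarith) hs1 (by linarith) (by linarith) hz
  set τ := s.im
  set δ := 0.1 / A with hδ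
  have hd : 0 < δ := by positivity
  have hd1 : δ ≤ 0.018 := by rw [hδ, div_le_iff₀ (by linarith)]; linarith
  set w := δ + 1 - s.re with hw
  have hw0 : 0 < w := by linarith
  have hw1 : w ≤ 0.1268 / A := by
    have : (0.1268:ℝ) / A = 0.1 / A + 0.0268 / A := by ring
    rw [this, hw]; linarith
  have hw2 : w ≤ 0.023 := hw1.trans (by rw [div_le_iff₀ (by linarith)]; linarith)
  have t := Kz_trig (x := 1 + δ) (by linarith) τ
  have r0 := Kz_real hd (by linarith)
  have r1 := (Kz_up' (τ' := τ) (j := 1) hT le_rfl (by norm_num) hd (by linarith) hτ him (by rw [one_mul])).2 w hw0 (by linarith) (by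
    rw [← hz]; congr 1; apply Complex.ext <;> simp [hw, τ] <;> ring)
  have r2 := (Kz_up' (τ' := 2 * τ) (j := 2) hT (by norm_num) (by norm_num) hd (by linarith) hτ him (by rw [abs_mul]; norm_num)).1
  have r3 := (Kz_up' (τ' := 3 * τ) (j := 3) hT (by norm_num) (by norm_num) hd (by linarith) hτ him (by rw [abs_mul]; norm_num)).1
  rw [Real.log_one] at r1
  have l2 := Real.log_two_lt_d9
  have l3 : Real.log 3 ≤ 1.1 := by
    rw [Real.log_le_iff_le_exp (by norm_num)]
    refine le_trans ?_ (Real.sum_le_exp_of_nonneg (by norm_num) 8)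
    norm_num [Finset.sum_range_succ, Nat.factorial]
  have q1 : 1 / δ = 10 * A := by rw [hδ]; field_simp; ring
  have q2 : 7.886 * A ≤ 1 / w := by
    rw [le_div_iff₀ hw0]
    rw [le_div_iff₀ (by linarith)] at hw1; linarith
  have q3 : A * 2.76 = 2 * L + 3.6 := by rw [hA]; field_simp
  rw [q1] at r0
  have r1' : (Kz ((1 + δ : ℝ) + τ * I)).re * 2.76 ≤ 2 * L + 2.561 - 2.76 * (1 / w) + 2.76 * 1.3 * w := by
    have := mul_le_mul_of_nonneg_right r1 (by norm_num : (0:ℝ) ≤ 2.76)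
    rw [add_mul, sub_mul, div_mul_cancel₀ _ (by norm_num)] at this; linarith
  rw [le_div_iff₀ (by norm_num)] at r2 r3
  linarith
end

section
open Complex Metric Set Filter Topology MeasureTheory

theorem bc_log {f : ℂ → ℂ} {R r B : ℝ} (hr : 0 ≤ r) (hR : r < R) (hB : 0 < B)
    (hf : DifferentiableOn ℂ f (ball 0 R)) (hn : ∀ z ∈ ball (0:ℂ) R, f z ≠ 0)
    (hM : ∀ z ∈ ball (0:ℂ) R, ‖f z‖ ≤ Real.exp B * ‖f 0‖) {z : ℂ} (hz : ‖z‖ ≤ r) :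
    ‖logDeriv f z‖ ≤ 4 * B * (R + r) / (R - r) ^ 2 := by
  have hD' : DifferentiableOn ℂ (logDeriv f) (ball 0 R) := by
    unfold logDeriv
    exact (hf.deriv isOpen_ball).div hf hn
  have hR0 : 0 < R := by linarith
  obtain ⟨h, hh⟩ := hD'.isExactOn_ball
  have h0 : (0:ℂ) ∈ ball (0:ℂ) R := mem_ball_self hR0
  have hconst : ∀ z ∈ ball (0:ℂ) R, f z * cexp (- h z) = f 0 * cexp (- h 0) := by
    intro z hz
    have hder : ∀ w ∈ ball (0:ℂ) R, HasDerivAt (fun z => f z * cexp (- h z)) 0 w := by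
      intro w hw
      have a := (hf.differentiableAt (isOpen_ball.mem_nhds hw)).hasDerivAt.mul ((hh w hw).neg.cexp)
      have h2 := hn w hw
      have e : deriv f w * cexp ((-h) w) + f w * (cexp ((-h) w) * -logDeriv f w) = 0 := by
        rw [logDeriv_apply]; field_simp; ring
      rw [e] at a; exact a
    refine (isOpen_ball.is_const_of_deriv_eq_zero (convex_ball 0 R).isPreconnected (f := fun z => f z * cexp (- h z)) ?_ ?_ hz h0)
    · exact fun w hw => (hder w hw).differentiableAt.differentiableWithinAt
    · exact fun w hw => (hder w hw).deriv
  set g : ℂ → ℂ := fun z => h z - h 0 with hg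
  have hgd : DifferentiableOn ℂ g (ball 0 R) := fun w hw => ((hh w hw).differentiableAt.sub_const _).differentiableWithinAt
  have hfg : ∀ z ∈ ball (0:ℂ) R, f z = f 0 * cexp (g z) := by
    intro z hz
    have := hconst z hz
    rw [hg]; simp only
    rw [sub_eq_add_neg, Complex.exp_add, mul_comm (cexp (h z)), ← mul_assoc, ← this, mul_assoc, ← Complex.exp_add]; simp
  have hre : MapsTo g (ball 0 R) {z | z.re ≤ B} := by
    intro w hw
    have h1 := hM w hw
    rw [hfg w hw, norm_mul, mul_comm, Complex.norm_exp] at h1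
    have := le_of_mul_le_mul_right h1 (norm_pos_iff.2 (hn 0 h0))
    exact Real.exp_le_exp.1 this
  have hder : logDeriv f z = deriv g z := by
    rw [hg, deriv_sub_const, (hh z (by simp; linarith)).deriv]
  rw [hder]
  have hρ : 0 < (R - r) / 2 := by linarith
  have hin : ∀ w ∈ closedBall z ((R - r) / 2), ‖w‖ ≤ (R + r) / 2 := by
    intro w hw
    have : ‖w - z‖ ≤ (R - r) / 2 := by simpa [dist_eq_norm] using hw
    have := norm_add_le (w - z) z
    rw [sub_add_cancel] at this; linarith
  have := Complex.norm_deriv_le_of_forall_mem_sphere_norm_le (c := z) (R := (R - r) / 2) (C := 2 * B * ((R + r) / 2) / ((R - r) / 2)) (f := g) hρ ?_ ?_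
  · refine this.trans (le_of_eq ?_)
    have : R - r ≠ 0 := by linarith
    field_simp; ring
  · refine DifferentiableOn.diffContOnCl (hgd.mono ?_)
    rw [closure_ball _ hρ.ne']
    intro w hw; have := hin w hw; simp; linarith
  · intro w hw
    have h1 := hin w (sphere_subset_closedBall hw)
    have hwR : w ∈ ball (0:ℂ) R := by simp; linarith
    refine (Complex.borelCaratheodory_zero hB hgd hre hR0 hwR (by simp [hg])).trans ?_
    have : (R - r) / 2 ≤ R - ‖w‖ := by linarith
    gcongr

theorem Fz_center {η t : ℝ} (h0 : 0 < η) (h1 : η ≤ 0.01) : 0.4 * η ≤ ‖Fz ((1 + η : ℝ) + t * I)‖ := by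
  set c : ℂ := (1 + η : ℝ) + t * I with hc
  have hre : c.re = 1 + η := by simp [hc]
  have him : c.im = t := by simp [hc]
  have hc1 : c - 1 = η + t * I := by rw [hc]; push_cast; ring
  have hc0 : c ≠ 0 := by intro h; rw [h] at hre; simp at hre; linarith
  have n0 := norm_pos_iff.2 hc0
  by_cases ht : |t| ≤ 1 / 2
  · have hF : Fz c = (c + 1) / (2 * c) - (c - 1) * Jz c := rfl
    rw [hF]
    refine le_trans ?_ (norm_sub_norm_le _ _)
    rw [norm_div, norm_mul, norm_mul, Complex.norm_ofNat]
    have a1 : ‖Jz c‖ ≤ 1 / 2 := (Jz_norm (by linarith)).trans (by rw [hre, div_le_div_iff₀ (by linarith) (by norm_num)]; linarith)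
    have a2 : ‖c - 1‖ ≤ 0.51 := by
      rw [hc1]; refine (norm_add_le _ _).trans ?_
      rw [norm_mul, Complex.norm_I, Complex.norm_real, Complex.norm_real, Real.norm_of_nonneg h0.le, Real.norm_eq_abs]; linarith
    have a3 : ‖c‖ ≤ 1.51 := by
      have := norm_add_le (c - 1) 1; rw [sub_add_cancel, norm_one] at this; linarith
    have a4 : 2 ≤ ‖c + 1‖ := by
      refine le_trans ?_ (Complex.re_le_norm _); simp [hre]; linarith
    have a5 : 2 / 3.02 ≤ ‖c + 1‖ / (2 * ‖c‖) := by gcongr; linarith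
    have : (0.662:ℝ) ≤ 2 / 3.02 := by norm_num
    nlinarith [norm_nonneg (c - 1), norm_nonneg (Jz c)]
  · push Not at ht
    have hs : 1 < c.re := by rw [hre]; linarith
    rw [Fz_eq hs, norm_div, norm_mul, mul_div_assoc]
    have a1 := zeta_lower hs
    rw [hre] at a1
    have a2 : 0.98 * η ≤ ‖riemannZeta c‖ := le_trans (by rw [le_div_iff₀ (by linarith)]; nlinarith) a1
    have ht2 : 1 / 4 ≤ t ^ 2 := by rw [← sq_abs]; nlinarith
    have a3 : 0.44 ≤ ‖c - 1‖ / ‖c‖ := by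
      rw [le_div_iff₀ n0]
      refine le_of_sq_le_sq ?_ (norm_nonneg _) |>.trans le_rfl
      rw [mul_pow, ← Complex.normSq_eq_norm_sq, ← Complex.normSq_eq_norm_sq, Complex.normSq_apply, Complex.normSq_apply]
      simp [hre, him]; nlinarith
    calc 0.4 * η ≤ 0.98 * η * 0.44 := by linarith
      _ ≤ _ := by gcongr

/-- regularised logarithmic derivative -/
noncomputable def Gz (z : ℂ) : ℂ := -logDeriv Fz (1 + z) - 1 / (1 + z)

noncomputable def etaT (T : ℝ) : ℝ := 0.0268 / ((2 * Real.log (5 * T + 7) + 3.6) / 2.76)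

theorem eta_pos {T : ℝ} (hT : 100 ≤ T) : 0 < etaT T := by
  unfold etaT; have := log57 hT; positivity

theorem eta_le {T : ℝ} (hT : 100 ≤ T) : etaT T ≤ 0.005 := by
  unfold etaT; have := log57 hT
  have h2 : 5.65 ≤ (2 * Real.log (5 * T + 7) + 3.6) / 2.76 := by rw [le_div_iff₀ (by norm_num)]; linarith
  rw [div_le_iff₀ (by positivity)]; linarith

theorem Gz_bound {T : ℝ} (hT : 100 ≤ T) {z : ℂ} (h1 : -(0.9 * etaT T) ≤ z.re) (h2 : z.re ≤ etaT T) (him : |z.im| ≤ T - 1) :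
    DifferentiableAt ℂ Gz z ∧ ‖Gz z‖ ≤ 1560 * Real.log (T / (0.4 * etaT T)) / etaT T + 1.02 := by
  have e0 := eta_pos hT
  have e1 := eta_le hT
  set η := etaT T with hη
  set c : ℂ := (1 + η : ℝ) + z.im * I with hc
  have hcre : c.re = 1 + η := by simp [hc]
  have hcim : c.im = z.im := by simp [hc]
  have key : ∀ w ∈ ball (0:ℂ) (2 * η), 1 - η < (c + w).re ∧ (c+w).re ≤ 1.02 ∧ |(c + w).im| ≤ T := by
    intro w hw
    have hw' : ‖w‖ < 2 * η := by simpa using hw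
    have a := (Complex.abs_re_le_norm w).trans_lt hw'
    have b := (Complex.abs_im_le_norm w).trans_lt hw'
    rw [abs_lt] at a
    refine ⟨by rw [Complex.add_re, hcre]; linarith, by rw [Complex.add_re, hcre]; linarith, ?_⟩
    rw [Complex.add_im, hcim]
    refine (abs_add_le _ _).trans ?_; linarith
  have hne : ∀ w ∈ ball (0:ℂ) (2 * η), Fz (c + w) ≠ 0 := fun w hw => zfree hT (key w hw).2.2 (key w hw).1.le
  have hdf : ∀ w ∈ ball (0:ℂ) (2 * η), DifferentiableAt ℂ (fun w => Fz (c + w)) w := by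
    intro w hw
    have := Fz_diff (s := c + w) (by linarith [(key w hw).1])
    exact DifferentiableAt.comp w this (by fun_prop)
  set u : ℂ := ((z.re - η : ℝ) : ℂ) with hu
  have hcu : c + u = 1 + z := by
    apply Complex.ext <;> simp [hc, hu]
  have hun : ‖u‖ ≤ 1.9 * η := by
    rw [hu, Complex.norm_real, Real.norm_eq_abs, abs_le]; constructor <;> linarith
  have hub : u ∈ ball (0:ℂ) (2 * η) := by simp; linarith
  have hF1 := hne u hub
  rw [hcu] at hF1
  have hre1 : 0.99 ≤ (1 + z).re := by simp; linarith
  have hz0 : 1 + z ≠ 0 := by intro h; rw [h] at hre1; simp at hre1; linarith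
  constructor
  · unfold Gz
    have hA : AnalyticAt ℂ Fz (1 + z) := Fz_analytic (by linarith)
    have : DifferentiableAt ℂ (logDeriv Fz) (1 + z) := by
      unfold logDeriv; exact (hA.deriv.differentiableAt).div hA.differentiableAt hF1
    refine DifferentiableAt.sub (DifferentiableAt.neg ?_) ?_
    · exact DifferentiableAt.comp z this (by fun_prop)
    · exact DifferentiableAt.div (by fun_prop) (by fun_prop) hz0
  · unfold Gz
    have hT2 : (1:ℝ) < T / (0.4 * η) := by rw [lt_div_iff₀ (by positivity)]; linarith
    have hB := Real.log_pos hT2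
    have := bc_log (f := fun w => Fz (c + w)) (R := 2 * η) (r := 1.9 * η) (by positivity) (by linarith) hB
      (fun w hw => (hdf w hw).differentiableWithinAt) hne ?_ hun
    · have hl : logDeriv (fun w => Fz (c + w)) u = logDeriv Fz (1 + z) := by
        simp only [logDeriv_apply]; rw [deriv_comp_const_add, hcu]
      rw [hl] at this
      refine (norm_sub_le _ _).trans ?_
      rw [norm_neg]
      refine add_le_add (this.trans (le_of_eq ?_)) ?_
      · field_simp; ring
      · rw [norm_div, norm_one, div_le_iff₀ (norm_pos_iff.2 hz0)]
        have := (Complex.re_le_norm (1 + z)); linarith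
    · intro w hw
      rw [Real.exp_log (by linarith)]
      simp only [add_zero]
      have hc4 := Fz_center (t := z.im) e0 (by linarith : η ≤ 0.01)
      rw [← hc] at hc4
      obtain ⟨k1, k2, k3⟩ := key w hw
      have hns : 0.99 ≤ ‖c + w‖ := by have := Complex.re_le_norm (c + w); linarith
      have hup : ‖Fz (c + w)‖ ≤ T := by
        refine (Fz_norm (by linarith)).trans ?_
        have b1 : ‖c + w + 1‖ / (2 * ‖c + w‖) ≤ 1.02 := by
          rw [div_le_iff₀ (by linarith)]
          have := norm_add_le (c + w) 1
          rw [norm_one] at this; linarith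
        have b2 : ‖c + w - 1‖ ≤ T + 0.02 := by
          refine (Complex.norm_le_abs_re_add_abs_im _).trans ?_
          rw [Complex.sub_re, Complex.sub_im, Complex.one_re, Complex.one_im, sub_zero]
          have : |(c + w).re - 1| ≤ 0.02 := by rw [abs_le]; constructor <;> linarith
          linarith
        have b3 : ‖c + w - 1‖ / (2 * (c + w).re) ≤ (T + 0.02) / 1.98 := by gcongr; linarith
        have b4 : (T + 0.02) / 1.98 ≤ 0.6 * T := by rw [div_le_iff₀ (by norm_num)]; linarith
        linarith
      refine hup.trans ?_
      rw [div_mul_eq_mul_div, le_div_iff₀ (by positivity)]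
      gcongr
end

section
open Complex Metric Set Filter Topology MeasureTheory
open scoped LSeries.notation ArithmeticFunction.vonMangoldt

noncomputable def Gs (h u : ℝ) : ℝ := √(2 * Real.pi) / h * Real.exp (-(u ^ 2 / (2 * h ^ 2)))

noncomputable def EE (h V : ℝ) (z : ℂ) : ℂ := cexp (z * V + (h:ℂ) ^ 2 * z ^ 2 / 2)

theorem EE_norm (h V c t : ℝ) : ‖EE h V (c + t * I)‖ = Real.exp (c * V + h ^ 2 * c ^ 2 / 2) * Real.exp (-(h ^ 2 / 2) * t ^ 2) := by
  unfold EE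
  rw [Complex.norm_exp, ← Real.exp_add]
  congr 1
  have : ((c + t * I) * V + (h:ℂ) ^ 2 * (c + t * I) ^ 2 / 2) = ((c * V + h ^ 2 * c ^ 2 / 2 + (-(h ^ 2 / 2)) * t ^ 2 : ℝ) : ℂ) + ((t * V + h ^ 2 * c * t : ℝ) : ℂ) * I := by
    push_cast; ring_nf; rw [Complex.I_sq]; ring
  rw [this]
  simp only [Complex.add_re, Complex.ofReal_re, Complex.mul_re, Complex.I_re, Complex.I_im, Complex.ofReal_im]; ring

theorem EE_cont (h V c : ℝ) : Continuous fun t : ℝ => EE h V (c + t * I) := by unfold EE; fun_prop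

theorem gauss_int {h : ℝ} (hh : 0 < h) : ∫ t : ℝ, Real.exp (-(h ^ 2 / 2) * t ^ 2) = √(2 * Real.pi) / h := by
  rw [integral_gaussian, show Real.pi / (h ^ 2 / 2) = 2 * Real.pi / h ^ 2 by field_simp, Real.sqrt_div (by positivity), Real.sqrt_sq hh.le]

theorem EE_int {h : ℝ} (hh : 0 < h) (V c : ℝ) : Integrable fun t : ℝ => EE h V (c + t * I) := by
  refine Integrable.mono' ((integrable_exp_neg_mul_sq (b := h ^ 2 / 2) (by positivity)).const_mul (Real.exp (c * V + h ^ 2 * c ^ 2 / 2))) (EE_cont h V c).aestronglyMeasurable (Eventually.of_forall fun t => ?_)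
  rw [EE_norm]

theorem EE_integral {h : ℝ} (hh : 0 < h) (u c : ℝ) : ∫ t : ℝ, EE h u (c + t * I) = (Gs h u : ℂ) := by
  have e : ∀ t : ℝ, EE h u (c + t * I) = cexp ((-(h ^ 2 / 2) : ℝ) * (t:ℂ) ^ 2 + (I * (u + h ^ 2 * c)) * t + (c * u + h ^ 2 * c ^ 2 / 2)) := by
    intro t; unfold EE; congr 1; push_cast; ring_nf; rw [Complex.I_sq]; ring
  simp_rw [e]
  rw [integral_cexp_quadratic (by rw [Complex.ofReal_re]; nlinarith [sq_pos_of_pos hh])]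
  unfold Gs
  push_cast
  have hhc : (h:ℂ) ≠ 0 := by exact_mod_cast hh.ne'
  congr 1
  · have : (Real.pi : ℂ) / - -((h:ℂ) ^ 2 / 2) = ((2 * Real.pi / h ^ 2 : ℝ) : ℂ) := by push_cast; field_simp
    rw [this, show (1 / 2 : ℂ) = ((1 / 2 : ℝ) : ℂ) by push_cast; rfl, ← Complex.ofReal_cpow (by positivity), ← Real.sqrt_eq_rpow,
      Real.sqrt_div (by positivity), Real.sqrt_sq hh.le]
    push_cast; rfl
  · congr 1; rw [mul_pow, Complex.I_sq]; field_simp; ring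

/-- smoothed prime sum (up to 2π) -/
noncomputable def NV (h V : ℝ) : ℝ := ∑' n : ℕ, Λ n / n * Gs h (V - Real.log n)

theorem Gs_pos {h : ℝ} (hh : 0 < h) (u : ℝ) : 0 < Gs h u := by unfold Gs; positivity

theorem term_EE {n : ℕ} (h V : ℝ) (z : ℂ) : LSeries.term (fun n => (Λ n : ℂ)) (1 + z) n * EE h V z = ((Λ n / n : ℝ) : ℂ) * EE h (V - Real.log n) z := by
  rcases Nat.eq_zero_or_pos n with rfl | hn
  · simp
  · have hnc : (n:ℂ) ≠ 0 := by exact_mod_cast hn.ne'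
    rw [LSeries.term_of_ne_zero hn.ne', Complex.cpow_add _ _ hnc, Complex.cpow_one]
    unfold EE
    have : cexp (z * ((V - Real.log n : ℝ) : ℂ) + (h:ℂ) ^ 2 * z ^ 2 / 2) = cexp (z * V + (h:ℂ) ^ 2 * z ^ 2 / 2) / (n:ℂ) ^ z := by
      rw [Complex.cpow_def_of_ne_zero hnc, ← Complex.exp_sub, ← Complex.natCast_log]
      congr 1; push_cast; ring
    rw [this]; push_cast; field_simp

theorem Kz_EE {h : ℝ} (hh : 0 < h) (V : ℝ) {c : ℝ} (hc : 0 < c) :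
    (Summable fun n : ℕ => Λ n / n * Gs h (V - Real.log n)) ∧
    ∫ t : ℝ, Kz (1 + (c + t * I)) * EE h V (c + t * I) = (NV h V : ℂ) := by
  set F : ℕ → ℝ → ℂ := fun n t => LSeries.term (fun n => (Λ n : ℂ)) (1 + (c + t * I)) n * EE h V (c + t * I) with hF
  have hF2 : ∀ n t, F n t = ((Λ n / n : ℝ) : ℂ) * EE h (V - Real.log n) (c + t * I) := fun n t => term_EE h V _
  have hFi : ∀ n, Integrable (F n) := by
    intro n; rw [funext (hF2 n)]; exact (EE_int hh _ c).const_mul _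
  have hFint : ∀ n, ∫ t, F n t = ((Λ n / n * Gs h (V - Real.log n) : ℝ) : ℂ) := by
    intro n; simp_rw [hF2]; rw [integral_const_mul, EE_integral hh]; push_cast; rfl
  have hterm : ∀ n (t : ℝ), ‖LSeries.term (fun n => (Λ n : ℂ)) (1 + (c + t * I)) n‖ = ‖LSeries.term (fun n => (Λ n : ℂ)) ((1 + c : ℝ) : ℂ) n‖ := by
    intro n t; rw [LSeries.norm_term_eq, LSeries.norm_term_eq]; simp
  have hsum : Summable fun n => ∫ t, ‖F n t‖ := by
    have : ∀ n, ∫ t, ‖F n t‖ = ‖LSeries.term (fun n => (Λ n : ℂ)) ((1 + c : ℝ) : ℂ) n‖ * ∫ t : ℝ, ‖EE h V (c + t * I)‖ := by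
      intro n
      rw [← integral_const_mul]; congr 1; funext t
      rw [hF]; simp only; rw [norm_mul, hterm]
    simp_rw [this]
    exact ((ArithmeticFunction.LSeriesSummable_vonMangoldt (s := ((1 + c : ℝ) : ℂ)) (by simpa using hc)).norm).mul_right _
  have hs := hasSum_integral_of_summable_integral_norm hFi hsum
  simp_rw [hFint] at hs
  have hsr : Summable fun n : ℕ => Λ n / n * Gs h (V - Real.log n) := by
    have := Complex.hasSum_re hs; simp only [Complex.ofReal_re] at this; exact this.summable
  refine ⟨hsr, ?_⟩
  have h1 : ∀ t : ℝ, ∑' n, F n t = Kz (1 + (c + t * I)) * EE h V (c + t * I) := by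
    intro t; rw [hF]; simp only; rw [tsum_mul_right]; rfl
  simp_rw [h1] at hs
  unfold NV
  rw [← hs.tsum_eq, Complex.ofReal_tsum]

theorem pole_EE {h : ℝ} (hh : 0 < h) (V : ℝ) {c : ℝ} (hc : 0 < c) :
    ∫ t : ℝ, 1 / (c + t * I : ℂ) * EE h V (c + t * I) = ((∫ u in Ioi (0:ℝ), Gs h (V - u) : ℝ) : ℂ) := by
  have h1 : ∀ t : ℝ, 1 / (c + t * I : ℂ) * EE h V (c + t * I) = ∫ u in Ioi (0:ℝ), EE h (V - u) (c + t * I) := by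
    intro t
    have e : ∀ u : ℝ, EE h (V - u) (c + t * I) = cexp (-(c + t * I) * u) * EE h V (c + t * I) := by
      intro u; unfold EE; rw [← Complex.exp_add]; congr 1; push_cast; ring
    simp_rw [e]
    rw [integral_mul_const, integral_exp_mul_complex_Ioi (by simpa using hc)]
    have : (c + t * I : ℂ) ≠ 0 := by intro h; have := congrArg Complex.re h; simp at this; linarith
    simp only [Complex.ofReal_zero, mul_zero, Complex.exp_zero]
    field_simp
  simp_rw [h1]
  rw [integral_integral_swap]
  · simp_rw [EE_integral hh]
    exact integral_ofReal
  · have hb : Integrable (fun p : ℝ × ℝ => (Real.exp (c * V + h ^ 2 * c ^ 2 / 2) * Real.exp (-(h ^ 2 / 2) * p.1 ^ 2)) * Real.exp (-c * p.2)) (volume.prod (volume.restrict (Ioi 0))) :=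
      Integrable.mul_prod ((integrable_exp_neg_mul_sq (b := h ^ 2 / 2) (by positivity)).const_mul _) (integrableOn_exp_mul_Ioi (by linarith) 0)
    refine hb.mono' (Continuous.aestronglyMeasurable ?_) (Eventually.of_forall fun p => ?_)
    · unfold Function.uncurry EE; fun_prop
    · simp only [Function.uncurry]
      rw [EE_norm, ← Real.exp_add, ← Real.exp_add, ← Real.exp_add]
      refine le_of_eq (congrArg _ ?_); ring

theorem Gs_integrable {h : ℝ} (hh : 0 < h) : Integrable (Gs h) := by
  unfold Gs
  have := (integrable_exp_neg_mul_sq (b := 1 / (2 * h ^ 2)) (by positivity)).const_mul (√(2 * Real.pi) / h)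
  convert this using 3; congr 1; ring

theorem Gs_integral {h : ℝ} (hh : 0 < h) : ∫ u, Gs h u = 2 * Real.pi := by
  unfold Gs
  rw [integral_const_mul]
  have : ∀ x : ℝ, -(x ^ 2 / (2 * h ^ 2)) = -(1 / (2 * h ^ 2)) * x ^ 2 := fun x => by ring
  simp_rw [this]
  have e2 : √(Real.pi / (1 / (2 * h ^ 2))) = √(2 * Real.pi) * h := by
    rw [show Real.pi / (1 / (2 * h ^ 2)) = 2 * Real.pi * h ^ 2 by field_simp, Real.sqrt_mul (by positivity), Real.sqrt_sq hh.le]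
  rw [integral_gaussian, e2]
  have e3 := Real.mul_self_sqrt (show 0 ≤ 2 * Real.pi by positivity)
  field_simp
  linarith [e3]

theorem pole_lower {h : ℝ} (hh : 0 < h) {V : ℝ} (hV : 0 ≤ V) :
    2 * Real.pi * (1 - Real.exp (-(V ^ 2 / (2 * h ^ 2)))) ≤ ∫ u in Ioi (0:ℝ), Gs h (V - u) := by
  have gi := Gs_integrable hh
  have gint := Gs_integral hh
  have gs : Integrable fun u => Gs h (V - u) := gi.comp_sub_left V
  have tot : ∫ u, Gs h (V - u) = 2 * Real.pi := by rw [integral_sub_left_eq_self (Gs h) volume V, gint]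
  have spl := integral_add_compl (measurableSet_Ioi (a := (0:ℝ))) gs
  rw [tot, compl_Ioi] at spl
  have low : ∫ u in Iic (0:ℝ), Gs h (V - u) ≤ 2 * Real.pi * Real.exp (-(V ^ 2 / (2 * h ^ 2))) := by
    have : ∫ u in Iic (0:ℝ), Gs h (V - u) ≤ ∫ u in Iic (0:ℝ), Gs h u * Real.exp (-(V ^ 2 / (2 * h ^ 2))) := by
      refine setIntegral_mono_on gs.integrableOn (gi.mul_const _).integrableOn measurableSet_Iic fun u hu => ?_
      unfold Gs
      rw [mul_assoc, ← Real.exp_add]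
      gcongr
      rw [← neg_add, neg_le_neg_iff, ← add_div]
      gcongr
      have : u ≤ 0 := hu
      nlinarith
    refine this.trans ?_
    rw [integral_mul_const, ← gint]
    exact mul_le_mul_of_nonneg_right (setIntegral_le_integral gi (Eventually.of_forall fun u => (Gs_pos hh u).le)) (Real.exp_pos _).le
  linarith

theorem shift {G : ℂ → ℂ} {h V c b T C D : ℝ} (hh : 0 < h) (hc : 0 < c) (hb : 0 < b) (hT : 0 < T) (hD : 0 ≤ D) (hV : 0 ≤ V)
    (hG : ∀ z : ℂ, -b ≤ z.re → z.re ≤ c → |z.im| ≤ T → DifferentiableAt ℂ G z ∧ ‖G z‖ ≤ C)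
    (hcont : Continuous fun t : ℝ => G (c + t * I)) (hGD : ∀ t : ℝ, ‖G (c + t * I)‖ ≤ D) :
    Integrable (fun t : ℝ => G (c + t * I) * EE h V (c + t * I)) ∧
    ‖∫ t : ℝ, G (c + t * I) * EE h V (c + t * I)‖ ≤
      C * Real.exp (-b * V + h ^ 2 * b ^ 2 / 2) * (√(2 * Real.pi) / h) +
      2 * (b + c) * C * Real.exp (c * V + h ^ 2 * (b ^ 2 + c ^ 2) / 2 - h ^ 2 * T ^ 2 / 2)
      + 2 * D * Real.exp (c * V + h ^ 2 * c ^ 2 / 2 - h ^ 2 * T ^ 2 / 2) / (h ^ 2 * T) := by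
  set H : ℂ → ℂ := fun z => G z * EE h V z with hH
  have hC : 0 ≤ C := (norm_nonneg _).trans (hG 0 (by simp; linarith) (by simp; linarith) (by simp; linarith)).2
  have hEd : Differentiable ℂ (EE h V) := by unfold EE; fun_prop
  have hint : Integrable (fun t : ℝ => H (c + t * I)) := by
    refine ((EE_int hh V c).norm.const_mul D).mono' ((hcont.mul (EE_cont h V c)).aestronglyMeasurable) (Eventually.of_forall fun t => ?_)
    rw [hH]; simp only; rw [norm_mul]; gcongr; exact hGD t
  refine ⟨hint, ?_⟩
  have gint := integrable_exp_neg_mul_sq (b := h ^ 2 / 2) (by positivity)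
  -- splitting
  have spl := integral_add_compl (measurableSet_Ioc (a := -T) (b := T)) hint
  have hcompl : (Ioc (-T) T)ᶜ = Iic (-T) ∪ Ioi T := by
    ext x; simp only [mem_compl_iff, mem_Ioc, not_and_or, not_lt, not_le, mem_union, mem_Iic, mem_Ioi]
  have hdis : Disjoint (Iic (-T)) (Ioi T) := by
    rw [Set.disjoint_left]; intro x hx hx2; simp at hx hx2; linarith
  rw [hcompl, setIntegral_union hdis measurableSet_Ioi hint.integrableOn hint.integrableOn] at spl
  set K := D * Real.exp (c * V + h ^ 2 * c ^ 2 / 2) with hK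
  have hK0 : 0 ≤ K := by positivity
  have hHn : ∀ t : ℝ, ‖H (c + t * I)‖ ≤ K * Real.exp (-(h ^ 2 / 2) * t ^ 2) := by
    intro t; rw [hH]; simp only; rw [norm_mul, EE_norm, hK, mul_assoc]; gcongr; exact hGD t
  have hlam : 0 < h ^ 2 * T := by positivity
  have tail1 : ‖∫ t in Ioi T, H (c + t * I)‖ ≤ K * Real.exp (- (h ^ 2 * T ^ 2 / 2)) / (h ^ 2 * T) := by
    have hi := (integrableOn_exp_mul_Ioi (a := -(h ^ 2 * T)) (by linarith) T).const_mul (K * Real.exp (h ^ 2 * T ^ 2 / 2))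
    refine (norm_integral_le_of_norm_le hi ?_).trans (le_of_eq ?_)
    · refine (ae_restrict_iff' measurableSet_Ioi).2 (Eventually.of_forall fun t ht => (hHn t).trans ?_)
      have e5 : ∀ u v : ℝ, K * Real.exp u * Real.exp v = K * Real.exp (u + v) := fun u v => by rw [mul_assoc, Real.exp_add]
      rw [e5]
      refine mul_le_mul_of_nonneg_left (Real.exp_le_exp.2 ?_) hK0
      nlinarith [mul_nonneg (sq_nonneg h) (sq_nonneg (t - T))]
    · rw [integral_const_mul, integral_exp_mul_Ioi (by linarith), neg_div_neg_eq]
      have e6 : Real.exp (h ^ 2 * T ^ 2 / 2) * Real.exp (-(h ^ 2 * T) * T) = Real.exp (- (h ^ 2 * T ^ 2 / 2)) := by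
        rw [← Real.exp_add]; congr 1; ring
      rw [← e6]; ring
  have tail2 : ‖∫ t in Iic (-T), H (c + t * I)‖ ≤ K * Real.exp (- (h ^ 2 * T ^ 2 / 2)) / (h ^ 2 * T) := by
    have hi := (integrableOn_exp_mul_Iic (a := (h ^ 2 * T)) hlam (-T)).const_mul (K * Real.exp (h ^ 2 * T ^ 2 / 2))
    refine (norm_integral_le_of_norm_le hi ?_).trans (le_of_eq ?_)
    · refine (ae_restrict_iff' measurableSet_Iic).2 (Eventually.of_forall fun t ht => (hHn t).trans ?_)
      have e5 : ∀ u v : ℝ, K * Real.exp u * Real.exp v = K * Real.exp (u + v) := fun u v => by rw [mul_assoc, Real.exp_add]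
      rw [e5]
      refine mul_le_mul_of_nonneg_left (Real.exp_le_exp.2 ?_) hK0
      nlinarith [mul_nonneg (sq_nonneg h) (sq_nonneg (t + T))]
    · rw [integral_const_mul, integral_exp_mul_Iic hlam]
      have e6 : Real.exp (h ^ 2 * T ^ 2 / 2) * Real.exp ((h ^ 2 * T) * -T) = Real.exp (- (h ^ 2 * T ^ 2 / 2)) := by
        rw [← Real.exp_add]; congr 1; ring
      rw [← e6]; ring
  -- rectangle
  have hcT : ∀ z : ℂ, z ∈ uIcc (-b) c ×ℂ uIcc (-T) T → -b ≤ z.re ∧ z.re ≤ c ∧ |z.im| ≤ T := by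
    rintro z ⟨h1, h2⟩
    rw [uIcc_of_le (by linarith)] at h1 h2
    exact ⟨h1.1, h1.2, abs_le.2 h2⟩
  have rect := Complex.integral_boundary_rect_eq_zero_of_differentiableOn H (⟨-b, -T⟩ : ℂ) (⟨c, T⟩ : ℂ) (by
    intro z hz
    obtain ⟨h1, h2, h3⟩ := hcT z hz
    exact (((hG z h1 h2 h3).1).mul (hEd z)).differentiableWithinAt)
  simp only at rect
  have hor : ∀ y : ℝ, y ^ 2 = T ^ 2 → ‖∫ x in (-b)..c, H (x + y * I)‖ ≤ C * Real.exp (c * V + h ^ 2 * (b ^ 2 + c ^ 2) / 2 - h ^ 2 * T ^ 2 / 2) * (b + c) := by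
    intro y hy
    have := intervalIntegral.norm_integral_le_of_norm_le_const (a := -b) (b := c) (f := fun x : ℝ => H (x + y * I)) (C := C * Real.exp (c * V + h ^ 2 * (b ^ 2 + c ^ 2) / 2 - h ^ 2 * T ^ 2 / 2)) ?_
    · rwa [show c - -b = b + c by ring, abs_of_pos (by linarith)] at this
    · intro x hx
      rw [uIoc_of_le (by linarith)] at hx
      simp only [hH]
      rw [norm_mul, EE_norm, ← Real.exp_add]
      have hy2 : |y| ≤ T := by rw [← Real.sqrt_sq_eq_abs, hy, Real.sqrt_sq hT.le]
      have := (hG (x + y * I) (by simp; linarith [hx.1]) (by simp; linarith [hx.2]) (by simpa using hy2)).2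
      gcongr
      have hx2 : x ^ 2 ≤ b ^ 2 + c ^ 2 := by
        rcases le_total 0 x with h0 | h0
        · nlinarith [hx.2]
        · nlinarith [hx.1]
      have hxV : x * V ≤ c * V := by gcongr; exact hx.2
      rw [hy]
      have : h ^ 2 * x ^ 2 ≤ h ^ 2 * (b ^ 2 + c ^ 2) := by gcongr
      linarith
  have left : ‖∫ y in (-T)..T, H ((-b : ℝ) + y * I)‖ ≤ C * Real.exp (-b * V + h ^ 2 * b ^ 2 / 2) * (√(2 * Real.pi) / h) := by
    rw [intervalIntegral.integral_of_le (by linarith)]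
    have hi := gint.const_mul (C * Real.exp (-b * V + h ^ 2 * b ^ 2 / 2))
    refine (norm_integral_le_of_norm_le (g := fun t => C * Real.exp (-b * V + h ^ 2 * b ^ 2 / 2) * Real.exp (-(h ^ 2 / 2) * t ^ 2)) hi.integrableOn ?_).trans ?_
    · refine (ae_restrict_iff' measurableSet_Ioc).2 (Eventually.of_forall fun t ht => ?_)
      simp only [hH]
      rw [norm_mul, EE_norm, mul_assoc, neg_sq]
      have := (hG ((-b:ℝ) + t * I) (by simp) (by simp; linarith) (by simpa using abs_le.2 ⟨ht.1.le, ht.2⟩)).2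
      gcongr
    · rw [← gauss_int hh, ← integral_const_mul]
      exact setIntegral_le_integral hi (Eventually.of_forall fun t => by positivity)
  have mid : ‖∫ t in Ioc (-T) T, H (c + t * I)‖ ≤ C * Real.exp (-b * V + h ^ 2 * b ^ 2 / 2) * (√(2 * Real.pi) / h) + 2 * (C * Real.exp (c * V + h ^ 2 * (b ^ 2 + c ^ 2) / 2 - h ^ 2 * T ^ 2 / 2) * (b + c)) := by
    rw [← intervalIntegral.integral_of_le (by linarith)]
    have h1 := hor (-T) (by ring)
    have h2 := hor T rfl
    set i1 := ∫ x in (-b)..c, H (x + (-T : ℝ) * I)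
    set i2 := ∫ x in (-b)..c, H (x + T * I)
    set i3 := ∫ y in (-T)..T, H (c + y * I)
    set i4 := ∫ y in (-T)..T, H ((-b : ℝ) + y * I)
    have e : i3 = i4 + I * (i1 - i2) := by
      have : I * ((i1 - i2) + I • i3 - I • i4) = 0 := by rw [rect, mul_zero]
      simp only [smul_eq_mul] at this
      linear_combination (-1 : ℂ) * this + (i3 - i4) * Complex.I_mul_I
    rw [e]
    refine (norm_add_le _ _).trans ?_
    rw [norm_mul, Complex.norm_I, one_mul]
    have := norm_sub_le i1 i2
    linarith
  rw [← spl]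
  refine (norm_add_le _ _).trans ?_
  have n2 := norm_add_le (∫ t in Iic (-T), H (c + t * I)) (∫ t in Ioi T, H (c + t * I))
  have e9 : K * Real.exp (- (h ^ 2 * T ^ 2 / 2)) = D * Real.exp (c * V + h ^ 2 * c ^ 2 / 2 - h ^ 2 * T ^ 2 / 2) := by
    rw [hK, mul_assoc, ← Real.exp_add, sub_eq_add_neg]
  rw [e9] at tail1 tail2
  have e10 : 2 * D * Real.exp (c * V + h ^ 2 * c ^ 2 / 2 - h ^ 2 * T ^ 2 / 2) / (h ^ 2 * T) = 2 * (D * Real.exp (c * V + h ^ 2 * c ^ 2 / 2 - h ^ 2 * T ^ 2 / 2) / (h ^ 2 * T)) := by ring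
  rw [e10]
  linarith
end

section
open Complex Metric Set Filter Topology MeasureTheory
open scoped LSeries.notation ArithmeticFunction.vonMangoldt

theorem term_val {d : ℝ} (n : ℕ) : LSeries.term (fun n => (Λ n : ℂ)) ((1 + d : ℝ) : ℂ) n = ((Λ n / n * Real.exp (-d * Real.log n) : ℝ) : ℂ) := by
  rcases Nat.eq_zero_or_pos n with rfl | hn
  · simp
  · have hn' : (0:ℝ) < n := by exact_mod_cast hn
    rw [LSeries.term_of_ne_zero hn.ne', show (n:ℂ) = ((n:ℝ):ℂ) by simp, ← Complex.ofReal_cpow hn'.le, ← Complex.ofReal_div]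
    congr 1
    rw [Real.rpow_add hn', Real.rpow_one, Real.rpow_def_of_pos hn', div_mul_eq_div_div, neg_mul, Real.exp_neg, mul_comm d]
    rfl

theorem Kz_hasSum {d : ℝ} (hd : 0 < d) : HasSum (fun n : ℕ => Λ n / n * Real.exp (-d * Real.log n)) (Kz (1 + d : ℝ)).re := by
  have h := Complex.hasSum_re (ArithmeticFunction.LSeriesSummable_vonMangoldt (s := ((1 + d : ℝ) : ℂ)) (by simpa using hd)).hasSum
  simp_rw [term_val, Complex.ofReal_re] at h
  unfold Kz LSeries
  simp_rw [term_val]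
  exact h

theorem Kz_norm {d : ℝ} (hd : 0 < d) (t : ℝ) : ‖Kz (1 + (d + t * I))‖ ≤ (Kz (1 + d : ℝ)).re := by
  unfold Kz LSeries
  refine tsum_of_norm_bounded (Kz_hasSum hd) fun n => ?_
  have : ‖LSeries.term (fun n => (Λ n : ℂ)) (1 + (d + t * I)) n‖ = ‖LSeries.term (fun n => (Λ n : ℂ)) ((1 + d : ℝ) : ℂ) n‖ := by
    rw [LSeries.norm_term_eq, LSeries.norm_term_eq]; simp
  rw [this, term_val, Complex.norm_real, Real.norm_of_nonneg]
  have := ArithmeticFunction.vonMangoldt_nonneg (n := n)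
  positivity

theorem NV_lower {h V X T : ℝ} (hh : 0 < h) (hX : 1000 ≤ X) (hV : 0 ≤ V) (hVX : V ≤ X) (hT : 100 ≤ T) (hXT : 1 / X ≤ etaT T) :
    2 * Real.pi * (1 - Real.exp (-(V ^ 2 / (2 * h ^ 2)))) -
    ((1560 * Real.log (T / (0.4 * etaT T)) / etaT T + 1.02) * Real.exp (-(0.9 * etaT T) * V + h ^ 2 * (0.9 * etaT T) ^ 2 / 2) * (√(2 * Real.pi) / h) +
      2 * ((0.9 * etaT T) + 1 / X) * (1560 * Real.log (T / (0.4 * etaT T)) / etaT T + 1.02) * Real.exp (1 / X * V + h ^ 2 * ((0.9 * etaT T) ^ 2 + (1 / X) ^ 2) / 2 - h ^ 2 * (T - 1) ^ 2 / 2)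
      + 2 * (2 * X + 1) * Real.exp (1 / X * V + h ^ 2 * (1 / X) ^ 2 / 2 - h ^ 2 * (T - 1) ^ 2 / 2) / (h ^ 2 * (T - 1)))
     ≤ NV h V := by
  have hc : (0:ℝ) < 1 / X := by positivity
  set c := 1 / X with hcd
  have e0 := eta_pos hT
  have hXc : 1 / c = X := by rw [hcd, one_div_one_div]
  have hz : ∀ t : ℝ, (c + t * I : ℂ) ≠ 0 := by
    intro t h; have := congrArg Complex.re h; simp at this; linarith
  have hGK : ∀ t : ℝ, Kz (1 + (c + t * I)) = Gz (c + t * I) + 1 / (c + t * I : ℂ) := by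
    intro t
    rw [Kz_eq (by simp; linarith)]; unfold Gz; rw [add_sub_cancel_left]; ring
  have hinv : ∀ t : ℝ, ‖1 / (c + t * I : ℂ)‖ ≤ X := by
    intro t
    rw [norm_div, norm_one, ← hXc]
    gcongr
    have := Complex.abs_re_le_norm (c + t * I : ℂ)
    simp at this
    exact (le_abs_self c).trans this
  have hGD : ∀ t : ℝ, ‖Gz (c + t * I)‖ ≤ 2 * X + 1 := by
    intro t
    have e : Gz (c + t * I) = Kz (1 + (c + t * I)) - 1 / (c + t * I : ℂ) := by rw [hGK]; ring
    rw [e]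
    refine (norm_sub_le _ _).trans ?_
    have h1 := (Kz_norm hc t).trans (Kz_real hc (by rw [hcd]; rw [div_le_div_iff₀] <;> linarith))
    rw [hXc] at h1
    have h2 : 6 * c ≤ 1 := by rw [hcd, mul_one_div, div_le_one (by linarith)]; linarith
    linarith [hinv t]
  have hcont : Continuous fun t : ℝ => Gz (c + t * I) := by
    rw [continuous_iff_continuousAt]; intro t
    have hre : 1 < (1 + (c + t * I) : ℂ).re := by simp; linarith
    have hd : DifferentiableAt ℂ Gz (c + t * I) := by
      unfold Gz logDeriv
      have ha : AnalyticAt ℂ Fz (1 + (c + t * I)) := Fz_analytic (by linarith)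
      have h1 : DifferentiableAt ℂ (fun z : ℂ => 1 + z) (c + t * I) := by fun_prop
      have h2 : DifferentiableAt ℂ (fun z : ℂ => deriv Fz (1 + z) / Fz (1 + z)) (c + t * I) := by
        refine DifferentiableAt.div ?_ ?_ (Fz_ne_right hre)
        · exact DifferentiableAt.comp (g := deriv Fz) (f := fun z : ℂ => 1 + z) _ ha.deriv.differentiableAt h1
        · exact DifferentiableAt.comp (g := Fz) (f := fun z : ℂ => 1 + z) _ ha.differentiableAt h1
      refine h2.neg.sub (DifferentiableAt.div (by fun_prop) (by fun_prop) ?_)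
      intro h; have := congrArg Complex.re h; simp at this; linarith
    exact hd.continuousAt.comp (f := fun t : ℝ => (c + t * I : ℂ)) (by fun_prop)
  obtain ⟨si, sb⟩ := shift (G := Gz) (c := c) (b := 0.9 * etaT T) (T := T - 1) (D := 2 * X + 1) hh hc (by positivity) (by linarith) (by positivity) hV
    (fun z h1 h2 h3 => Gz_bound hT h1 (h2.trans hXT) h3) hcont hGD
  have pi : Integrable (fun t : ℝ => 1 / (c + t * I : ℂ) * EE h V (c + t * I)) := by
    refine ((EE_int hh V c).norm.const_mul X).mono' ?_ (Eventually.of_forall fun t => ?_)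
    · refine (Continuous.mul ?_ (EE_cont h V c)).aestronglyMeasurable
      exact continuous_const.div (by fun_prop) hz
    · rw [norm_mul]; gcongr; exact hinv t
  have key := (Kz_EE hh V hc).2
  simp_rw [hGK, add_mul] at key
  rw [integral_add si pi, pole_EE hh V hc] at key
  have pl := pole_lower hh hV
  have : ‖((NV h V - ∫ u in Ioi (0:ℝ), Gs h (V - u) : ℝ) : ℂ)‖ = ‖∫ t : ℝ, Gz (c + t * I) * EE h V (c + t * I)‖ := by
    rw [Complex.ofReal_sub, ← key]; congr 1; ring
  rw [← this, Complex.norm_real, Real.norm_eq_abs] at sb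
  have := (abs_le.1 sb).1
  linarith
end

section
open Set Filter Topology MeasureTheory
open scoped ArithmeticFunction.vonMangoldt

theorem Gs_exp {h : ℝ} (hh : 0 < h) (V l : ℝ) : Real.exp V * Gs h (V - l) = Real.exp (l + h ^ 2 / 2) * Gs h (V - (l + h ^ 2)) := by
  unfold Gs
  have : Real.exp V * Real.exp (-((V - l) ^ 2 / (2 * h ^ 2))) = Real.exp (l + h ^ 2 / 2) * Real.exp (-((V - (l + h ^ 2)) ^ 2 / (2 * h ^ 2))) := by
    rw [← Real.exp_add, ← Real.exp_add]; congr 1; field_simp; ring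
  linear_combination (√(2 * Real.pi) / h) * this

theorem Gs_tail {h V X a d l : ℝ} (hh : 0 < h) (ha : 0 < a) (hV : V ≤ X - a) (hl : X ≤ l) (hd : d ≤ a / h ^ 2) :
    Gs h (V - l) ≤ √(2 * Real.pi) / h * Real.exp (d * X - a ^ 2 / (2 * h ^ 2)) * Real.exp (-d * l) := by
  unfold Gs
  rw [mul_assoc, ← Real.exp_add]
  gcongr
  have h1 : a ^ 2 + 2 * a * (l - X) ≤ (V - l) ^ 2 := by nlinarith
  have h2 : d * (l - X) ≤ a / h ^ 2 * (l - X) := mul_le_mul_of_nonneg_right hd (by linarith)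
  have h3 : (a ^ 2 + 2 * a * (l - X)) / (2 * h ^ 2) ≤ (V - l) ^ 2 / (2 * h ^ 2) := by gcongr
  have h4 : (a ^ 2 + 2 * a * (l - X)) / (2 * h ^ 2) = a ^ 2 / (2 * h ^ 2) + a / h ^ 2 * (l - X) := by field_simp
  linarith

theorem psi_NV {h X a L B : ℝ} (hh : 0 < h) (ha : 0 < a) (hL : 0 < L) (hX : 1000 ≤ X) (hd : 1 / X ≤ a / h ^ 2)
    (hB : ∀ V, X - a - L ≤ V → V ≤ X - a → B ≤ NV h V) :
    Real.exp (X - a) * (1 - Real.exp (-L)) * (B - √(2 * Real.pi) / h * Real.exp (1 - a ^ 2 / (2 * h ^ 2)) * (X + 1)) ≤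
     2 * Real.pi * Real.exp (h ^ 2 / 2) * Chebyshev.psi (Real.exp X) := by
  have hX0 : 0 < X := by linarith
  set N := ⌊Real.exp X⌋₊ with hN
  set E4 := √(2 * Real.pi) / h * Real.exp (1 - a ^ 2 / (2 * h ^ 2)) with hE4
  set F : ℝ → ℝ := fun V => ∑ n ∈ Finset.Ioc 0 N, Λ n / n * Gs h (V - Real.log n) with hF
  have hΛ : ∀ n : ℕ, 0 ≤ Λ n := fun n => ArithmeticFunction.vonMangoldt_nonneg
  have low : ∀ V, X - a - L ≤ V → V ≤ X - a → B - E4 * (X + 1) ≤ F V := by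
    intro V h1 h2
    have hd0 : 0 < 1 / X := by positivity
    have s1 := (Kz_EE hh V hd0).1.hasSum
    have s2 := (Kz_hasSum hd0).mul_left E4
    have s3 := hasSum_sum_of_ne_finset_zero (f := fun n : ℕ => if n ∈ Finset.Ioc 0 N then Λ n / n * Gs h (V - Real.log n) else 0) (s := Finset.Ioc 0 N) (L := SummationFilter.unconditional ℕ) (by intro n hn; rw [if_neg hn])
    rw [Finset.sum_congr rfl (fun n hn => if_pos hn)] at s3
    have := hasSum_le (fun n => ?_) s1 (s3.add s2)
    · have b := hB V h1 h2
      have k := Kz_real hd0 (by rw [div_le_div_iff₀] <;> linarith)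
      have h6 : 6 * (1 / X) ≤ 1 := by rw [mul_one_div, div_le_one (by linarith)]; linarith
      have hE : 0 ≤ E4 := by positivity
      rw [one_div_one_div] at k
      have : E4 * (Kz ((1 + 1 / X : ℝ))).re ≤ E4 * (X + 1) := by gcongr; linarith
      unfold NV at b
      linarith
    · split_ifs with hn
      · have := hΛ n
        have : 0 ≤ E4 * (Λ n / n * Real.exp (-(1 / X) * Real.log n)) := by positivity
        linarith
      · rw [zero_add]
        rcases Nat.eq_zero_or_pos n with rfl | hp
        · simp
        · have : N < n := by by_contra hc; exact hn (Finset.mem_Ioc.2 ⟨hp, not_lt.1 hc⟩)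
          have hl : X ≤ Real.log n := by
            rw [Real.le_log_iff_exp_le (by exact_mod_cast hp)]
            exact (Nat.lt_of_floor_lt this).le
          have := Gs_tail hh ha h2 hl hd
          rw [one_div_mul_cancel hX0.ne', ← hE4] at this
          calc Λ n / n * Gs h (V - Real.log n) ≤ Λ n / n * (E4 * Real.exp (-(1 / X) * Real.log n)) := by
                have := hΛ n; gcongr
            _ = _ := by ring
  have gc : Continuous (Gs h) := by unfold Gs; fun_prop
  have int1 : ∫ V in (X - a - L)..(X - a), Real.exp V * (B - E4 * (X + 1)) ≤ ∫ V in (X - a - L)..(X - a), Real.exp V * F V := by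
    refine intervalIntegral.integral_mono_on (by linarith) ?_ ?_ fun V hV => ?_
    · exact Continuous.intervalIntegrable (by fun_prop) _ _
    · refine Continuous.intervalIntegrable (Real.continuous_exp.mul ?_) _ _
      rw [hF]; fun_prop
    · exact mul_le_mul_of_nonneg_left (low V hV.1 hV.2) (Real.exp_pos _).le
  rw [intervalIntegral.integral_mul_const, integral_exp] at int1
  have e1 : Real.exp (X - a) - Real.exp (X - a - L) = Real.exp (X - a) * (1 - Real.exp (-L)) := by
    rw [sub_eq_add_neg (X - a) L, Real.exp_add]; ring
  rw [e1] at int1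
  refine int1.trans ?_
  simp_rw [hF, Finset.mul_sum]
  rw [intervalIntegral.integral_finsetSum]
  · rw [Chebyshev.psi, Finset.mul_sum]
    refine Finset.sum_le_sum fun n hn => ?_
    have hn0 : (0:ℝ) < n := by exact_mod_cast (Finset.mem_Ioc.1 hn).1
    have : ∀ V, Real.exp V * (Λ n / n * Gs h (V - Real.log n)) = Λ n * Real.exp (h ^ 2 / 2) * Gs h (V - (Real.log n + h ^ 2)) := by
      intro V
      have := Gs_exp hh V (Real.log n)
      rw [Real.exp_add, Real.exp_log hn0] at this
      field_simp
      linear_combination Λ n * this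
    simp_rw [this]
    rw [intervalIntegral.integral_const_mul, intervalIntegral.integral_of_le (by linarith)]
    have hi : ∫ V in Ioc (X - a - L) (X - a), Gs h (V - (Real.log n + h ^ 2)) ≤ 2 * Real.pi := by
      rw [← Gs_integral hh, ← integral_sub_right_eq_self (Gs h) (Real.log n + h ^ 2)]
      exact setIntegral_le_integral ((Gs_integrable hh).comp_sub_right _) (Eventually.of_forall fun u => (Gs_pos hh _).le)
    have := hΛ n
    calc Λ n * Real.exp (h ^ 2 / 2) * _ ≤ Λ n * Real.exp (h ^ 2 / 2) * (2 * Real.pi) := by gcongr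
      _ = _ := by ring
  · intro n hn
    exact Continuous.intervalIntegrable (by fun_prop) _ _
end

section
open Set Filter

theorem log15011 : Real.log 15011 ≤ 9.61845 := by
  have h1 : Real.log 15011 = 14 * Real.log 2 + 2 * Real.log (√(15011 / 16384)) := by
    rw [Real.log_sqrt (by norm_num), Real.log_div (by norm_num) (by norm_num), show (16384:ℝ) = 2 ^ 14 by norm_num, Real.log_pow]; push_cast; ring
  have h2 : √(15011 / 16384 : ℝ) ≤ 0.95719 := by rw [Real.sqrt_le_left (by norm_num)]; norm_num
  have h3 := Real.log_le_sub_one_of_pos (show (0:ℝ) < √(15011 / 16384) by positivity)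
  have := Real.log_two_lt_d9
  linarith

theorem exp_of_le {a b : ℝ} {n : ℕ} (h : (n:ℝ) ≤ a) (hb : b ≤ 2.7182818283 ^ n * (1 + (a - n) / 4 + ((a - n) / 4) ^ 2 / 2) ^ 4) : b ≤ Real.exp a := by
  have h1 := Real.exp_one_gt_d9
  have h2 : Real.exp a = Real.exp 1 ^ n * Real.exp ((a - n) / 4) ^ 4 := by
    rw [← Real.exp_nat_mul, ← Real.exp_nat_mul, ← Real.exp_add]; congr 1; push_cast; ring
  have h3 := Real.quadratic_le_exp_of_nonneg (show (0:ℝ) ≤ (a - n) / 4 by linarith)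
  rw [h2]
  refine hb.trans ?_
  have : 0 ≤ a - n := by linarith
  gcongr

theorem etaC {X s : ℝ} (hs : 0 ≤ s) (hX : X = 8999 * Real.exp s) :
    0.073968 / (22.84 + 2 * s) ≤ etaT (X / 3 + 1) ∧
    1560 * Real.log ((X / 3 + 1) / (0.4 * etaT (X / 3 + 1))) / etaT (X / 3 + 1) + 1.02 ≤ 7.07e6 * Real.exp (0.2 * s) := by
  have hes : 1 ≤ Real.exp s := Real.one_le_exp hs
  have hl : Real.log (5 * (X / 3 + 1) + 7) ≤ 9.61845 + s := by
    have : 5 * (X / 3 + 1) + 7 ≤ 15011 * Real.exp s := by rw [hX]; linarith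
    have h2 := Real.log_le_log (by rw [hX]; positivity) this
    rw [Real.log_mul (by norm_num) (Real.exp_ne_zero _), Real.log_exp] at h2
    linarith [log15011]
  have hT : 100 ≤ X / 3 + 1 := by rw [hX]; linarith
  have hl6 := log57 hT
  have he : etaT (X / 3 + 1) = 0.073968 / (2 * Real.log (5 * (X / 3 + 1) + 7) + 3.6) := by
    unfold etaT; field_simp; norm_num
  have h1 : 0.073968 / (22.84 + 2 * s) ≤ etaT (X / 3 + 1) := by
    rw [he]; exact div_le_div_of_nonneg_left (by norm_num) (by linarith) (by linarith)
  refine ⟨h1, ?_⟩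
  set η := etaT (X / 3 + 1)
  have hη : 0 < η := eta_pos hT
  have hu : 1 / η ≤ 308.8 * (1 + 0.0876 * s) := by
    rw [div_le_iff₀ hη]
    rw [div_le_iff₀ (by positivity)] at h1
    have : 0.073968 ≤ η * (22.84 * (1 + 0.0876 * s)) := h1.trans (by gcongr; linarith)
    nlinarith
  have hue : 1 + 0.0876 * s ≤ Real.exp (0.0876 * s) := by linarith [Real.add_one_le_exp (0.0876 * s)]
  have hlog : Real.log ((X / 3 + 1) / (0.4 * η)) ≤ 14.66 + 1.0876 * s := by
    have e1 : (X / 3 + 1) / (0.4 * η) ≤ 2316772 * Real.exp (1.0876 * s) := by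
      calc (X / 3 + 1) / (0.4 * η) = (X / 3 + 1) * (1 / η) * 2.5 := by field_simp; ring
        _ ≤ (3001 * Real.exp s) * (308.8 * Real.exp (0.0876 * s)) * 2.5 := by
            have : X / 3 + 1 ≤ 3001 * Real.exp s := by rw [hX]; linarith
            have : 1 / η ≤ 308.8 * Real.exp (0.0876 * s) := hu.trans (by gcongr)
            gcongr
        _ = 2316772 * (Real.exp s * Real.exp (0.0876 * s)) := by ring
        _ = _ := by rw [← Real.exp_add]; congr 2; ring
    have h2 := Real.log_le_log (by positivity) e1
    rw [Real.log_mul (by norm_num) (Real.exp_ne_zero _), Real.log_exp] at h2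
    have : Real.log 2316772 ≤ 14.66 := by
      rw [Real.log_le_iff_le_exp (by norm_num)]
      exact exp_of_le (n := 14) (by norm_num) (by norm_num)
    linarith
  have hc : 1560 * Real.log ((X / 3 + 1) / (0.4 * η)) / η ≤ 1560 * (14.66 + 1.0876 * s) * (308.8 * (1 + 0.0876 * s)) := by
    rw [mul_div_assoc, mul_assoc, div_eq_mul_one_div]
    gcongr
  have h9 : 1560 * (14.66 + 1.0876 * s) * (308.8 * (1 + 0.0876 * s)) + 1.02 ≤ 7.07e6 * (1 + 0.2 * s + (0.2 * s) ^ 2 / 2) := by nlinarith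
  have := Real.quadratic_le_exp_of_nonneg (show 0 ≤ 0.2 * s by positivity)
  nlinarith

theorem fin_comb {p e e1 e2 e3 w : ℝ} (hw : 0 < w) (hp : 3.14 < p) (E0 : e ≤ 0.0001 / w) (E1 : e1 ≤ 2 * p * (0.36 / w))
    (E2 : e2 ≤ 0.0001 / w) (E3 : e3 ≤ 0.0001 / w) : 2 * p * (1 - 0.362 / w) ≤ 2 * p * (1 - e) - (e1 + e2 + e3) := by
  have hv : 0 < 1 / w := by positivity
  have e0 : ∀ u : ℝ, u / w = u * (1 / w) := fun u => by ring
  simp only [e0 0.0001, e0 0.36, e0 0.362] at *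
  generalize 1 / w = v at *
  nlinarith

theorem pw_a {s X : ℝ} (hs0 : 0 ≤ s) (h3 : 8999 * (1 + s + s ^ 2 / 2) ≤ X) :
    (26.19 + 20 * s) * (22.84 + 2 * s) ≤ 0.9 * 0.073968 * 0.9989 * X := by nlinarith
theorem pw_b {h q : ℝ} (h0 : 0 ≤ h) (h1 : h ≤ 0.00002) (h2 : q ≤ 1) : h * q / 2 ≤ 0.001 := by nlinarith
theorem pw_c {h q : ℝ} (h0 : 0 ≤ h) (h1 : h ≤ 0.5) (h2 : 0 ≤ q) (h3 : q ≤ 0.01) : h ^ 2 + q ^ 2 ≤ 1 := by nlinarith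

set_option maxHeartbeats 4000000 in
theorem psi_lower {Z : ℝ} (hZ : 9.74 ≤ Z) : (1 - 2.6 / Z ^ 2) * Real.exp (Z ^ 4) ≤ Chebyshev.psi (Real.exp (Z ^ 4)) := by
  obtain ⟨X, hXZ⟩ : ∃ X, X = Z ^ 4 := ⟨_, rfl⟩
  have hZ0 : 0 < Z := by linarith
  have hX : 8999 ≤ X := by
    rw [hXZ]; calc (8999:ℝ) ≤ 9.74 ^ 4 := by norm_num
      _ ≤ _ := by gcongr
  obtain ⟨s, hs⟩ : ∃ s, s = Real.log (X / 8999) := ⟨_, rfl⟩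
  have hs0 : 0 ≤ s := by rw [hs]; exact Real.log_nonneg (by rw [le_div_iff₀] <;> linarith)
  have hXs : X = 8999 * Real.exp s := by rw [hs, Real.exp_log (by linarith)]; ring
  obtain ⟨hη1, hC⟩ := etaC hs0 hXs
  have hT : 100 ≤ X / 3 + 1 := by linarith
  have hη0 := eta_pos hT
  have hη2 := eta_le hT
  set η := etaT (X / 3 + 1) with hη
  set C := 1560 * Real.log ((X / 3 + 1) / (0.4 * η)) / η + 1.02 with hCd
  have p4 : Real.exp (s / 4) ^ 4 = Real.exp s := by rw [← Real.exp_nat_mul]; congr 1; push_cast; ring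
  have zu : Z ≤ 9.741 * Real.exp (s / 4) := by
    refine le_of_pow_le_pow_left₀ (n := 4) (by norm_num) (by positivity) ?_
    rw [mul_pow, p4, ← hXZ, hXs]; gcongr; norm_num
  have zl : 9.739 * Real.exp (s / 4) ≤ Z := by
    refine le_of_pow_le_pow_left₀ (n := 4) (by norm_num) (by positivity) ?_
    rw [mul_pow, p4, ← hXZ, hXs]; gcongr; norm_num
  have zl2 : 9.739 * (1 + s / 4) ≤ Z := le_trans (by gcongr; linarith [Real.add_one_le_exp (s / 4)]) zl
  have z2l : 94.86 * (1 + s / 2) ≤ Z ^ 2 := by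
    refine le_of_pow_le_pow_left₀ (n := 2) (by norm_num) (by positivity) ?_
    have : Real.exp (s / 2) ^ 2 = Real.exp s := by rw [← Real.exp_nat_mul]; congr 1; push_cast; ring
    rw [mul_pow, ← pow_mul, ← hXZ, hXs, ← this]
    have := Real.add_one_le_exp (s / 2)
    gcongr
    · norm_num
    · linarith
  have z5 : Z ^ 5 ≤ 87660 * Real.exp (1.25 * s) := by
    calc Z ^ 5 = X * Z := by rw [hXZ]; ring
      _ ≤ (8999 * Real.exp s) * (9.741 * Real.exp (s / 4)) := by rw [hXs]; gcongr
      _ = 87659.259 * (Real.exp s * Real.exp (s / 4)) := by ring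
      _ ≤ 87660 * (Real.exp s * Real.exp (s / 4)) := by gcongr; norm_num
      _ = _ := by rw [← Real.exp_add]; congr 2; ring
  have z2u : Z ^ 2 ≤ 94.9 * Real.exp (s / 2) := by
    calc Z ^ 2 ≤ (9.741 * Real.exp (s / 4)) ^ 2 := by gcongr
      _ = 9.741 ^ 2 * Real.exp (s / 2) := by rw [mul_pow, ← Real.exp_nat_mul]; congr 2; push_cast; ring
      _ ≤ _ := by gcongr; norm_num
  -- parameters
  have hh : 0 < 3 / Z ^ 3 := by positivity
  have hZ2 : 94 ≤ Z ^ 2 := le_trans (by norm_num) (pow_le_pow_left₀ (by norm_num) hZ 2)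
  have hZ3 : 923 ≤ Z ^ 3 := by
    calc (923:ℝ) ≤ 9.74 ^ 3 := by norm_num
      _ ≤ _ := by gcongr
  obtain ⟨h, hhd⟩ : ∃ h, h = 3 / Z ^ 3 := ⟨_, rfl⟩
  obtain ⟨a, had⟩ : ∃ a, a = 2.1 / Z ^ 2 := ⟨_, rfl⟩
  rw [← hhd] at hh
  have ha : 0 < a := by rw [had]; positivity
  have ha1 : a ≤ 0.023 := by rw [had, div_le_iff₀ (by positivity)]; linarith
  have hh1 : h ≤ 0.0033 := by rw [hhd, div_le_iff₀ (by positivity)]; linarith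
  have hh2 : h ^ 2 ≤ 0.00002 := (pow_le_pow_left₀ hh.le hh1 2).trans (by norm_num)
  have hZX : Z ≤ 0.001084 * X := by
    rw [hXZ, show Z ^ 4 = Z * Z ^ 3 by ring]; linarith only [mul_le_mul_of_nonneg_left hZ3 hZ0.le, hZ0]
  have hVl : ∀ V, X - a - Z ≤ V → 0.9989 * X ≤ V := by intro V hV; linarith
  have hbV : ∀ V, X - a - Z ≤ V → 26.19 + 20 * s ≤ 0.9 * η * V := by
    intro V hV
    have h1 := hVl V hV
    have h2 : 0.9 * (0.073968 / (22.84 + 2 * s)) * (0.9989 * X) ≤ 0.9 * η * V := by gcongr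
    refine le_trans ?_ h2
    have hq := Real.quadratic_le_exp_of_nonneg hs0
    have h3 : 8999 * (1 + s + s ^ 2 / 2) ≤ X := by rw [hXs]; gcongr
    rw [show 0.9 * (0.073968 / (22.84 + 2 * s)) * (0.9989 * X) = (0.9 * 0.073968 * 0.9989 * X) / (22.84 + 2 * s) by ring, le_div_iff₀ (by positivity)]
    exact pw_a hs0 h3
  have hXη : 1 / X ≤ η := by
    refine le_trans ?_ hη1
    rw [div_le_div_iff₀ (by linarith) (by positivity), hXs]
    linarith [Real.add_one_le_exp s]
  have hC0 : 0 ≤ C := (norm_nonneg _).trans (Gz_bound hT (z := 0) (by simp; positivity) (by simp; positivity) (by simp; linarith)).2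
  have hexpZ : ∀ k : ℝ, k * s ≤ 23 * s → Real.exp (k * s) * Real.exp (-(Z ^ 2 / 2)) ≤ 1e-20 := by
    intro k hk
    rw [← Real.exp_add]
    have : k * s + -(Z ^ 2 / 2) ≤ -47.43 := by linarith
    refine (Real.exp_le_exp.2 this).trans ?_
    rw [Real.exp_neg, inv_le_comm₀ (Real.exp_pos _) (by norm_num)]
    exact exp_of_le (n := 47) (by norm_num) (by norm_num)
  set B := 2 * Real.pi * (1 - 0.362 / Z ^ 2) with hB
  have hpi := Real.pi_gt_d2
  have hsq : 2.5 ≤ √(2 * Real.pi) := by apply Real.le_sqrt_of_sq_le; linarith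
  have hsq2 : √(2 * Real.pi) * √(2 * Real.pi) = 2 * Real.pi := Real.mul_self_sqrt (by positivity)
  have hsq3 : √(2 * Real.pi) ≤ 2 * Real.pi * 0.4 := by linarith only [mul_le_mul_of_nonneg_right hsq (Real.sqrt_nonneg (2 * Real.pi)), hsq2]
  have haX : a * X = 2.1 * Z ^ 2 := by rw [had, hXZ]; field_simp
  have hhT : h ^ 2 * (X / 3 + 1 - 1) ^ 2 / 2 = Z ^ 2 / 2 := by rw [hhd, hXZ]; field_simp; ring
  have hhT2 : h ^ 2 * (X / 3 + 1 - 1) = 3 / Z ^ 2 := by rw [hhd, hXZ]; field_simp; ring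
  have hah : a ^ 2 / (2 * h ^ 2) = 0.245 * Z ^ 2 := by rw [had, hhd]; field_simp; norm_num
  have hsh : √(2 * Real.pi) / h ≤ 2 * Real.pi * (0.4 / 3) * Z ^ 3 := by
    rw [hhd, div_div_eq_mul_div, mul_div_assoc]
    calc √(2 * Real.pi) * (Z ^ 3 / 3) ≤ 2 * Real.pi * 0.4 * (Z ^ 3 / 3) := by gcongr
      _ = _ := by ring
  have h3 : Real.exp 1.001 ≤ 3 := by
    have := Real.exp_one_lt_d9
    have h2 : Real.exp 1.001 = Real.exp 1 * Real.exp 0.001 := by rw [← Real.exp_add]; norm_num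
    have h4 := Real.exp_bound_div_one_sub_of_interval (x := 0.001) (by norm_num) (by norm_num)
    rw [h2]
    calc Real.exp 1 * Real.exp 0.001 ≤ 2.7182818286 * (1 / (1 - 0.001)) := by gcongr
      _ ≤ _ := by norm_num
  obtain ⟨t0, ht0⟩ : ∃ t, t = Real.exp (-(Z ^ 2 / 2)) := ⟨_, rfl⟩
  rw [← ht0] at hexpZ
  have ht0p : 0 < t0 := by rw [ht0]; positivity
  have hbs : h ^ 2 * (0.9 * η) ^ 2 / 2 ≤ 0.001 := by
    have : (0.9 * η) ^ 2 ≤ 1 := pow_le_one₀ (by positivity) (by linarith)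
    exact pw_b (sq_nonneg h) hh2 this
  have hX1 : 1 / X ≤ 0.01 := by rw [div_le_iff₀ (by linarith)]; linarith
  have hX1p : 0 < 1 / X := by positivity
  have main := psi_NV (h := h) (X := X) (a := a) (L := Z) (B := B) hh ha hZ0 (by linarith) (by
      rw [div_le_div_iff₀ (by linarith) (by positivity)]
      linarith) (by
    intro V hV1 hV2
    have hV0 : 0 ≤ V := by linarith [hVl V hV1]
    refine le_trans ?_ (NV_lower (T := X / 3 + 1) (X := X) hh (by linarith) hV0 (by linarith) hT hXη)
    rw [← hη, ← hCd, hhT, hhT2]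
    have hVX : 1 / X * V ≤ 1 := by rw [div_mul_eq_mul_div, one_mul, div_le_one (by linarith)]; linarith
    have E0 : Real.exp (-(V ^ 2 / (2 * h ^ 2))) ≤ 0.0001 / Z ^ 2 := by
      rw [le_div_iff₀ (by positivity)]
      have : Real.exp (-(V ^ 2 / (2 * h ^ 2))) ≤ t0 := by
        rw [ht0]; apply Real.exp_le_exp.2
        have : Z ^ 2 / 2 ≤ V ^ 2 / (2 * h ^ 2) := by
          have : Z ≤ V := by linarith [hVl V hV1]
          gcongr; linarith
        linarith
      have h5 := hexpZ (1 / 2) (by linarith)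
      rw [one_div_mul_eq_div] at h5
      calc _ ≤ t0 * (94.9 * Real.exp (s / 2)) := by gcongr
        _ = 94.9 * (Real.exp (s / 2) * t0) := by ring
        _ ≤ 94.9 * 1e-20 := by gcongr
        _ ≤ _ := by norm_num
    have E1 : C * Real.exp (-(0.9 * η) * V + h ^ 2 * (0.9 * η) ^ 2 / 2) * (√(2 * Real.pi) / h) ≤ 2 * Real.pi * (0.36 / Z ^ 2) := by
      rw [show 2 * Real.pi * (0.36 / Z ^ 2) = 2 * Real.pi * 0.36 / Z ^ 2 by ring, le_div_iff₀ (by positivity)]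
      have e : Real.exp (-(0.9 * η) * V + h ^ 2 * (0.9 * η) ^ 2 / 2) ≤ Real.exp (-26.189 + -20 * s) := by
        apply Real.exp_le_exp.2; linarith [hbV V hV1]
      have e2 : Real.exp (-26.189) ≤ 1 / 2.36e11 := by
        rw [Real.exp_neg, ← one_div]; gcongr; exact exp_of_le (n := 26) (by norm_num) (by norm_num)
      calc _ ≤ (7.07e6 * Real.exp (0.2 * s)) * Real.exp (-26.189 + -20 * s) * (2 * Real.pi * (0.4 / 3) * Z ^ 3) * Z ^ 2 := by gcongr
        _ = 2 * Real.pi * (7.07e6 * (0.4 / 3)) * (Real.exp (0.2 * s) * Real.exp (-26.189 + -20 * s)) * Z ^ 5 := by ring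
        _ ≤ 2 * Real.pi * (7.07e6 * (0.4 / 3)) * (Real.exp (0.2 * s) * Real.exp (-26.189 + -20 * s)) * (87660 * Real.exp (1.25 * s)) := by gcongr
        _ = 2 * Real.pi * (7.07e6 * (0.4 / 3) * 87660) * (Real.exp (0.2 * s) * Real.exp (-26.189 + -20 * s) * Real.exp (1.25 * s)) := by ring
        _ = 2 * Real.pi * (7.07e6 * (0.4 / 3) * 87660) * (Real.exp (-18.55 * s + -26.189)) := by
            rw [← Real.exp_add, ← Real.exp_add]; congr 2; ring
        _ ≤ 2 * Real.pi * (7.07e6 * (0.4 / 3) * 87660) * (Real.exp (-26.189)) := by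
            gcongr; linarith
        _ ≤ 2 * Real.pi * (7.07e6 * (0.4 / 3) * 87660) * (1 / 2.36e11) := by gcongr
        _ = 2 * Real.pi * (7.07e6 * (0.4 / 3) * 87660 * (1 / 2.36e11)) := by ring
        _ ≤ _ := by gcongr; norm_num
    have hsm : h ^ 2 * ((0.9 * η) ^ 2 + (1 / X) ^ 2) / 2 ≤ 0.001 := by
      have : (0.9 * η) ^ 2 + (1 / X) ^ 2 ≤ 1 := pw_c (by positivity) (by linarith) hX1p.le hX1
      exact pw_b (sq_nonneg h) hh2 this
    have E2 : 2 * (0.9 * η + 1 / X) * C * Real.exp (1 / X * V + h ^ 2 * ((0.9 * η) ^ 2 + (1 / X) ^ 2) / 2 - Z ^ 2 / 2) ≤ 0.0001 / Z ^ 2 := by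
      rw [le_div_iff₀ (by positivity)]
      have e : Real.exp (1 / X * V + h ^ 2 * ((0.9 * η) ^ 2 + (1 / X) ^ 2) / 2 - Z ^ 2 / 2) ≤ 3 * t0 := by
        calc _ ≤ Real.exp (1.001 + -(Z ^ 2 / 2)) := by apply Real.exp_le_exp.2; linarith
          _ = Real.exp 1.001 * t0 := by rw [Real.exp_add, ht0]
          _ ≤ _ := by gcongr
      have h5 := hexpZ 0.7 (by linarith)
      calc _ ≤ 2 * (0.9 * 0.005 + 0.01) * (7.07e6 * Real.exp (0.2 * s)) * (3 * t0) * (94.9 * Real.exp (s / 2)) := by gcongr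
        _ = 2 * (0.9 * 0.005 + 0.01) * 7.07e6 * 3 * 94.9 * ((Real.exp (0.2 * s) * Real.exp (s / 2)) * t0) := by ring
        _ = 2 * (0.9 * 0.005 + 0.01) * 7.07e6 * 3 * 94.9 * (Real.exp (0.7 * s) * t0) := by rw [← Real.exp_add]; congr 3; ring
        _ ≤ 2 * (0.9 * 0.005 + 0.01) * 7.07e6 * 3 * 94.9 * 1e-20 := by gcongr
        _ ≤ _ := by norm_num
    have E3 : 2 * (2 * X + 1) * Real.exp (1 / X * V + h ^ 2 * (1 / X) ^ 2 / 2 - Z ^ 2 / 2) / (3 / Z ^ 2) ≤ 0.0001 / Z ^ 2 := by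
      rw [le_div_iff₀ (by positivity)]
      have e : Real.exp (1 / X * V + h ^ 2 * (1 / X) ^ 2 / 2 - Z ^ 2 / 2) ≤ 3 * t0 := by
        calc _ ≤ Real.exp (1.001 + -(Z ^ 2 / 2)) := by
              apply Real.exp_le_exp.2
              have : h ^ 2 * (1 / X) ^ 2 / 2 ≤ h ^ 2 * ((0.9 * η) ^ 2 + (1 / X) ^ 2) / 2 := by gcongr; linarith [sq_nonneg (0.9 * η)]
              linarith
          _ = Real.exp 1.001 * t0 := by rw [Real.exp_add, ht0]
          _ ≤ _ := by gcongr
      have h5 := hexpZ 2 (by linarith)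
      calc _ ≤ 2 * (2 * X + 1) * (3 * t0) / (3 / Z ^ 2) * Z ^ 2 := by gcongr
        _ = 2 * (2 * X + 1) * X * t0 := by rw [hXZ]; field_simp
        _ ≤ 2 * (2 * X + X) * X * t0 := by gcongr; linarith
        _ = 6 * 8999 ^ 2 * (Real.exp (2 * s) * t0) := by rw [hXs, two_mul s, Real.exp_add]; ring
        _ ≤ 6 * 8999 ^ 2 * 1e-20 := by gcongr
        _ ≤ _ := by norm_num
    exact fin_comb (by positivity) hpi E0 E1 E2 E3)
  have E4 : √(2 * Real.pi) / h * Real.exp (1 - a ^ 2 / (2 * h ^ 2)) * (X + 1) ≤ 2 * Real.pi * (0.03 / Z ^ 2) := by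
    rw [show 2 * Real.pi * (0.03 / Z ^ 2) = 2 * Real.pi * 0.03 / Z ^ 2 by ring, le_div_iff₀ (by positivity), hah]
    have e : Real.exp (1 - 0.245 * Z ^ 2) ≤ Real.exp (-22.24 + -11.62 * s) := by
      apply Real.exp_le_exp.2; linarith
    have e2 : Real.exp (-22.24) ≤ 1 / 4.5e9 := by
      rw [Real.exp_neg, ← one_div]; gcongr; exact exp_of_le (n := 22) (by norm_num) (by norm_num)
    have e3 : X + 1 ≤ 9000 * Real.exp s := by rw [hXs]; linarith [Real.one_le_exp hs0]
    calc _ ≤ (2 * Real.pi * (0.4 / 3) * Z ^ 3) * Real.exp (-22.24 + -11.62 * s) * (9000 * Real.exp s) * Z ^ 2 := by gcongr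
      _ = 2 * Real.pi * (9000 * (0.4 / 3)) * (Real.exp (-22.24 + -11.62 * s) * Real.exp s) * Z ^ 5 := by ring
      _ ≤ 2 * Real.pi * (9000 * (0.4 / 3)) * (Real.exp (-22.24 + -11.62 * s) * Real.exp s) * (87660 * Real.exp (1.25 * s)) := by gcongr
      _ = 2 * Real.pi * (9000 * (0.4 / 3) * 87660) * (Real.exp (-22.24 + -11.62 * s) * Real.exp s * Real.exp (1.25 * s)) := by ring
      _ = 2 * Real.pi * (9000 * (0.4 / 3) * 87660) * (Real.exp (-9.37 * s + -22.24)) := by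
          rw [← Real.exp_add, ← Real.exp_add]; congr 2; ring
      _ ≤ 2 * Real.pi * (9000 * (0.4 / 3) * 87660) * (Real.exp (-22.24)) := by
          gcongr; linarith
      _ ≤ 2 * Real.pi * (9000 * (0.4 / 3) * 87660) * (1 / 4.5e9) := by gcongr
      _ = 2 * Real.pi * (9000 * (0.4 / 3) * 87660 * (1 / 4.5e9)) := by ring
      _ ≤ _ := by gcongr; norm_num
  have E5 : Real.exp (-Z) ≤ 0.006 / Z ^ 2 := by
    rw [le_div_iff₀ (by positivity)]
    have e2 : Real.exp (-9.739) ≤ 1 / 16900 := by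
      rw [Real.exp_neg, ← one_div]; gcongr; exact exp_of_le (n := 9) (by norm_num) (by norm_num)
    calc _ ≤ Real.exp (-9.739 + -(s / 2)) * (94.9 * Real.exp (s / 2)) := by gcongr; linarith
      _ = 94.9 * (Real.exp (-9.739 + -(s / 2)) * Real.exp (s / 2)) := by ring
      _ = 94.9 * Real.exp (-9.739) := by rw [← Real.exp_add]; congr 2; ring
      _ ≤ 94.9 * (1 / 16900) := by gcongr
      _ ≤ _ := by norm_num
  rw [← hXZ]
  have hh6 : h ^ 2 / 2 ≤ 0.001 / Z ^ 2 := by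
    rw [hhd, le_div_iff₀ (by positivity)]
    have : (3 / Z ^ 3) ^ 2 / 2 * Z ^ 2 = 4.5 / (Z ^ 2 * Z ^ 2) := by field_simp; norm_num
    rw [this, div_le_iff₀ (by positivity)]; linarith only [mul_le_mul hZ2 hZ2 (by norm_num) (by positivity)]
  have hexa : 1 - a - h ^ 2 / 2 ≤ Real.exp (-a + -(h ^ 2 / 2)) := by linarith [Real.add_one_le_exp (-a + -(h ^ 2 / 2))]
  obtain ⟨w, hw⟩ : ∃ w, w = 1 / Z ^ 2 := ⟨_, rfl⟩
  have e0 : ∀ u : ℝ, u / Z ^ 2 = u * w := fun u => by rw [hw]; ring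
  have hw0 : 0 < w := by rw [hw]; positivity
  have hw1 : w ≤ 0.0107 := by rw [hw, div_le_iff₀ (by positivity)]; linarith
  rw [e0] at E4 E5 hh6 had hB ⊢
  have m2 : Real.exp (X - a) * (1 - 0.006 * w) * (2 * Real.pi * (1 - 0.392 * w)) ≤ 2 * Real.pi * Real.exp (h ^ 2 / 2) * Chebyshev.psi (Real.exp X) := by
    refine le_trans ?_ main
    have : 0 ≤ 1 - 0.392 * w := by linarith
    have : 0 ≤ 1 - 0.006 * w := by linarith
    have : 0 ≤ 1 - Real.exp (-Z) := by linarith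
    gcongr
    rw [hB]; linarith
  have m3 : Real.exp X * (Real.exp (-a + -(h ^ 2 / 2)) * ((1 - 0.006 * w) * (1 - 0.392 * w))) ≤ Chebyshev.psi (Real.exp X) := by
    have e1 : Real.exp (X - a) = Real.exp X * Real.exp (-a + -(h ^ 2 / 2)) * Real.exp (h ^ 2 / 2) := by
      rw [← Real.exp_add, ← Real.exp_add]; congr 1; ring
    rw [e1] at m2
    have pp : 0 < 2 * Real.pi * Real.exp (h ^ 2 / 2) := by positivity
    refine le_of_mul_le_mul_left ?_ pp
    refine le_trans (le_of_eq ?_) m2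
    ring
  refine le_trans ?_ m3
  rw [mul_comm]
  gcongr
  have q1 : 1 - 0.398 * w ≤ (1 - 0.006 * w) * (1 - 0.392 * w) := by linarith only [sq_nonneg w, hw0]
  have q2 : 1 - 2.101 * w ≤ Real.exp (-a + -(h ^ 2 / 2)) := by linarith
  calc 1 - 2.6 * w ≤ (1 - 2.101 * w) * (1 - 0.398 * w) := by linarith only [sq_nonneg w, hw0]
    _ ≤ _ := mul_le_mul q2 q1 (by linarith) (Real.exp_pos _).le
end

section
open ArithmeticFunction

theorem logfac (N : ℕ) : Real.log (N.factorial) = ∑ n ∈ Finset.Ioc 0 N, Λ n * ((N / n : ℕ) : ℝ) := by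
  induction N with
  | zero => simp
  | succ k ih =>
    rw [Nat.factorial_succ]
    push_cast
    rw [Real.log_mul (by positivity) (by positivity), ih]
    have h1 : ∑ n ∈ Finset.Ioc 0 (k + 1), Λ n * (((k + 1) / n : ℕ) : ℝ)
        = ∑ n ∈ Finset.Ioc 0 (k + 1), Λ n * ((k / n : ℕ) : ℝ) + ∑ n ∈ Finset.Ioc 0 (k + 1), (if n ∣ k + 1 then Λ n else 0) := by
      rw [← Finset.sum_add_distrib]
      refine Finset.sum_congr rfl fun n _ => ?_
      rw [Nat.succ_div]; split_ifs <;> push_cast <;> ring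
    rw [h1, ← Finset.sum_filter]
    have h2 : (Finset.Ioc 0 (k + 1)).filter (fun n => n ∣ k + 1) = (k + 1).divisors := by
      ext n; simp only [Finset.mem_filter, Finset.mem_Ioc, Nat.mem_divisors]
      constructor
      · rintro ⟨_, h⟩; exact ⟨h, by omega⟩
      · rintro ⟨h, _⟩; exact ⟨⟨Nat.pos_of_dvd_of_pos h (by omega), Nat.le_of_dvd (by omega) h⟩, h⟩
    rw [h2, vonMangoldt_sum, Finset.sum_Ioc_succ_top (by omega), Nat.div_eq_of_lt (Nat.lt_succ_self k)]
    push_cast; ring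

theorem logfac' (N M : ℕ) (h : N ≤ M) : Real.log (N.factorial) = ∑ n ∈ Finset.Ioc 0 M, Λ n * ((N / n : ℕ) : ℝ) := by
  rw [logfac]
  refine Finset.sum_subset (Finset.Ioc_subset_Ioc le_rfl h) ?_
  intro n hn hn2
  simp only [Finset.mem_Ioc] at hn hn2
  rw [Nat.div_eq_of_lt (by omega)]; simp

/-- step function of a list of (d, c) -/
def Af (cs : List (ℕ × ℤ)) (k : ℕ) : ℤ := (cs.map fun c => c.2 * ((k / c.1 : ℕ) : ℤ)).sum

theorem Tsum (cs : List (ℕ × ℤ)) (N : ℕ) :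
    (cs.map fun c => (c.2 : ℝ) * Real.log ((N / c.1).factorial)).sum = ∑ n ∈ Finset.Ioc 0 N, Λ n * (Af cs (N / n) : ℝ) := by
  induction cs with
  | nil => simp [Af]
  | cons c cs ih =>
    rw [List.map_cons, List.sum_cons, ih, logfac' _ N (Nat.div_le_self _ _), Finset.mul_sum, ← Finset.sum_add_distrib]
    refine Finset.sum_congr rfl fun n _ => ?_
    simp only [Af, List.map_cons, List.sum_cons]
    rw [Int.cast_add, Int.cast_mul, Int.cast_natCast, Nat.div_div_eq_div_mul, mul_comm c.1 n, ← Nat.div_div_eq_div_mul]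
    ring

theorem fac_nat (n : ℕ) : (n + 1 : ℝ) * Real.log (n + 1) - (n + 1) + 1 ≤ Real.log ((n + 1).factorial) ∧
    Real.log ((n + 1).factorial) ≤ (n + 1 : ℝ) * Real.log (n + 1) - (n + 1) + 1 + Real.log (n + 1) := by
  induction n with
  | zero => simp
  | succ n ih =>
    obtain ⟨h1, h2⟩ := ih
    rw [Nat.factorial_succ (n + 1)]
    push_cast
    rw [Real.log_mul (by positivity) (by positivity)]
    have e : (n:ℝ) + 1 + 1 = n + 2 := by ring
    rw [e]
    have a1 := Real.log_le_sub_one_of_pos (show 0 < (n + 2 : ℝ) / (n + 1) by positivity)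
    have a2 := Real.log_le_sub_one_of_pos (show 0 < (n + 1 : ℝ) / (n + 2) by positivity)
    rw [Real.log_div (by positivity) (by positivity)] at a1 a2
    have b1 : (n + 1 : ℝ) * ((n + 2 : ℝ) / (n + 1) - 1) = 1 := by field_simp; ring
    have b2 : (n + 2 : ℝ) * ((n + 1 : ℝ) / (n + 2) - 1) = -1 := by field_simp; ring
    have c1 := mul_le_mul_of_nonneg_left a1 (show 0 ≤ (n + 1 : ℝ) by positivity)
    have c2 := mul_le_mul_of_nonneg_left a2 (show 0 ≤ (n + 2 : ℝ) by positivity)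
    rw [b1] at c1; rw [b2] at c2
    constructor <;> linarith

theorem fac_real {x : ℝ} (hx : 1 ≤ x) : x * Real.log x - x + 1 - Real.log x ≤ Real.log (⌊x⌋₊.factorial) ∧
    Real.log (⌊x⌋₊.factorial) ≤ x * Real.log x - x + 1 + Real.log x := by
  have hn : 1 ≤ ⌊x⌋₊ := (Nat.one_le_floor_iff x).2 hx
  obtain ⟨n, hn'⟩ : ∃ n, ⌊x⌋₊ = n + 1 := ⟨⌊x⌋₊ - 1, by omega⟩
  have f1 := Nat.floor_le (show 0 ≤ x by linarith)
  have f2 := Nat.lt_floor_add_one x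
  have h := fac_nat n
  rw [hn'] at f1 f2 ⊢
  push_cast at f1 f2
  obtain ⟨h1, h2⟩ := h
  have hxp : 0 < x := by linarith
  have a1 := Real.log_le_sub_one_of_pos (show 0 < x / (n + 1) by positivity)
  have a2 := Real.log_le_sub_one_of_pos (show 0 < (n + 1 : ℝ) / x by positivity)
  rw [Real.log_div (by positivity) (by positivity)] at a1 a2
  have b1 : (n + 1 : ℝ) * (x / (n + 1) - 1) = x - (n + 1) := by field_simp
  have b2 : x * ((n + 1 : ℝ) / x - 1) = (n + 1) - x := by field_simp
  have c1 := mul_le_mul_of_nonneg_left a1 (show 0 ≤ (n + 1 : ℝ) by positivity)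
  have c2 := mul_le_mul_of_nonneg_left a2 hxp.le
  rw [b1] at c1; rw [b2] at c2
  have l0 := Real.log_nonneg hx
  have l1 : Real.log (n + 1) ≤ Real.log x := Real.log_le_log (by positivity) f1
  have l2 : 0 ≤ Real.log ((n:ℝ) + 1) := Real.log_nonneg (by linarith [(Nat.cast_nonneg n : (0:ℝ) ≤ n)])
  have l3 : (x - (n + 1)) * Real.log x ≤ Real.log x := by nlinarith
  have l4 : 0 ≤ (x - (n + 1)) * Real.log (n + 1) := mul_nonneg (by linarith) l2
  constructor <;> linarith

/-- `-∑ c log d / d` -/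
noncomputable def Ic (cs : List (ℕ × ℤ)) : ℝ := (cs.map fun c => -(c.2 : ℝ) * Real.log c.1 / c.1).sum
noncomputable def Lc (cs : List (ℕ × ℤ)) : ℝ := (cs.map fun c => |(c.2 : ℝ)| * Real.log c.1).sum
def Kc (cs : List (ℕ × ℤ)) : ℤ := (cs.map fun c => |c.2|).sum
def Cc (cs : List (ℕ × ℤ)) : ℤ := (cs.map fun c => c.2).sum
def Hc (cs : List (ℕ × ℤ)) : ℚ := (cs.map fun c => (c.2 : ℚ) / c.1).sum

theorem Tbound (cs : List (ℕ × ℤ)) {x : ℝ} (hx : 1 ≤ x) (hd : ∀ c ∈ cs, 1 ≤ c.1 ∧ (c.1 : ℝ) ≤ x) :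
    |(cs.map fun c => (c.2 : ℝ) * Real.log ((⌊x⌋₊ / c.1).factorial)).sum - ((Hc cs : ℝ) * (x * Real.log x - x) + Ic cs * x + Cc cs)|
      ≤ Kc cs * Real.log x - Lc cs := by
  induction cs with
  | nil => simp [Ic, Lc, Kc, Cc, Hc]
  | cons c cs ih =>
    have ih := ih (fun c hc => hd c (List.mem_cons_of_mem _ hc))
    obtain ⟨d1, d2⟩ := hd c List.mem_cons_self
    have dp : (0:ℝ) < c.1 := by exact_mod_cast d1
    have hxd : 1 ≤ x / c.1 := by rwa [le_div_iff₀ dp, one_mul]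
    have hf := fac_real hxd
    rw [Nat.floor_div_natCast, Real.log_div (by linarith) dp.ne'] at hf
    simp only [Ic, Lc, Kc, Cc, Hc, List.map_cons, List.sum_cons] at ih ⊢
    push_cast at ih ⊢
    have key : |(c.2 : ℝ) * Real.log ((⌊x⌋₊ / c.1).factorial) - (c.2 : ℝ) * (x / c.1 * (Real.log x - Real.log c.1) - x / c.1 + 1)|
        ≤ |(c.2 : ℝ)| * (Real.log x - Real.log c.1) := by
      rw [← mul_sub, abs_mul]
      refine mul_le_mul_of_nonneg_left ?_ (abs_nonneg _)
      rw [abs_le]; constructor <;> linarith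
    rw [abs_le] at ih key ⊢
    have e : (c.2 : ℝ) * (x / c.1 * (Real.log x - Real.log c.1) - x / c.1 + 1) = (c.2 : ℝ) / c.1 * (x * Real.log x - x) + (-(c.2 : ℝ) * Real.log c.1 / c.1) * x + c.2 := by
      field_simp; ring
    rw [e] at key
    constructor <;> nlinarith [ih.1, ih.2, key.1, key.2]

theorem psi_Ioc (x : ℝ) : Chebyshev.psi x = ∑ n ∈ Finset.Ioc 0 ⌊x⌋₊, Λ n := rfl

theorem cheb_lower (cs : List (ℕ × ℤ)) (D : ℕ) (hA : ∀ k, Af cs k ≤ D) (hH : Hc cs = 0) {x : ℝ} (hx : 1 ≤ x)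
    (hd : ∀ c ∈ cs, 1 ≤ c.1 ∧ (c.1 : ℝ) ≤ x) :
    Ic cs * x + Cc cs + Lc cs - Kc cs * Real.log x ≤ D * Chebyshev.psi x := by
  have h := Tbound cs hx hd
  rw [Tsum, hH, abs_le] at h
  have : ∑ n ∈ Finset.Ioc 0 ⌊x⌋₊, Λ n * (Af cs (⌊x⌋₊ / n) : ℝ) ≤ D * Chebyshev.psi x := by
    rw [psi_Ioc, Finset.mul_sum]
    refine Finset.sum_le_sum fun n _ => ?_
    rw [mul_comm]
    refine mul_le_mul_of_nonneg_right ?_ vonMangoldt_nonneg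
    exact_mod_cast hA _
  push_cast at h
  linarith [h.1]

theorem cheb_upper (cs : List (ℕ × ℤ)) (hA : ∀ k, 0 ≤ Af cs k) (hA6 : ∀ k, 1 ≤ k → k < 6 → 1 ≤ Af cs k) (hH : Hc cs = 0) {x : ℝ} (hx : 1 ≤ x)
    (hd : ∀ c ∈ cs, 1 ≤ c.1 ∧ (c.1 : ℝ) ≤ x) :
    Chebyshev.psi x - Chebyshev.psi (x / 6) ≤ Ic cs * x + Cc cs + Kc cs * Real.log x - Lc cs := by
  have h := Tbound cs hx hd
  rw [Tsum, hH, abs_le] at h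
  have e6 : ⌊x / 6⌋₊ = ⌊x⌋₊ / 6 := by exact_mod_cast Nat.floor_div_natCast x 6
  have : Chebyshev.psi x - Chebyshev.psi (x / 6) ≤ ∑ n ∈ Finset.Ioc 0 ⌊x⌋₊, Λ n * (Af cs (⌊x⌋₊ / n) : ℝ) := by
    rw [psi_Ioc, psi_Ioc, e6, ← Finset.sum_Ioc_consecutive _ (Nat.zero_le (⌊x⌋₊ / 6)) (Nat.div_le_self _ _),
      ← Finset.sum_Ioc_consecutive (fun n => Λ n * (Af cs (⌊x⌋₊ / n) : ℝ)) (Nat.zero_le (⌊x⌋₊ / 6)) (Nat.div_le_self _ _), add_sub_cancel_left]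
    have a1 : 0 ≤ ∑ n ∈ Finset.Ioc 0 (⌊x⌋₊ / 6), Λ n * (Af cs (⌊x⌋₊ / n) : ℝ) :=
      Finset.sum_nonneg fun n _ => mul_nonneg vonMangoldt_nonneg (by exact_mod_cast hA _)
    have a2 : ∑ n ∈ Finset.Ioc (⌊x⌋₊ / 6) ⌊x⌋₊, Λ n ≤ ∑ n ∈ Finset.Ioc (⌊x⌋₊ / 6) ⌊x⌋₊, Λ n * (Af cs (⌊x⌋₊ / n) : ℝ) := by
      refine Finset.sum_le_sum fun n hn => ?_
      rw [Finset.mem_Ioc] at hn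
      have n0 : 0 < n := by omega
      refine le_mul_of_one_le_right vonMangoldt_nonneg ?_
      exact_mod_cast hA6 _ ((Nat.one_le_div_iff n0).2 hn.2) ((Nat.div_lt_iff_lt_mul n0).2 (by omega))
    linarith
  push_cast at h
  linarith [h.2]

theorem Af_add (cs : List (ℕ × ℤ)) (Q : ℕ) (hQ : ∀ c ∈ cs, 1 ≤ c.1 ∧ c.1 ∣ Q) (k : ℕ) : Af cs (k + Q) = Af cs k + Af cs Q := by
  induction cs with
  | nil => simp [Af]
  | cons c cs ih =>
    have ih := ih (fun c hc => hQ c (List.mem_cons_of_mem _ hc))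
    simp only [Af, List.map_cons, List.sum_cons] at ih ⊢
    rw [ih]
    obtain ⟨h1, e, rfl⟩ := hQ c List.mem_cons_self
    rw [Nat.add_mul_div_left _ _ h1, Nat.mul_div_cancel_left _ h1]; push_cast; ring

theorem Af_mod (cs : List (ℕ × ℤ)) (Q : ℕ) (hQ : ∀ c ∈ cs, 1 ≤ c.1 ∧ c.1 ∣ Q) (h0 : Af cs Q = 0) (k : ℕ) : Af cs k = Af cs (k % Q) := by
  have : ∀ j r, Af cs (r + j * Q) = Af cs r := by
    intro j; induction j with
    | zero => simp
    | succ j ih => intro r; rw [show r + (j + 1) * Q = (r + j * Q) + Q by ring, Af_add cs Q hQ, ih, h0, add_zero]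
  conv_lhs => rw [← Nat.mod_add_div k Q, mul_comm]
  exact this _ _
end

section
/-- forced evaluation of a number -/
def fnat {α : Type} (a : ℕ) (f : ℕ → α) : α := Nat.rec (f 0) (fun k _ => f (Nat.succ k)) a
def fbool {α : Type} (a : Bool) (f : Bool → α) : α := Bool.rec (f false) (f true) a
theorem fnat_eq {α : Type} (a : ℕ) (f : ℕ → α) : fnat a f = f a := by cases a <;> rfl
theorem fbool_eq {α : Type} (a : Bool) (f : Bool → α) : fbool a f = f a := by cases a <;> rfl
def runF {σ : Type} (fc : σ → (σ → σ) → σ) (step : σ → σ) (j : ℕ) : σ → σ :=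
  Nat.rec step (fun _ r s => fc (r s) r) j
theorem runF_eq {σ : Type} (fc : σ → (σ → σ) → σ) (step : σ → σ) (h : ∀ s f, fc s f = f s) (j : ℕ) (s : σ) :
    runF fc step j s = step^[2 ^ j] s := by
  induction j generalizing s with
  | zero => rfl
  | succ j ih =>
    show fc (runF fc step j s) (runF fc step j) = _
    rw [h, ih, ih, ← Function.iterate_add_apply, pow_succ, mul_two]

def cs27 : List (ℕ × ℤ) := [(1, 15), (2, -15), (3, -15), (5, -15), (6, 15), (7, -15), (10, 15), (11, -15), (12, -15), (14, 15), (18, -15), (21, 15), (24, 15), (28, -15), (30, -15), (33, 15), (35, 15), (36, 15), (40, -15), (42, -30), (44, 15), (45, -15), (55, 25), (56, 5), (60, 15), (63, -10), (66, -5), (70, -30), (72, -15), (77, 15), (84, 45), (88, -15), (90, 30), (99, -30), (105, -15), (110, -15), (120, 10), (126, 15), (132, 5), (140, 30), (165, -25), (168, -35), (180, -35), (198, 50), (210, 75), (220, -25), (231, -30), (252, -20), (264, -25), (280, -20), (308, 30), (315, 25), (330, 35), (360, 30), (385, -31), (396, -29), (420, -90), (440, 35), (462, 20), (495, 35), (504,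 40), (616, -50), (630, -60), (660, 5), (693, 55), (770, 21), (792, 24), (840, 45), (924, -27), (990, -123), (1155, 91), (1260, 48), (1320, -10), (1386, -44), (1540, -45), (1848, 63), (1980, 82), (2310, -101), (2520, -33), (2772, 1), (3080, 50), (3465, -68), (3960, 17), (4620, 77), (5544, -31), (6930, 151), (9240, -13), (13860, 2), (27720, 86)]
def look (g : ℕ) : ℕ := Nat.mod (Nat.shiftRight 4127718221317196862848125523105441487854074544973665029949109141776636773849147975780210067010154016475244697726273310161771315484380610792684434875388503613186507328927825884787684949414635327883934114635895471252779748376403260308729808543686820887269582340573772771022519890055419142715336400536273377547131348988033449097417274163794760659117608735448395130752269039231665663185451367245438830121594260380221416695059280380352527141476944373736744905469781962390389470686610550958127282262647255030955023609275061406788352115069083781730768247942128054567937072441196472950815999707037616610901215674924192871666555301890418176 (Nat.mul 9 (Nat.mod g 233))) 512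

structure S27 where
  k : ℕ
  a : ℕ
  ok : Bool

noncomputable def S27.fc (s : S27) (f : S27 → S27) : S27 := S27.rec (fun k a ok => f ⟨k, a, ok⟩) s
noncomputable def S27.step (s : S27) : S27 :=
  S27.rec (fun k a ok => fnat (Nat.succ k) fun k' => fnat (Nat.add a (look (Nat.gcd k' 27720))) fun a' =>
    fbool (Bool.and ok (Nat.ble a' (Nat.add 315 (Nat.mul 100 k')))) fun ok' => ⟨k', a', ok'⟩) s

theorem S27.step_eq (s : S27) : s.step = ⟨s.k + 1, s.a + look (Nat.gcd (s.k + 1) 27720),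
    s.ok && Nat.ble (s.a + look (Nat.gcd (s.k + 1) 27720)) (315 + 100 * (s.k + 1))⟩ := by
  cases s; simp only [S27.step, fnat_eq, fbool_eq]; rfl

theorem run27 : (runF S27.fc S27.step 15 ⟨0, 300, true⟩).ok = true := by decide +kernel

theorem look27 : ∀ a ∈ [1, 2, 4, 8], ∀ b ∈ [1, 3, 9], ∀ c ∈ [1, 5], ∀ d ∈ [1, 7], ∀ e ∈ [1, 11],
    ((look (a * b * c * d * e) : ℕ) : ℤ) = (cs27.map fun t => if t.1 ∣ a * b * c * d * e then t.2 else 0).sum + 100 := by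
  decide +kernel

theorem look27' (g : ℕ) (hg : g ∣ 27720) : ((look g : ℕ) : ℤ) = (cs27.map fun t => if t.1 ∣ g then t.2 else 0).sum + 100 := by
  have h : g ∣ 8 * 9 * 5 * 7 * 11 := hg
  obtain ⟨y4, e, h4, he, rfl⟩ := (Nat.dvd_mul).1 h
  obtain ⟨y3, d, h3, hd, rfl⟩ := (Nat.dvd_mul).1 h4
  obtain ⟨y2, c, h2, hc, rfl⟩ := (Nat.dvd_mul).1 h3
  obtain ⟨a, b, ha, hb, rfl⟩ := (Nat.dvd_mul).1 h2
  refine look27 a ?_ b ?_ c ?_ d ?_ e ?_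
  · have := Nat.le_of_dvd (by norm_num) ha
    interval_cases a <;> simp <;> revert ha <;> decide
  · have := Nat.le_of_dvd (by norm_num) hb
    interval_cases b <;> simp <;> revert hb <;> decide
  · rcases (Nat.dvd_prime (by norm_num)).1 hc with rfl | rfl <;> simp
  · rcases (Nat.dvd_prime (by norm_num)).1 hd with rfl | rfl <;> simp
  · rcases (Nat.dvd_prime (by norm_num)).1 he with rfl | rfl <;> simp

theorem cs27_dvd : ∀ c ∈ cs27, 1 ≤ c.1 ∧ c.1 ∣ 27720 := by decide +kernel

theorem Af_succ (cs : List (ℕ × ℤ)) (Q : ℕ) (hQ : ∀ c ∈ cs, 1 ≤ c.1 ∧ c.1 ∣ Q) (k : ℕ) :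
    Af cs (k + 1) = Af cs k + (cs.map fun t => if t.1 ∣ Nat.gcd (k + 1) Q then t.2 else 0).sum := by
  induction cs with
  | nil => simp [Af]
  | cons c cs ih =>
    have ih := ih (fun c hc => hQ c (List.mem_cons_of_mem _ hc))
    simp only [Af, List.map_cons, List.sum_cons] at ih ⊢
    rw [ih, Nat.succ_div]
    have h := (hQ c List.mem_cons_self).2
    have : c.1 ∣ Nat.gcd (k + 1) Q ↔ c.1 ∣ k + 1 := ⟨fun h' => h'.trans (Nat.gcd_dvd_left _ _), fun h' => Nat.dvd_gcd h' h⟩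
    simp only [this]
    split_ifs <;> push_cast <;> ring

theorem inv27 (j : ℕ) : (S27.step^[j] ⟨0, 300, true⟩).k = j ∧ ((S27.step^[j] ⟨0, 300, true⟩).a : ℤ) = Af cs27 j + 300 + 100 * j := by
  induction j with
  | zero => simp [Af]
  | succ j ih =>
    rw [Function.iterate_succ_apply', S27.step_eq]
    obtain ⟨h1, h2⟩ := ih
    refine ⟨by simp [h1], ?_⟩
    simp only [h1]
    push_cast
    rw [h2, look27' _ (Nat.gcd_dvd_right _ _), Af_succ cs27 27720 cs27_dvd]
    push_cast; ring

theorem ok27 (j i : ℕ) (h : (S27.step^[j + i] ⟨0, 300, true⟩).ok = true) : (S27.step^[j] ⟨0, 300, true⟩).ok = true := by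
  induction i with
  | zero => exact h
  | succ i ih =>
    apply ih
    rw [← add_assoc, Function.iterate_succ_apply', S27.step_eq] at h
    simp only [Bool.and_eq_true] at h
    exact h.1

theorem Af27 (k : ℕ) : Af cs27 k ≤ (15 : ℕ) := by
  have h0 : Af cs27 27720 = 0 := by decide +kernel
  rw [Af_mod cs27 27720 cs27_dvd h0]
  have hk : k % 27720 < 27720 := Nat.mod_lt _ (by norm_num)
  generalize k % 27720 = j at hk
  cases j with
  | zero => simp [Af]
  | succ j =>
    have h := run27
    rw [runF_eq S27.fc S27.step (fun s f => rfl)] at h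
    have e : 2 ^ 15 = (j + 1) + (32767 - j) := by omega
    rw [e] at h
    have h2 := ok27 _ _ h
    have h3 := inv27 (j + 1)
    have h4 := inv27 j
    rw [Function.iterate_succ_apply', S27.step_eq] at h2 h3
    simp only [Bool.and_eq_true, Nat.ble_eq] at h2 h3
    have h5 := h2.2
    zify at h5
    rw [h4.1] at h3 h5
    push_cast at h3 h5
    rw [h3.2] at h5
    push_cast at h5 ⊢
    linarith
end

section
def ve (p d : ℕ) : ℕ := (if p ∣ d then 1 else 0) + (if p ^ 2 ∣ d then 1 else 0) + (if p ^ 3 ∣ d then 1 else 0)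
def al (p : ℕ) (cs : List (ℕ × ℤ)) : ℚ := (cs.map fun c => -((c.2 * (ve p c.1 : ℤ) : ℤ) : ℚ) / c.1).sum

theorem Ic_al (cs : List (ℕ × ℤ)) (h : ∀ c ∈ cs, c.1 = 2 ^ ve 2 c.1 * 3 ^ ve 3 c.1 * 5 ^ ve 5 c.1 * 7 ^ ve 7 c.1 * 11 ^ ve 11 c.1) :
    Ic cs = al 2 cs * Real.log 2 + al 3 cs * Real.log 3 + al 5 cs * Real.log 5 + al 7 cs * Real.log 7 + al 11 cs * Real.log 11 := by
  induction cs with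
  | nil => simp [Ic, al]
  | cons c cs ih =>
    have ih := ih (fun c hc => h c (List.mem_cons_of_mem _ hc))
    have h1 := h c List.mem_cons_self
    simp only [Ic, al, List.map_cons, List.sum_cons] at ih ⊢
    rw [ih]
    have e : Real.log c.1 = ve 2 c.1 * Real.log 2 + ve 3 c.1 * Real.log 3 + ve 5 c.1 * Real.log 5 + ve 7 c.1 * Real.log 7 + ve 11 c.1 * Real.log 11 := by
      conv_lhs => rw [h1]
      push_cast
      rw [Real.log_mul (by positivity) (by positivity), Real.log_mul (by positivity) (by positivity),
        Real.log_mul (by positivity) (by positivity), Real.log_mul (by positivity) (by positivity)]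
      simp only [Real.log_pow]
    rw [e]
    push_cast
    ring

theorem log7_lo : 1.9458 ≤ Real.log 7 := by
  have h : Real.log 2400 ≤ Real.log (7 ^ 4) := Real.log_le_log (by norm_num) (by norm_num)
  rw [show (2400:ℝ) = 2 ^ 5 * 3 * 5 ^ 2 by norm_num, Real.log_mul (by norm_num) (by norm_num), Real.log_mul (by norm_num) (by norm_num)] at h
  simp only [Real.log_pow] at h
  push_cast at h
  have := Real.log_two_gt_d9; have := Real.log_three_gt_d9; have := Real.log_five_gt_d9
  norm_num at *
  linarith
theorem log7_hi : Real.log 7 ≤ 1.9461 := by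
  have h : Real.log (7 ^ 4 / 2400) ≤ 7 ^ 4 / 2400 - 1 := Real.log_le_sub_one_of_pos (by norm_num)
  rw [Real.log_div (by norm_num) (by norm_num), show (2400:ℝ) = 2 ^ 5 * 3 * 5 ^ 2 by norm_num, Real.log_mul (by norm_num) (by norm_num), Real.log_mul (by norm_num) (by norm_num)] at h
  simp only [Real.log_pow] at h
  push_cast at h
  have := Real.log_two_lt_d9; have := Real.log_three_lt_d9; have := Real.log_five_lt_d9
  norm_num at *
  linarith
theorem log11_lo : 2.3977 ≤ Real.log 11 := by
  have h : Real.log 9800 ≤ Real.log (3 ^ 4 * 11 ^ 2) := Real.log_le_log (by norm_num) (by norm_num)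
  rw [show (9800:ℝ) = 2 ^ 3 * 5 ^ 2 * 7 ^ 2 by norm_num, Real.log_mul (by norm_num) (by norm_num), Real.log_mul (by norm_num) (by norm_num), Real.log_mul (by norm_num) (by norm_num)] at h
  simp only [Real.log_pow] at h
  push_cast at h
  have := Real.log_two_gt_d9; have := Real.log_three_lt_d9; have := Real.log_five_gt_d9; have := log7_lo
  norm_num at *
  linarith

theorem Lc_nonneg (cs : List (ℕ × ℤ)) : 0 ≤ Lc cs := by
  refine List.sum_nonneg ?_
  intro a ha
  obtain ⟨c, _, rfl⟩ := List.mem_map.1 ha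
  exact mul_nonneg (abs_nonneg _) (Real.log_natCast_nonneg _)

theorem psi27 {t : ℝ} (ht : 27720 ≤ t) : 0.9519 * t - 190 * Real.log t ≤ Chebyshev.psi t := by
  have h := cheb_lower cs27 15 Af27 (by decide +kernel) (x := t) (by linarith) (fun c hc => by
    refine ⟨(cs27_dvd c hc).1, le_trans ?_ ht⟩
    exact_mod_cast Nat.le_of_dvd (by norm_num) (cs27_dvd c hc).2)
  rw [Ic_al cs27 (by decide +kernel)] at h
  have a2 : al 2 cs27 = 74321/13860 := by decide +kernel
  have a3 : al 3 cs27 = 6631/1540 := by decide +kernel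
  have a5 : al 5 cs27 = 4787/2772 := by decide +kernel
  have a7 : al 7 cs27 = 3419/3960 := by decide +kernel
  have a11 : al 11 cs27 = 481/840 := by decide +kernel
  have hK : Kc cs27 = 2838 := by decide +kernel
  have hC : -100 ≤ Cc cs27 := by decide +kernel
  rw [a2, a3, a5, a7, a11, hK] at h
  have hC' : (-100 : ℝ) ≤ Cc cs27 := by exact_mod_cast hC
  have hL := Lc_nonneg cs27
  have hlog : 10 ≤ Real.log t := by
    rw [Real.le_log_iff_exp_le (by linarith)]
    have : Real.exp 10 = Real.exp 1 ^ 10 := by rw [← Real.exp_nat_mul]; norm_num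
    rw [this]
    have h1 := Real.exp_one_lt_d9
    calc Real.exp 1 ^ 10 ≤ 2.7183 ^ 10 := pow_le_pow_left₀ (Real.exp_pos _).le (by linarith) _
      _ ≤ _ := by norm_num at *; linarith
  have := Real.log_two_gt_d9; have := Real.log_three_gt_d9; have := Real.log_five_gt_d9; have := log7_lo; have := log11_lo
  have hI : (14.2785:ℝ) ≤ (((74321/13860 : ℚ) : ℝ) * Real.log 2 + ((6631/1540 : ℚ) : ℝ) * Real.log 3 + ((4787/2772 : ℚ) : ℝ) * Real.log 5 + ((3419/3960 : ℚ) : ℝ) * Real.log 7 + ((481/840 : ℚ) : ℝ) * Real.log 11) := by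
    push_cast
    norm_num at *
    linarith
  have := mul_le_mul_of_nonneg_right hI (show 0 ≤ t by linarith)
  push_cast at h this
  linarith

def cs30 : List (ℕ × ℤ) := [(1, 1), (2, -1), (3, -1), (5, -1), (30, 1)]
theorem psi30 {t : ℝ} (ht : 30 ≤ t) : 0.9212 * t - 5 * Real.log t + 5.8 ≤ Chebyshev.psi t := by
  have hd : ∀ c ∈ cs30, 1 ≤ c.1 ∧ c.1 ∣ 30 := by decide +kernel
  have h := cheb_lower cs30 1 (fun k => by
      rw [Af_mod cs30 30 hd (by decide +kernel)]
      have : ∀ j < 30, Af cs30 j ≤ (1 : ℕ) := by decide +kernel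
      exact this _ (Nat.mod_lt _ (by norm_num))) (by decide +kernel) (x := t) (by linarith) (fun c hc => by
    refine ⟨(hd c hc).1, le_trans ?_ ht⟩
    exact_mod_cast Nat.le_of_dvd (by norm_num) (hd c hc).2)
  have hL : Lc cs30 = Real.log 2 + Real.log 3 + Real.log 5 + Real.log 30 := by
    simp [Lc, cs30]; ring
  have l30 : Real.log 30 = Real.log 2 + Real.log 3 + Real.log 5 := by
    rw [← Real.log_mul (by norm_num) (by norm_num), ← Real.log_mul (by norm_num) (by norm_num)]; norm_num
  have hI : Ic cs30 = Real.log 2 / 2 + Real.log 3 / 3 + Real.log 5 / 5 - Real.log 30 / 30 := by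
    simp [Ic, cs30]; ring
  have hK : Kc cs30 = 5 := by decide +kernel
  have hC : Cc cs30 = -1 := by decide +kernel
  have := Real.log_two_gt_d9; have := Real.log_three_gt_d9; have := Real.log_five_gt_d9
  have hI2 : 0.9212 ≤ Ic cs30 := by rw [hI, l30]; norm_num at *; linarith
  have := mul_le_mul_of_nonneg_right hI2 (show 0 ≤ t by linarith)
  rw [hL, hK, hC, l30] at h
  push_cast at h
  norm_num at *
  linarith

def cs210 : List (ℕ × ℤ) := [(1,1),(2,-1),(3,-1),(5,-1),(7,-1),(10,1),(14,1),(30,1),(42,-1),(210,-1)]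
theorem psi210 {t : ℝ} (ht : 210 ≤ t) : Chebyshev.psi t - Chebyshev.psi (t / 6) ≤ 0.895 * t + 10 * Real.log t := by
  have hd : ∀ c ∈ cs210, 1 ≤ c.1 ∧ c.1 ∣ 210 := by decide +kernel
  have hmod : ∀ k, Af cs210 k = Af cs210 (k % 210) := Af_mod cs210 210 hd (by decide +kernel)
  have h := cheb_upper cs210 (fun k => by
      rw [hmod]
      have : ∀ j < 210, 0 ≤ Af cs210 j := by decide +kernel
      exact this _ (Nat.mod_lt _ (by norm_num)))
      (fun k h1 h6 => by
        have : ∀ j < 6, 1 ≤ j → 1 ≤ Af cs210 j := by decide +kernel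
        exact this k h6 h1) (by decide +kernel) (x := t) (by linarith) (fun c hc => by
    refine ⟨(hd c hc).1, le_trans ?_ ht⟩
    exact_mod_cast Nat.le_of_dvd (by norm_num) (hd c hc).2)
  rw [Ic_al cs210 (by decide +kernel)] at h
  have hK : Kc cs210 = 10 := by decide +kernel
  have hC : Cc cs210 = -2 := by decide +kernel
  have a2 : al 2 cs210 = 34/105 := by decide +kernel
  have a3 : al 3 cs210 = 23/70 := by decide +kernel
  have a5 : al 5 cs210 = 1/14 := by decide +kernel
  have a7 : al 7 cs210 = 1/10 := by decide +kernel
  have a11 : al 11 cs210 = 0 := by decide +kernel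
  rw [a2, a3, a5, a7, a11, hK, hC] at h
  have hL := Lc_nonneg cs210
  have := Real.log_two_lt_d9; have := Real.log_three_lt_d9; have := Real.log_five_lt_d9; have := log7_hi
  have hI : (((34/105 : ℚ) : ℝ) * Real.log 2 + ((23/70 : ℚ) : ℝ) * Real.log 3 + ((1/14 : ℚ) : ℝ) * Real.log 5 + ((1/10 : ℚ) : ℝ) * Real.log 7 + ((0 : ℚ) : ℝ) * Real.log 11) ≤ 0.895 := by
    push_cast
    norm_num at *
    linarith
  have := mul_le_mul_of_nonneg_right hI (show 0 ≤ t by linarith)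
  push_cast at h this
  linarith

theorem lcm210 : ∀ n < 216, Nat.lcmUpto n * 10 ^ n ≤ 29 ^ n := by decide +kernel

theorem psi_up {t : ℝ} (ht : 1 ≤ t) : Chebyshev.psi t ≤ 1.074 * t + 4 * Real.log t ^ 2 := by
  have base : ∀ t : ℝ, 1 ≤ t → t < 210 → Chebyshev.psi t ≤ 1.074 * t + 4 * Real.log t ^ 2 := by
    intro t ht h2
    have hfl := Nat.floor_le (show 0 ≤ t by linarith)
    have h1 : Chebyshev.psi t = Real.log (Nat.lcmUpto ⌊t⌋₊) := by
      rw [← Chebyshev.psi_eq_log_lcmUpto, psi_Ioc, psi_Ioc, Nat.floor_natCast]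
    have hl := lcm210 ⌊t⌋₊ (by
      rw [Nat.floor_lt (by linarith)]; push_cast; linarith)
    have h3 : (Nat.lcmUpto ⌊t⌋₊ : ℝ) ≤ 2.9 ^ ⌊t⌋₊ := by
      have : (Nat.lcmUpto ⌊t⌋₊ : ℝ) * 10 ^ ⌊t⌋₊ ≤ 29 ^ ⌊t⌋₊ := by exact_mod_cast hl
      rw [show (2.9:ℝ) = 29 / 10 by norm_num, div_pow, le_div_iff₀ (by positivity)]; exact this
    have h4 : Real.log 2.9 ≤ 1.074 := by
      have h : Real.log (2.9 / 3) ≤ 2.9 / 3 - 1 := Real.log_le_sub_one_of_pos (by norm_num)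
      rw [Real.log_div (by norm_num) (by norm_num)] at h
      have := Real.log_three_lt_d9
      norm_num at *; linarith
    rw [h1]
    have h5 : Real.log (Nat.lcmUpto ⌊t⌋₊) ≤ ⌊t⌋₊ * Real.log 2.9 := by
      rw [← Real.log_pow]
      exact Real.log_le_log (by exact_mod_cast Nat.lcmUpto_pos _) h3
    have := mul_le_mul_of_nonneg_left h4 (show (0:ℝ) ≤ ⌊t⌋₊ by positivity)
    nlinarith [sq_nonneg (Real.log t)]
  have main : ∀ n : ℕ, ∀ t : ℝ, 1 ≤ t → t < 210 * 6 ^ n → Chebyshev.psi t ≤ 1.074 * t + 4 * Real.log t ^ 2 := by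
    intro n
    induction n with
    | zero => intro t h1 h2; exact base t h1 (by simpa using h2)
    | succ n ih =>
      intro t h1 h2
      rcases lt_or_ge t 210 with h | h
      · exact base t h1 h
      have a1 := ih (t / 6) (by linarith) (by rw [pow_succ] at h2; linarith)
      have a2 := psi210 h
      rw [Real.log_div (by linarith) (by norm_num)] at a1
      have l6 : Real.log 6 = Real.log 2 + Real.log 3 := by rw [← Real.log_mul (by norm_num) (by norm_num)]; norm_num
      have := Real.log_two_lt_d9; have := Real.log_three_lt_d9; have := Real.log_two_gt_d9; have := Real.log_three_gt_d9
      have b1 : 1.79 ≤ Real.log 6 := by norm_num at *; linarith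
      have b2 : Real.log 6 ≤ 1.8 := by norm_num at *; linarith
      have b3 : 2 * Real.log 6 ≤ Real.log t := by
        rw [show 2 * Real.log 6 = Real.log (6 ^ 2) by rw [Real.log_pow]; push_cast; ring]
        exact Real.log_le_log (by norm_num) (by linarith)
      nlinarith [mul_nonneg (sub_nonneg.2 b1) (show 0 ≤ Real.log t - 2 * Real.log 6 by linarith)]
  obtain ⟨n, hn⟩ := pow_unbounded_of_one_lt t (show (1:ℝ) < 6 by norm_num)
  exact main n t ht (by nlinarith [show (0:ℝ) < 6 ^ n by positivity])
end

section
theorem sum_mult (a k : ℕ) (hk : 1 ≤ k) (f : ℕ → ℚ) :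
    ∑ n ∈ (Finset.Icc 1 (a * k - 1)).filter (fun n => k ∣ n), f n = ∑ j ∈ Finset.Icc 1 (a - 1), f (k * j) := by
  symm
  refine Finset.sum_nbij (fun j => k * j) ?_ ?_ ?_ ?_
  · intro j hj
    simp only [Finset.mem_filter, Finset.mem_Icc] at hj ⊢
    have : k * j < a * k := by rw [mul_comm a k]; exact Nat.mul_lt_mul_of_pos_left (by omega) (by omega)
    have h1 : 1 ≤ k * j := Nat.mul_pos (by omega) (by omega)
    exact ⟨⟨h1, by omega⟩, Dvd.intro _ rfl⟩
  · intro i _ j _ h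
    exact Nat.eq_of_mul_eq_mul_left (by omega) h
  · intro n hn
    simp only [Finset.coe_filter, Finset.mem_Icc, Set.mem_ofPred_eq] at hn
    obtain ⟨⟨h1, h2⟩, j, rfl⟩ := hn
    refine ⟨j, ?_, rfl⟩
    have j0 : 0 < j := Nat.pos_of_ne_zero (by rintro rfl; simp at h1)
    have : k * j < k * a := by rw [mul_comm k a]; omega
    have := Nat.lt_of_mul_lt_mul_left this
    simp only [Finset.coe_Icc, Set.mem_Icc]; omega
  · intro j _; rfl

theorem nonU_mul {N k : ℕ} (hk : 1 ≤ k) (hN : 1 ≤ N) (h : ¬ memU N) : ¬ memU (N * k) := by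
  intro hU
  apply h
  refine ⟨hN, fun w hw hs => ?_⟩
  refine hU.2 (fun n => if k ∣ n then w (n / k) else 0) (fun n => ?_) ?_
  · split_ifs
    · exact hw _
    · simp
  · have : ∀ n ∈ Finset.Icc 1 (N * k - 1), (((if k ∣ n then w (n / k) else 0 : ℤ)) : ℚ) / n = if k ∣ n then (w (n / k) : ℚ) / n else 0 := by
      intro n _; split_ifs <;> simp
    rw [Finset.sum_congr rfl this, ← Finset.sum_filter, sum_mult N k hk]
    have k0 : (k:ℚ) ≠ 0 := by positivity
    calc ∑ j ∈ Finset.Icc 1 (N - 1), (w (k * j / k) : ℚ) / ((k * j : ℕ) : ℚ) = ∑ j ∈ Finset.Icc 1 (N - 1), ((w j : ℚ) / j) * (1 / k) := by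
          refine Finset.sum_congr rfl fun j _ => ?_
          rw [Nat.mul_div_cancel_left _ hk]; push_cast; rw [div_mul_div_comm, mul_one, mul_comm (k:ℚ)]
      _ = 1 / ((N * k : ℕ) : ℚ) := by
          rw [← Finset.sum_mul, hs]; push_cast; rw [div_mul_div_comm, one_mul]

theorem critU (m p L : ℕ) (hm : 1 ≤ m) (hp : p.Prime) (hL0 : L ≠ 0) (hL : ∀ k ∈ Finset.Icc 1 m, k ∣ L)
    (h : ∀ w : ℕ → ℤ, (∀ n, w n = -1 ∨ w n = 0 ∨ w n = 1) →
      ¬ (p : ℤ) ∣ ∑ k ∈ Finset.Icc 1 (m - 1), w k * ((L / k : ℕ) : ℤ) - ((L / m : ℕ) : ℤ)) : memU (m * p) := by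
  refine ⟨Nat.mul_pos hm hp.pos, fun w hw hs => ?_⟩
  apply h (fun k => w (p * k)) (fun k => hw _)
  set s := (Finset.Icc 1 (m * p - 1)).filter (fun n => ¬ p ∣ n) with hs'
  set N : ℕ := ∏ n ∈ s, n with hN
  have hN0 : N ≠ 0 := by
    rw [hN, Finset.prod_ne_zero_iff]; intro n hn; simp [hs'] at hn; omega
  have hpN : ¬ p ∣ N := by
    rw [hN, hp.prime.dvd_finsetProd_iff]; rintro ⟨n, hn, h2⟩; simp [hs'] at hn; exact hn.2 h2
  have hdiv : ∀ (l k : ℕ), k ∣ l → k ≠ 0 → ((l / k : ℕ) : ℚ) = (l : ℚ) / k := by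
    intro l k h hk; exact Nat.cast_div h (by exact_mod_cast hk)
  have e1 : ∑ n ∈ s, (w n : ℚ) / n = ((∑ n ∈ s, w n * ((N / n : ℕ) : ℤ) : ℤ) : ℚ) / N := by
    rw [Int.cast_sum, Finset.sum_div]
    refine Finset.sum_congr rfl fun n hn => ?_
    have n0 : n ≠ 0 := by simp [hs'] at hn; omega
    rw [Int.cast_mul, Int.cast_natCast, hdiv N n (Finset.dvd_prod_of_mem _ hn) n0]
    have : (N:ℚ) ≠ 0 := by exact_mod_cast hN0
    have : (n:ℚ) ≠ 0 := by exact_mod_cast n0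
    field_simp
  have e2 : ∑ n ∈ (Finset.Icc 1 (m * p - 1)).filter (fun n => p ∣ n), (w n : ℚ) / n
      = ((∑ k ∈ Finset.Icc 1 (m - 1), w (p * k) * ((L / k : ℕ) : ℤ) : ℤ) : ℚ) / (p * L) := by
    rw [sum_mult m p hp.one_lt.le, Int.cast_sum, Finset.sum_div]
    refine Finset.sum_congr rfl fun n hn => ?_
    rw [Finset.mem_Icc] at hn
    have n0 : n ≠ 0 := by omega
    rw [Int.cast_mul, Int.cast_natCast, hdiv L n (hL n (by rw [Finset.mem_Icc]; omega)) n0]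
    have : (L:ℚ) ≠ 0 := by exact_mod_cast hL0
    have : (n:ℚ) ≠ 0 := by exact_mod_cast n0
    have : (p:ℚ) ≠ 0 := by exact_mod_cast hp.ne_zero
    push_cast
    field_simp
  rw [← Finset.sum_filter_add_sum_filter_not _ (fun n => p ∣ n), e2, e1] at hs
  set A := ∑ n ∈ s, w n * ((N / n : ℕ) : ℤ)
  set B := ∑ k ∈ Finset.Icc 1 (m - 1), w (p * k) * ((L / k : ℕ) : ℤ)
  have hm0 : (m:ℚ) ≠ 0 := by positivity
  have hLm : (1:ℚ) / ((m * p : ℕ) : ℚ) = ((L / m : ℕ) : ℚ) / (p * L) := by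
    rw [hdiv L m (hL m (by rw [Finset.mem_Icc]; omega)) (by omega)]
    have : (L:ℚ) ≠ 0 := by exact_mod_cast hL0
    have : (p:ℚ) ≠ 0 := by exact_mod_cast hp.ne_zero
    push_cast
    field_simp
  rw [hLm] at hs
  have key : (A : ℚ) * (p * L) + N * (B - ((L / m : ℕ) : ℚ)) = 0 := by
    have : (L:ℚ) ≠ 0 := by exact_mod_cast hL0
    have : (p:ℚ) ≠ 0 := by exact_mod_cast hp.ne_zero
    have : (N:ℚ) ≠ 0 := by exact_mod_cast hN0
    field_simp at hs
    linear_combination hs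
  have key2 : A * (p * L) + N * (B - ((L / m : ℕ) : ℤ)) = 0 := by
    have : ((A * (p * L) + N * (B - ((L / m : ℕ) : ℤ)) : ℤ) : ℚ) = 0 := by
      rw [← key]
      rw [Int.cast_add, Int.cast_mul, Int.cast_mul, Int.cast_mul, Int.cast_sub, Int.cast_natCast, Int.cast_natCast, Int.cast_natCast, Int.cast_natCast]
    exact_mod_cast this
  have hd : (p : ℤ) ∣ N * (B - ((L / m : ℕ) : ℤ)) := ⟨-(A * L), by linear_combination key2⟩
  rcases (Nat.prime_iff_prime_int.1 hp).dvd_or_dvd hd with h1 | h1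
  · exact absurd (by exact_mod_cast h1) hpN
  · exact h1

def gm (m : ℕ) : ℕ := ∑ k ∈ Finset.Icc 1 m, Nat.lcmUpto m / k

theorem dvd_lcmUpto {m k : ℕ} (h : k ∈ Finset.Icc 1 m) : k ∣ Nat.lcmUpto m := Finset.dvd_lcm (f := id) h

theorem le_gm (m : ℕ) : m ≤ gm m := by
  rw [gm]
  calc m = ∑ k ∈ Finset.Icc 1 m, 1 := by simp
    _ ≤ _ := by
      refine Finset.sum_le_sum fun k hk => ?_
      have := Nat.le_of_dvd (Nat.lcmUpto_pos m) (dvd_lcmUpto hk)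
      rw [Finset.mem_Icc] at hk
      exact (Nat.one_le_div_iff (by omega)).2 this

theorem memU_mul {m p : ℕ} (hm : memU m) (hp : p.Prime) (h : gm m < p) : memU (m * p) := by
  refine critU m p (Nat.lcmUpto m) hm.1 hp (Nat.lcmUpto_ne_zero m) (fun k hk => dvd_lcmUpto hk) ?_
  intro w hw hd
  have hm1 := hm.1
  have hL0 := Nat.lcmUpto_ne_zero m
  have hdiv : ∀ k ∈ Finset.Icc 1 m, ((Nat.lcmUpto m / k : ℕ) : ℚ) = (Nat.lcmUpto m : ℚ) / k := by
    intro k hk; rw [Finset.mem_Icc] at hk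
    exact Nat.cast_div (dvd_lcmUpto (Finset.mem_Icc.2 hk)) (by have := hk.1; positivity)
  have h0 : ∑ k ∈ Finset.Icc 1 (m - 1), w k * ((Nat.lcmUpto m / k : ℕ) : ℤ) - ((Nat.lcmUpto m / m : ℕ) : ℤ) = 0 := by
    refine Int.eq_zero_of_abs_lt_dvd hd ?_
    have a1 : |∑ k ∈ Finset.Icc 1 (m - 1), w k * ((Nat.lcmUpto m / k : ℕ) : ℤ)| ≤ ∑ k ∈ Finset.Icc 1 (m - 1), ((Nat.lcmUpto m / k : ℕ) : ℤ) := by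
      refine (Finset.abs_sum_le_sum_abs _ _).trans (Finset.sum_le_sum fun k _ => ?_)
      rw [abs_mul, Nat.abs_cast]
      rcases hw k with h | h | h <;> rw [h]
      · simp
      · rw [abs_zero, zero_mul]; exact Int.natCast_nonneg _
      · simp
    have a2 : ∑ k ∈ Finset.Icc 1 (m - 1), ((Nat.lcmUpto m / k : ℕ) : ℤ) + ((Nat.lcmUpto m / m : ℕ) : ℤ) = (gm m : ℤ) := by
      rw [gm, Nat.cast_sum]
      obtain ⟨j, rfl⟩ : ∃ j, m = j + 1 := ⟨m - 1, by omega⟩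
      rw [Finset.sum_Icc_succ_top (by omega)]; rfl
    have a3 : (gm m : ℤ) < p := by exact_mod_cast h
    refine (abs_sub _ _).trans_lt ?_
    rw [Nat.abs_cast]; linarith
  refine hm.2 w hw ?_
  have h1 : (Nat.lcmUpto m : ℚ) * ∑ n ∈ Finset.Icc 1 (m - 1), (w n : ℚ) / n = (Nat.lcmUpto m : ℚ) * (1 / m) := by
    rw [Finset.mul_sum]
    have e : ((∑ k ∈ Finset.Icc 1 (m - 1), w k * ((Nat.lcmUpto m / k : ℕ) : ℤ) : ℤ) : ℚ) = (((Nat.lcmUpto m / m : ℕ) : ℤ) : ℚ) := by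
      congr 1; linarith
    rw [Int.cast_sum, Int.cast_natCast, hdiv m (Finset.mem_Icc.2 ⟨hm1, le_rfl⟩)] at e
    rw [mul_one_div, ← e]
    refine Finset.sum_congr rfl fun k hk => ?_
    rw [Finset.mem_Icc] at hk
    rw [Int.cast_mul, Int.cast_natCast, hdiv k (Finset.mem_Icc.2 (by omega))]; ring
  exact mul_left_cancel₀ (by exact_mod_cast hL0) h1

theorem count_lower (x : ℝ) (hx : 0 ≤ x) (M : ℕ) :
    ∑ m ∈ (Finset.Icc 1 M).filter (fun m => memU m), ((Nat.primeCounting ⌊x / m⌋₊ : ℝ) - gm m) ≤ countU x := by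
  set V := (Finset.Icc 1 M).filter (fun m => memU m) with hV
  let P : ℕ → Finset ℕ := fun m => (Finset.Ioc (gm m) ⌊x / m⌋₊).filter Nat.Prime
  have hcard : ∀ m : ℕ, (Nat.primeCounting ⌊x / m⌋₊ : ℝ) - gm m ≤ (P m).card := by
    intro m
    have h1 : Nat.primeCounting ⌊x / m⌋₊ = ((Finset.range (⌊x / m⌋₊ + 1)).filter Nat.Prime).card := by
      rw [Nat.primeCounting, Nat.primeCounting', Nat.count_eq_card_filter_range]
    have h2 : (Finset.range (⌊x / m⌋₊ + 1)).filter Nat.Prime ⊆ P m ∪ Finset.Icc 1 (gm m) := by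
      intro p hp
      simp only [P, Finset.mem_filter, Finset.mem_range, Finset.mem_union, Finset.mem_Ioc, Finset.mem_Icc] at hp ⊢
      have := hp.2.one_lt
      by_cases h : gm m < p
      · left; exact ⟨⟨h, by omega⟩, hp.2⟩
      · right; omega
    have h3 := (Finset.card_le_card h2).trans (Finset.card_union_le _ _)
    rw [← h1, Nat.card_Icc] at h3
    have : Nat.primeCounting ⌊x / m⌋₊ ≤ (P m).card + gm m := by omega
    have : (Nat.primeCounting ⌊x / m⌋₊ : ℝ) ≤ (P m).card + gm m := by exact_mod_cast this
    linarith
  have hle : ((V.sigma P).card : ℝ) ≤ countU x := by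
    have : (V.sigma P).card ≤ countU x := by
      rw [countU]
      refine Finset.card_le_card_of_injOn (fun q => q.1 * q.2) ?_ ?_
      · rintro ⟨m, p⟩ hq
        simp only [hV, P, Finset.coe_sigma, Set.mem_sigma_iff, Finset.coe_filter, Finset.mem_Icc, Finset.mem_Ioc, Set.mem_ofPred_eq] at hq ⊢
        obtain ⟨⟨⟨h1, h2⟩, hm⟩, ⟨h3, h4⟩, hp⟩ := hq
        refine ⟨⟨Nat.mul_pos h1 hp.pos, ?_⟩, memU_mul hm hp h3⟩
        rw [Nat.floor_div_natCast] at h4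
        rw [mul_comm]
        exact (Nat.le_div_iff_mul_le h1).1 h4
      · rintro ⟨m, p⟩ hq ⟨m', p'⟩ hq' he
        simp only [hV, P, Finset.coe_sigma, Set.mem_sigma_iff, Finset.coe_filter, Finset.mem_Icc, Finset.mem_Ioc, Set.mem_ofPred_eq] at hq hq' he
        obtain ⟨⟨⟨h1, h2⟩, hm⟩, ⟨h3, h4⟩, hp⟩ := hq
        obtain ⟨⟨⟨h1', h2'⟩, hm'⟩, ⟨h3', h4'⟩, hp'⟩ := hq'
        have g1 := le_gm m
        have g2 := le_gm m'
        have : p = p' := by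
          by_contra hne
          have d1 : p ∣ m' * p' := he ▸ Dvd.intro_left _ rfl
          have d2 : p' ∣ m * p := he ▸ Dvd.intro_left _ rfl
          have c1 : p ∣ m' := (hp.dvd_mul.1 d1).resolve_right (fun h => hne ((Nat.prime_dvd_prime_iff_eq hp hp').1 h))
          have c2 : p' ∣ m := (hp'.dvd_mul.1 d2).resolve_right (fun h => hne ((Nat.prime_dvd_prime_iff_eq hp' hp).1 h).symm)
          have := Nat.le_of_dvd h1' c1
          have := Nat.le_of_dvd h1 c2
          omega
        subst this
        have := Nat.eq_of_mul_eq_mul_right hp.pos he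
        subst this; rfl
    exact_mod_cast this
  refine le_trans ?_ hle
  rw [Finset.card_sigma, Nat.cast_sum]
  exact Finset.sum_le_sum fun m _ => hcard m

theorem int_inv_sq {a b : ℝ} (ha : 0 < a) (hab : a ≤ b) : ∫ v in a..b, 1 / v ^ 2 = 1 / a - 1 / b := by
  have h : ∀ v ∈ Set.uIcc a b, HasDerivAt (fun v : ℝ => -(1 / v)) (1 / v ^ 2) v := by
    intro v hv
    rw [Set.uIcc_of_le hab] at hv
    have v0 : v ≠ 0 := by linarith [hv.1]
    have := ((hasDerivAt_inv v0).neg)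
    simp only [one_div]
    rw [neg_neg] at this
    exact this
  rw [intervalIntegral.integral_eq_sub_of_hasDerivAt h]
  · ring
  · refine ContinuousOn.intervalIntegrable ?_
    rw [Set.uIcc_of_le hab]
    intro v hv
    have v0 : v ≠ 0 := by linarith [hv.1]
    exact ContinuousAt.continuousWithinAt (by fun_prop (disch := positivity))

theorem integral_le (Y : ℝ) (hY : 1 ≤ Y) :
    ∫ v in (1 : ℝ)..Y, (countU v : ℝ) / v ^ 2 ≤
      ∑ m ∈ (Finset.Icc 1 ⌊Y⌋₊).filter (fun m => memU m), (1 / (m : ℝ) - 1 / Y) := by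
  set V := (Finset.Icc 1 ⌊Y⌋₊).filter (fun m => memU m) with hV
  have hint : ∀ a : ℝ, 0 < a → MeasureTheory.IntegrableOn (fun v : ℝ => 1 / v ^ 2) (Set.Icc a Y) := by
    intro a ha
    refine ContinuousOn.integrableOn_Icc ?_
    intro v hv
    have v0 : v ≠ 0 := by linarith [hv.1]
    exact ContinuousAt.continuousWithinAt (by fun_prop (disch := positivity))
  have h1 : ∀ v ∈ Set.Ioc 1 Y, (countU v : ℝ) / v ^ 2 = ∑ m ∈ V, (Set.Ici (m : ℝ)).indicator (fun v : ℝ => 1 / v ^ 2) v := by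
    intro v hv
    have e : (Finset.Icc 1 ⌊v⌋₊).filter (fun m => memU m) = V.filter (fun m : ℕ => (m : ℝ) ≤ v) := by
      ext m
      simp only [hV, Finset.mem_filter, Finset.mem_Icc]
      have : m ≤ ⌊v⌋₊ ↔ (m : ℝ) ≤ v := Nat.le_floor_iff (by linarith [hv.1])
      rw [this]
      constructor
      · rintro ⟨⟨a, b⟩, c⟩; exact ⟨⟨⟨a, Nat.le_floor (b.trans hv.2)⟩, c⟩, b⟩
      · rintro ⟨⟨⟨a, b⟩, c⟩, d⟩; exact ⟨⟨a, d⟩, c⟩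
    rw [countU, e, Finset.card_filter, Nat.cast_sum, Finset.sum_div]
    refine Finset.sum_congr rfl fun m _ => ?_
    by_cases h : (m : ℝ) ≤ v
    · simp [h]
    · simp [h]
  rw [intervalIntegral.integral_of_le hY, MeasureTheory.setIntegral_congr_fun measurableSet_Ioc h1, MeasureTheory.integral_finsetSum]
  · refine Finset.sum_le_sum fun m hm => ?_
    simp only [hV, Finset.mem_filter, Finset.mem_Icc] at hm
    have m1 : (1:ℝ) ≤ m := by exact_mod_cast hm.1.1
    have mY : (m:ℝ) ≤ Y := (Nat.le_floor_iff (by linarith)).1 hm.1.2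
    rw [MeasureTheory.setIntegral_indicator measurableSet_Ici]
    calc ∫ v in Set.Ioc 1 Y ∩ Set.Ici (m:ℝ), 1 / v ^ 2 ≤ ∫ v in Set.Icc (m:ℝ) Y, 1 / v ^ 2 := by
          refine MeasureTheory.setIntegral_mono_set (hint _ (by linarith)) (Filter.Eventually.of_forall fun v => by positivity) ?_
          refine Filter.Eventually.of_forall ?_
          rintro v ⟨⟨_, a⟩, b⟩; exact ⟨b, a⟩
      _ = 1 / (m : ℝ) - 1 / Y := by
          rw [MeasureTheory.integral_Icc_eq_integral_Ioc, ← intervalIntegral.integral_of_le mY, int_inv_sq (by linarith) mY]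
  · intro m _
    refine MeasureTheory.Integrable.indicator ?_ measurableSet_Ici
    exact (hint 1 one_pos).mono_set Set.Ioc_subset_Icc_self
end

section
noncomputable def Uf (n : ℕ) : Finset ℕ := (Finset.Icc 1 n).filter (fun m => memU m)

theorem countU_mono {x y : ℝ} (h : x ≤ y) : countU x ≤ countU y :=
  Finset.card_le_card (Finset.filter_subset_filter _ (Finset.Icc_subset_Icc le_rfl (Nat.floor_le_floor h)))

theorem master (x Y : ℝ) (hY : 1 ≤ Y) (hx : 1 < x) (M : ℕ) (ε E : ℝ)
    (hpsi : ∀ m ∈ Finset.Icc 1 M, (1 - ε) * x / m - E ≤ Chebyshev.psi (x / m))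
    (h : x * ∑ m ∈ Uf ⌊Y⌋₊, (1 / (m : ℝ) - 1 / Y) ≤ ∑ m ∈ Uf M, ((1 - ε) * x / m - E - Real.log x * gm m))
    (y : ℝ) (hy : 1 ≤ y) (hyY : y ≤ Y) :
    (x / Real.log x) * ∫ v in (1 : ℝ)..y, (countU v : ℝ) / v ^ 2 ≤ (countU x : ℝ) := by
  have hX : 0 < Real.log x := Real.log_pos hx
  have h1 : ∫ v in (1 : ℝ)..y, (countU v : ℝ) / v ^ 2 ≤ ∑ m ∈ Uf ⌊Y⌋₊, (1 / (m : ℝ) - 1 / Y) := by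
    refine (integral_le y hy).trans ?_
    calc ∑ m ∈ Uf ⌊y⌋₊, (1 / (m : ℝ) - 1 / y) ≤ ∑ m ∈ Uf ⌊y⌋₊, (1 / (m : ℝ) - 1 / Y) := by
          refine Finset.sum_le_sum fun m _ => ?_
          have := one_div_le_one_div_of_le (by linarith) hyY
          linarith
      _ ≤ _ := by
          refine Finset.sum_le_sum_of_subset_of_nonneg (Finset.filter_subset_filter _ (Finset.Icc_subset_Icc le_rfl (Nat.floor_le_floor hyY))) ?_
          intro m hm _
          simp only [Uf, Finset.mem_filter, Finset.mem_Icc] at hm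
          have m1 : (1:ℝ) ≤ m := by exact_mod_cast hm.1.1
          have mY : (m:ℝ) ≤ Y := (Nat.le_floor_iff (by linarith)).1 hm.1.2
          have := one_div_le_one_div_of_le (by linarith) mY
          linarith
  have h2 : ∑ m ∈ Uf M, ((1 - ε) * x / m - E - Real.log x * gm m) ≤ Real.log x * countU x := by
    refine le_trans ?_ (mul_le_mul_of_nonneg_left (count_lower x (by linarith) M) hX.le)
    rw [Finset.mul_sum]
    refine Finset.sum_le_sum fun m hm => ?_
    simp only [Uf, Finset.mem_filter] at hm
    have hp := hpsi m hm.1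
    have m1 : (1:ℝ) ≤ m := by exact_mod_cast (Finset.mem_Icc.1 hm.1).1
    have h3 : Chebyshev.psi (x / m) ≤ Nat.primeCounting ⌊x / m⌋₊ * Real.log x := by
      refine (Chebyshev.psi_le_primeCounting_mul_log' _).trans ?_
      refine mul_le_mul_of_nonneg_left ?_ (by positivity)
      exact Real.log_le_log (by positivity) (div_le_self (by linarith) m1)
    linarith
  have h4 := mul_le_mul_of_nonneg_left h1 (show 0 ≤ x by linarith)
  rw [div_mul_eq_mul_div, div_le_iff₀ hX]
  linarith
end

section
def wOf (l : List ℤ) (n : ℕ) : ℤ := if (n : ℤ) ∈ l then 1 else if (-(n : ℤ)) ∈ l then -1 else 0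
def reps : List (ℕ × List ℤ) := [(6, [-3, 2]), (15, [-10, 6]), (20, [-5, 4]), (21, [14, 7, -6]), (28, [-14, -7, 4]), (33, [-22, -11, 6]), (35, [-14, 10]), (44, [33, 12, -11]), (52, [-39, -26, 12]), (55, [44, 22, -20]), (65, [26, 13, -10]), (68, [51, -34, -17, 12]), (76, [-57, -19, 12]), (77, [-33, -21, 11]), (85, [-34, -17, 10]), (91, [-52, 28, 14, -13]), (95, [-76, -38, 20]), (115, [-69, -23, 15]), (117, [-39, -13, 9]), (119, [51, 21, -17]), (133, [38, 19, -14]), (143, [-26, 22]), (145, [-116, -29, 20]), (153, [102, 18, -17]), (155, [124, 62, 31, -20]), (161, [-46, -23, 14]), (171, [114, 19, -18]), (184, [138, 24, -23])]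
theorem reps_chk : ∀ t ∈ reps, 1 ≤ t.1 ∧ ∑ n ∈ Finset.Icc 1 (t.1 - 1), (wOf t.2 n : ℚ) / (n : ℚ) = 1 / (t.1 : ℚ) := by
  decide +kernel
theorem reps_non {t : ℕ × List ℤ} (ht : t ∈ reps) {n : ℕ} (hn : 1 ≤ n) (h : t.1 ∣ n) : ¬ memU n := by
  obtain ⟨k, rfl⟩ := h
  have h0 := reps_chk t ht
  refine nonU_mul (Nat.pos_of_ne_zero (by rintro rfl; simp at hn)) h0.1 fun hU => ?_
  refine hU.2 (wOf t.2) (fun n => ?_) h0.2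
  unfold wOf; split_ifs <;> simp

noncomputable def exB (l : List (ℕ × List ℤ)) (n : ℕ) : Bool := List.rec false (fun t _ ih => Bool.or (Nat.beq (Nat.mod n t.1) 0) ih) l
theorem exB_spec (l : List (ℕ × List ℤ)) (n : ℕ) (h : exB l n = true) : ∃ t ∈ l, t.1 ∣ n := by
  induction l with
  | nil => exact absurd h (by simp [exB])
  | cons t l ih =>
    have h' : Bool.or (Nat.beq (Nat.mod n t.1) 0) (exB l n) = true := h
    rw [Bool.or_eq_true] at h'
    rcases h' with h' | h'
    · exact ⟨t, List.mem_cons_self, Nat.dvd_of_mod_eq_zero (Nat.eq_of_beq_eq_true h')⟩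
    · obtain ⟨s, hs, h2⟩ := ih h'
      exact ⟨s, List.mem_cons_of_mem _ hs, h2⟩

/-- product of all values -/
def prodAll : List ℤ → ℤ → ℤ
  | [], v => v
  | a :: l, v => prodAll l (v - a) * prodAll l v * prodAll l (v + a)
theorem prodAll_dvd (L m i j : ℕ) (w : ℕ → ℤ) (hw : ∀ n, w n = -1 ∨ w n = 0 ∨ w n = 1) (v : ℤ) (hj : j = i + m) :
    (v + ∑ k ∈ Finset.Ico i j, w k * ((L / k : ℕ) : ℤ)) ∣ prodAll ((List.range' i m).map fun k => ((L / k : ℕ) : ℤ)) v := by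
  induction m generalizing i v with
  | zero => subst hj; simp [prodAll]
  | succ m ih =>
    subst hj
    rw [List.range'_succ, List.map_cons, prodAll, Finset.sum_eq_sum_Ico_succ_bot (by omega), ← add_assoc]
    have := fun v => ih (i + 1) v (by omega)
    rcases hw i with h | h | h <;> rw [h]
    · refine Dvd.dvd.mul_right (Dvd.dvd.mul_right ?_ _) _
      have e := this (v - ((L / i : ℕ) : ℤ)); rw [neg_one_mul, ← sub_eq_add_neg]; exact e
    · refine Dvd.dvd.mul_right (Dvd.dvd.mul_left ?_ _) _
      rw [zero_mul, add_zero]; exact this v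
    · refine Dvd.dvd.mul_left ?_ _
      rw [one_mul]; exact this _

def Wm (m : ℕ) : ℕ := (prodAll ((List.range' 1 (m - 1)).map fun k => ((Nat.lcmUpto m / k : ℕ) : ℤ)) (-((Nat.lcmUpto m / m : ℕ) : ℤ))).natAbs

def P96 : ℕ := 23768741896345550770650537601358310
theorem P96_eq : P96 = primorial 96 := by decide +kernel
def isP (p : ℕ) : Bool :=
  Bool.or (Bool.or (Bool.or (Nat.beq p 2) (Nat.beq p 3)) (Bool.or (Nat.beq p 5) (Nat.beq p 7)))
   (Bool.and (Nat.ble 2 p) (Bool.or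
    (Bool.and (Nat.ble p 120) (Nat.beq (Nat.gcd p 210) 1))
    (Bool.and (Nat.ble p 9408) (Nat.beq (Nat.gcd p 23768741896345550770650537601358310) 1))))
theorem prime_of_cop (p a : ℕ) (h2 : 2 ≤ p) (hp : p < (a + 1) ^ 2) (h : Nat.gcd p (primorial a) = 1) : p.Prime := by
  by_contra hn
  have h1 := Nat.minFac_sq_le_self (by omega) hn
  have h3 : p.minFac ≤ a := by nlinarith
  have hm : (p.minFac).Prime := Nat.minFac_prime (by omega)
  have h4 : p.minFac ∣ primorial a := Finset.dvd_prod_of_mem (fun p => p) (by simp [hm]; omega)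
  have := Nat.dvd_gcd (Nat.minFac_dvd p) h4
  rw [h] at this
  exact hm.one_lt.ne' (Nat.dvd_one.1 this)
theorem isP_spec (p : ℕ) (h : isP p = true) : p.Prime := by
  simp only [isP, Bool.or_eq_true, Bool.and_eq_true, Nat.beq_eq, Nat.ble_eq] at h
  rcases h with ((rfl | rfl) | (rfl | rfl)) | ⟨h2, h | h⟩ <;> try norm_num
  · exact prime_of_cop p 10 h2 (by omega) (by rw [show primorial 10 = 210 by decide]; exact h.2)
  · exact prime_of_cop p 96 h2 (by omega) (by rw [← P96_eq]; exact h.2)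
def tst (p w : ℕ) : Bool := Bool.and (isP p) (Nat.beq (Nat.gcd p w) 1)
theorem tst_spec (m n : ℕ) (hm : m ∈ [1, 2, 3, 4, 5, 7, 8]) (hn : n % m = 0) (h : tst (n / m) (Wm m) = true) : memU n := by
  simp only [tst, Bool.and_eq_true, Nat.beq_eq] at h
  have hp := isP_spec _ h.1
  have e : n = m * (n / m) := (Nat.mul_div_cancel' (Nat.dvd_of_mod_eq_zero hn)).symm
  rw [e]
  have h1 : 1 ≤ m := by revert m; simp
  refine critU m (n / m) (Nat.lcmUpto m) h1 hp (Nat.lcmUpto_ne_zero m) (fun k hk => dvd_lcmUpto hk) ?_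
  · intro w hw hd
    have h2 := prodAll_dvd (Nat.lcmUpto m) (m - 1) 1 m w hw (-((Nat.lcmUpto m / m : ℕ) : ℤ)) (by omega)
    have e2 : Finset.Icc 1 (m - 1) = Finset.Ico 1 m := by ext; simp; omega
    rw [e2, sub_eq_add_neg, add_comm] at hd
    have h3 := Int.natCast_dvd.1 (hd.trans h2)
    have h4 := Nat.dvd_gcd dvd_rfl h3
    change n / m ∣ Nat.gcd (n / m) (Wm m) at h4
    rw [h.2] at h4
    exact hp.one_lt.ne' (Nat.dvd_one.1 h4)
def good (w1 w2 w3 w4 w5 w7 w8 n : ℕ) : Bool :=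
  Bool.or (Bool.or (Bool.or (Bool.or (Bool.or (Bool.or (Bool.or (Nat.beq n 1) (Bool.and (Nat.beq (Nat.mod n 1) 0) (tst (Nat.div n 1) w1))) (Bool.and (Nat.beq (Nat.mod n 2) 0) (tst (Nat.div n 2) w2))) (Bool.and (Nat.beq (Nat.mod n 3) 0) (tst (Nat.div n 3) w3))) (Bool.and (Nat.beq (Nat.mod n 4) 0) (tst (Nat.div n 4) w4))) (Bool.and (Nat.beq (Nat.mod n 5) 0) (tst (Nat.div n 5) w5))) (Bool.and (Nat.beq (Nat.mod n 7) 0) (tst (Nat.div n 7) w7))) (Bool.and (Nat.beq (Nat.mod n 8) 0) (tst (Nat.div n 8) w8))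
theorem memU_one : memU 1 := ⟨le_rfl, fun w _ => by simp⟩
theorem good_spec (n : ℕ) (h : good (Wm 1) (Wm 2) (Wm 3) (Wm 4) (Wm 5) (Wm 7) (Wm 8) n = true) : memU n := by
  simp only [good, Bool.or_eq_true, Bool.and_eq_true, Nat.beq_eq] at h
  rcases h with ((((((rfl | h) | h) | h) | h) | h) | h) | h
  · exact memU_one
  all_goals exact tst_spec _ n (by decide) h.1 h.2

structure S8 where
  n : ℕ
  L : ℕ
  g : ℕ
  G : ℕ
  S : ℕ
  c : ℕ
  ok : Bool

noncomputable def S8.fc (s : S8) (f : S8 → S8) : S8 := S8.rec (fun n L g G S c ok => f ⟨n, L, g, G, S, c, ok⟩) s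

/-- the inequality checked from sixty on -/
def ineq8 (n G S c : ℕ) : Bool :=
  Nat.ble (Nat.mul (Nat.add n 1) (Nat.add (Nat.mul 481 (Nat.mul (Nat.mul 18 (Nat.pow 3 n)) S))
    (Nat.mul (Nat.mul (Nat.add 29000 (Nat.mul 10987 n)) 1000000000) (Nat.add (Nat.mul 190 n) G))))
    (Nat.mul c (Nat.mul (Nat.mul 18 (Nat.pow 3 n)) 10000000000000))

noncomputable def S8.step (w1 w2 w3 w4 w5 w7 w8 : ℕ) (s : S8) : S8 :=
  S8.rec (fun n L g G S c ok =>
    fnat (Nat.succ n) fun n' =>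
    fnat (Nat.div (Nat.mul L n') (Nat.gcd L n')) fun L' =>
    fnat (Nat.add (Nat.mul g (Nat.div L' L)) (Nat.div L' n')) fun g' =>
    fnat (Nat.add G g') fun G' =>
    fnat (Bool.rec (Nat.add S (Nat.succ (Nat.div 1000000000 n'))) S (exB reps n')) fun S' =>
    fnat (Bool.rec c (Nat.succ c) (good w1 w2 w3 w4 w5 w7 w8 n')) fun c' =>
    fbool (Bool.and ok (Bool.or (Nat.ble n' 59) (ineq8 n' G' S' c'))) fun ok' =>
    ⟨n', L', g', G', S', c', ok'⟩) s

theorem S8.step_eq (w1 w2 w3 w4 w5 w7 w8 : ℕ) (s : S8) : (s.step w1 w2 w3 w4 w5 w7 w8).n = s.n + 1 ∧ (s.step w1 w2 w3 w4 w5 w7 w8).L = Nat.lcm s.L (s.n + 1) ∧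
    (s.step w1 w2 w3 w4 w5 w7 w8).g = s.g * (Nat.lcm s.L (s.n + 1) / s.L) + Nat.lcm s.L (s.n + 1) / (s.n + 1) ∧
    (s.step w1 w2 w3 w4 w5 w7 w8).G = s.G + (s.step w1 w2 w3 w4 w5 w7 w8).g ∧
    (s.step w1 w2 w3 w4 w5 w7 w8).S = (if exB reps (s.n + 1) then s.S else s.S + (1000000000 / (s.n + 1) + 1)) ∧
    (s.step w1 w2 w3 w4 w5 w7 w8).c = if good w1 w2 w3 w4 w5 w7 w8 (s.n + 1) then s.c + 1 else s.c := by
  cases s with | _ n L g G S c ok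
  simp only [S8.step, fnat_eq, fbool_eq]
  refine ⟨trivial, rfl, rfl, rfl, ?_, ?_⟩
  · cases exB reps (n + 1) <;> rfl
  · cases good w1 w2 w3 w4 w5 w7 w8 (n + 1) <;> rfl

theorem S8.step_ok (w1 w2 w3 w4 w5 w7 w8 : ℕ) (s : S8) (h : (s.step w1 w2 w3 w4 w5 w7 w8).ok = true) : s.ok = true ∧
    ((s.step w1 w2 w3 w4 w5 w7 w8).n ≤ 59 ∨ ineq8 (s.step w1 w2 w3 w4 w5 w7 w8).n (s.step w1 w2 w3 w4 w5 w7 w8).G (s.step w1 w2 w3 w4 w5 w7 w8).S (s.step w1 w2 w3 w4 w5 w7 w8).c = true) := by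
  cases s with | _ n L g G S c ok
  simp only [S8.step, fnat_eq, fbool_eq] at h ⊢
  simp only [Bool.and_eq_true, Bool.or_eq_true, Nat.ble_eq] at h
  exact h

def st0 : S8 := ⟨0, 1, 0, 0, 0, 0, true⟩
noncomputable def chk8 : Bool := fnat (Nat.add (Wm 1) 0) fun w1 => fnat (Nat.add (Wm 2) 0) fun w2 => fnat (Nat.add (Wm 3) 0) fun w3 => fnat (Nat.add (Wm 4) 0) fun w4 => fnat (Nat.add (Wm 5) 0) fun w5 => fnat (Nat.add (Wm 7) 0) fun w7 => fnat (Nat.add (Wm 8) 0) fun w8 =>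
  S8.rec (fun _ _ _ _ S _ ok => Bool.and ok (Nat.ble S 6800000000)) (runF S8.fc (S8.step w1 w2 w3 w4 w5 w7 w8) 4 (runF S8.fc (S8.step w1 w2 w3 w4 w5 w7 w8) 13 st0))
theorem run8 : chk8 = true := by decide +kernel
noncomputable def st (n : ℕ) : S8 := (S8.step (Wm 1) (Wm 2) (Wm 3) (Wm 4) (Wm 5) (Wm 7) (Wm 8))^[n] st0
theorem run8' : (st 8208).ok = true ∧ (st 8208).S ≤ 6800000000 := by
  have h := run8
  simp only [chk8, fnat_eq, Nat.add_eq, Nat.add_zero] at h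
  rw [runF_eq S8.fc _ (fun s f => rfl), runF_eq S8.fc _ (fun s f => rfl), ← Function.iterate_add_apply] at h
  have e : (S8.step (Wm 1) (Wm 2) (Wm 3) (Wm 4) (Wm 5) (Wm 7) (Wm 8))^[2 ^ 4 + 2 ^ 13] st0 = st 8208 := by rw [st, show 2 ^ 4 + 2 ^ 13 = 8208 by norm_num]
  rw [e] at h
  generalize st 8208 = s at h ⊢
  cases s
  simpa using h
/-- the low table -/
def tab : List (ℕ × ℕ) := [(1, 1), (2, 2), (3, 3), (4, 4), (5, 4), (6, 5), (7, 5), (8, 7), (9, 8), (10, 9), (11, 10), (12, 10), (13, 11), (14, 11), (15, 11), (16, 14), (17, 16), (18, 16), (19, 17), (20, 17), (21, 17), (22, 19), (23, 19), (24, 22), (25, 23), (26, 23), (27, 26), (28, 27), (29, 27), (30, 27), (31, 29), (32, 29), (33, 29), (34, 29), (35, 32), (36, 34), (37, 34), (38, 34), (39, 39), (40, 39), (41, 39), (42, 39), (43, 41), (44, 41), (45, 41), (46, 43), (47, 46), (48, 46), (49, 46), (50, 47), (51, 47), (52, 51), (53, 51), (54, 51), (55, 53), (56, 53), (57, 57),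 (58, 58), (59, 59)]
def ineq0 (n M SM GM Sn cn : ℕ) : Bool :=
  Nat.ble ((n + 1) * (Sn * (18 * 3 ^ n) * 10000 + 788 * (18 * 3 ^ n) * SM + (M * (5 * (29000 + 10987 * n)) + (29000 + 10987 * n) * GM) * 1000000000))
    (cn * (18 * 3 ^ n) * 10000000000000 + (n + 1) * (SM * (18 * 3 ^ n) * 10000 + M * 58000 * 1000000000))
noncomputable def chk0 : Bool := fnat (Nat.add (Wm 1) 0) fun w1 => fnat (Nat.add (Wm 2) 0) fun w2 => fnat (Nat.add (Wm 3) 0) fun w3 => fnat (Nat.add (Wm 4) 0) fun w4 => fnat (Nat.add (Wm 5) 0) fun w5 => fnat (Nat.add (Wm 7) 0) fun w7 => fnat (Nat.add (Wm 8) 0) fun w8 =>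
  tab.all fun t => 
    S8.rec (fun _ _ _ GM SM _ _ => S8.rec (fun _ _ _ _ Sn cn _ => ineq0 t.1 t.2 SM GM Sn cn)
      ((S8.step w1 w2 w3 w4 w5 w7 w8)^[t.1] st0)) ((S8.step w1 w2 w3 w4 w5 w7 w8)^[t.2] st0)
theorem run0 : chk0 = true := by decide +kernel
theorem run0' (n M : ℕ) (h : (n, M) ∈ tab) : ineq0 n M (st M).S (st M).G (st n).S (st n).c = true := by
  have h0 := run0
  simp only [chk0, fnat_eq, Nat.add_eq, Nat.add_zero] at h0
  rw [List.all_eq_true] at h0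
  exact h0 _ h
theorem st_succ (n : ℕ) : st (n + 1) = S8.step (Wm 1) (Wm 2) (Wm 3) (Wm 4) (Wm 5) (Wm 7) (Wm 8) (st n) := Function.iterate_succ_apply' _ _ _
theorem st_ok (i n : ℕ) (h : (st (n + i)).ok = true) : (st n).ok = true := by
  induction i with
  | zero => exact h
  | succ i ih =>
    apply ih
    rw [← add_assoc, st_succ] at h
    exact (S8.step_ok _ _ _ _ _ _ _ _ h).1
theorem st_n (n : ℕ) : (st n).n = n := by
  induction n with
  | zero => rfl
  | succ n ih => rw [st_succ, (S8.step_eq _ _ _ _ _ _ _ _).1, ih]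
theorem lcmUpto_succ (n : ℕ) : Nat.lcmUpto (n + 1) = Nat.lcm (Nat.lcmUpto n) (n + 1) := by
  rw [Nat.lcmUpto, Nat.lcmUpto, ← Finset.insert_Icc_right_eq_Icc_add_one (by omega), Finset.lcm_insert, lcm_comm]; rfl
theorem st_L (n : ℕ) : (st n).L = Nat.lcmUpto n := by
  induction n with
  | zero => rfl
  | succ n ih => rw [st_succ, (S8.step_eq _ _ _ _ _ _ _ _).2.1, ih, st_n, lcmUpto_succ]
theorem st_g (n : ℕ) : (st n).g = gm n := by
  induction n with
  | zero => rfl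
  | succ n ih =>
    rw [st_succ, (S8.step_eq _ _ _ _ _ _ _ _).2.2.1, ih, st_n, st_L, ← lcmUpto_succ, gm, gm, Finset.sum_mul, ← Finset.insert_Icc_right_eq_Icc_add_one (a := 1) (b := n) (by omega), Finset.sum_insert (by simp), add_comm]
    congr 1
    refine Finset.sum_congr rfl fun k hk => ?_
    have h1 : Nat.lcmUpto n ∣ Nat.lcmUpto (n + 1) := by rw [lcmUpto_succ]; exact Nat.dvd_lcm_left _ _
    rw [mul_comm, Nat.div_mul_div_comm h1 (dvd_lcmUpto hk), mul_comm (Nat.lcmUpto (n+1)), Nat.mul_div_mul_left _ _ (Nat.lcmUpto_pos n)]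
theorem st_G (n : ℕ) : (st n).G = ∑ k ∈ Finset.Icc 1 n, gm k := by
  induction n with
  | zero => rfl
  | succ n ih =>
    have h := (S8.step_eq (Wm 1) (Wm 2) (Wm 3) (Wm 4) (Wm 5) (Wm 7) (Wm 8) (st n)).2.2.2.1
    rw [← st_succ, st_g] at h
    rw [h, ih, Finset.sum_Icc_succ_top (by omega)]
theorem Uf_succ (n : ℕ) : Uf (n + 1) = if memU (n + 1) then insert (n + 1) (Uf n) else Uf n := by
  rw [Uf, Uf, ← Finset.insert_Icc_right_eq_Icc_add_one (by omega), Finset.filter_insert]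
theorem not_mem_Uf (n : ℕ) : n + 1 ∉ Uf n := by simp [Uf]
theorem st_c (n : ℕ) : (st n).c ≤ (Uf n).card := by
  induction n with
  | zero => exact Nat.zero_le _
  | succ n ih =>
    rw [st_succ, (S8.step_eq _ _ _ _ _ _ _ _).2.2.2.2.2, st_n, Uf_succ]
    by_cases hg : good (Wm 1) (Wm 2) (Wm 3) (Wm 4) (Wm 5) (Wm 7) (Wm 8) (n + 1) = true
    · rw [if_pos hg, if_pos (good_spec _ hg), Finset.card_insert_of_notMem (not_mem_Uf n)]; omega
    · rw [if_neg hg]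
      split_ifs
      · rw [Finset.card_insert_of_notMem (not_mem_Uf n)]; omega
      · exact ih
theorem st_S {M n : ℕ} (h : M ≤ n) : (10:ℝ) ^ 9 * (∑ m ∈ Uf n, (1:ℝ) / m - ∑ m ∈ Uf M, (1:ℝ) / m) ≤ (st n).S - (st M).S := by
  have hm : Monotone fun n => ((st n).S : ℝ) - (10:ℝ) ^ 9 * ∑ m ∈ Uf n, (1:ℝ) / m := by
    refine monotone_nat_of_le_succ fun n => ?_
    rw [st_succ, (S8.step_eq _ _ _ _ _ _ _ _).2.2.2.2.1, st_n, Uf_succ]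
    have hd : (10:ℝ) ^ 9 * (1 / ((n + 1 : ℕ) : ℝ)) ≤ ((1000000000 / (n + 1) : ℕ) : ℝ) + 1 := by
      have := Nat.lt_floor_add_one ((1000000000 : ℝ) / ((n + 1 : ℕ) : ℝ))
      have e : ⌊(1000000000 : ℝ) / ((n + 1 : ℕ) : ℝ)⌋₊ = 1000000000 / (n + 1) := by
        have := Nat.floor_div_eq_div (K := ℝ) 1000000000 (n + 1)
        exact_mod_cast this
      rw [e] at this
      calc _ = (1000000000 : ℝ) / ((n + 1 : ℕ) : ℝ) := by rw [mul_one_div]; norm_num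
        _ ≤ _ := this.le
    by_cases hg : exB reps (n + 1) = true
    · obtain ⟨t, ht, h2⟩ := exB_spec _ _ hg
      rw [if_pos hg, if_neg (reps_non ht (by omega) h2)]
    · rw [if_neg hg]
      have h0 : (0:ℝ) ≤ ((1000000000 / (n + 1) : ℕ) : ℝ) := Nat.cast_nonneg _
      split_ifs
      · rw [Finset.sum_insert (not_mem_Uf n)]; push_cast at hd h0 ⊢; linarith
      · push_cast at h0 ⊢; linarith
  have := hm h
  simp only at this
  linarith
theorem ineq8_ok (n : ℕ) (h0 : 60 ≤ n) (h1 : n ≤ 8208) : ineq8 n (st n).G (st n).S (st n).c = true := by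
  have h2 : (st n).ok = true := st_ok (8208 - n) n (by rw [Nat.add_sub_cancel' h1]; exact run8'.1)
  obtain ⟨k, rfl⟩ : ∃ k, n = k + 1 := ⟨n - 1, by omega⟩
  rw [st_succ] at h2
  have h3 := (S8.step_ok _ _ _ _ _ _ _ _ h2).2
  rw [← st_succ, st_n] at h3
  rcases h3 with h3 | h3
  · omega
  · exact h3
end

section
theorem log_lin {x T a b : ℝ} (hT : 0 < T) (hx : T ≤ x) (ha : 0 ≤ a) (hb : b ≤ a * (Real.log T - 1)) :
    a * Real.log x - b ≤ (a * Real.log T - b) * (x / T) := by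
  have hr : 1 ≤ x / T := (one_le_div hT).2 hx
  have h1 : Real.log x = Real.log T + Real.log (x / T) := by
    rw [Real.log_div (by linarith) hT.ne']; ring
  have h2 := Real.log_le_sub_one_of_pos (show 0 < x / T by linarith)
  rw [h1]
  nlinarith [mul_le_mul_of_nonneg_left h2 ha, mul_nonneg (sub_nonneg.2 hb) (sub_nonneg.2 hr)]

theorem log3_up : Real.log 3 ≤ 1.0987 := by
  have h := Real.log_three_lt_d9
  linarith
theorem log18_up : Real.log 18 ≤ 2.9 := by
  rw [show (18:ℝ) = 2 * 3 ^ 2 by norm_num, Real.log_mul (by norm_num) (by norm_num), Real.log_pow]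
  have h1 := Real.log_two_lt_d9
  have h2 := log3_up
  push_cast; linarith
theorem logT (n : ℕ) : Real.log (18 * 3 ^ n) ≤ 2.9 + 1.0987 * n := by
  rw [Real.log_mul (by norm_num) (by positivity), Real.log_pow]
  have := mul_le_mul_of_nonneg_left log3_up (Nat.cast_nonneg (α := ℝ) n)
  linarith [log18_up]
theorem logT_lo (n : ℕ) (hn : 1 ≤ n) : 3.9 ≤ Real.log (18 * 3 ^ n) := by
  have h1 : (54 : ℝ) ≤ 18 * 3 ^ n := by
    have : (3:ℝ) ^ 1 ≤ 3 ^ n := pow_le_pow_right₀ (by norm_num) hn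
    linarith
  refine le_trans ?_ (Real.log_le_log (by norm_num) h1)
  rw [show (54:ℝ) = 2 * 3 ^ 3 by norm_num, Real.log_mul (by norm_num) (by norm_num), Real.log_pow]
  have h1 := Real.log_two_gt_d9
  have h2 := Real.log_three_gt_d9
  push_cast; linarith

theorem low (x Y : ℝ) (n M : ℕ) (hn1 : 1 ≤ n) (hMn : M ≤ n) (hY : 1 ≤ Y) (hn : ⌊Y⌋₊ = n) (hx : 18 * 3 ^ n ≤ x) (ε e1 e2 : ℝ)
    (hε : 0 ≤ ε) (he1 : 0 ≤ e1) (he2 : e2 ≤ 2.9 * e1)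
    (hpsi : ∀ m ∈ Finset.Icc 1 M, (1 - ε) * x / m - (e1 * Real.log x - e2) ≤ Chebyshev.psi (x / m))
    (h : (n + 1) * (((st n).S - (st M).S) * (18 * 3 ^ n) + ε * (18 * 3 ^ n) * (st M).S +
      ((M * e1 + (st M).G) * (2.9 + 1.0987 * n) - M * e2) * 10 ^ 9) ≤ (st n).c * (18 * 3 ^ n) * (10:ℝ) ^ 9)
    (y : ℝ) (hy : 1 ≤ y) (hyY : y ≤ Y) :
    (x / Real.log x) * ∫ v in (1 : ℝ)..y, (countU v : ℝ) / v ^ 2 ≤ (countU x : ℝ) := by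
  have hTl := logT_lo n hn1
  have hTu := logT n
  set T : ℝ := 18 * 3 ^ n with hT
  have T0 : 0 < T := by positivity
  have hxT : Real.log T ≤ Real.log x := Real.log_le_log T0 hx
  have x1 : 1 < x := by
    by_contra h'
    have := Real.log_nonpos (by linarith) (not_lt.1 h')
    linarith
  refine master x Y hY x1 M ε (e1 * Real.log x - e2) hpsi ?_ y hy hyY
  have hS0 := st_S (Nat.zero_le M)
  have hS1 := st_S hMn
  have hc := st_c n
  have z1 : ∑ m ∈ Uf 0, (1:ℝ) / m = 0 := by simp [Uf]
  have z2 : ((st 0).S : ℝ) = 0 := by simp [st, st0]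
  rw [z1, z2] at hS0
  have hcM : ((Uf M).card : ℝ) ≤ M := by
    have := Finset.card_filter_le (Finset.Icc 1 M) (fun m => memU m)
    simp only [Nat.card_Icc, Nat.add_sub_cancel] at this
    exact_mod_cast this
  have hG : ∑ m ∈ Uf M, (gm m : ℝ) ≤ (st M).G := by
    rw [st_G]; push_cast
    exact Finset.sum_le_sum_of_subset_of_nonneg (Finset.filter_subset _ _) fun _ _ _ => Nat.cast_nonneg _
  have hl : 0 ≤ Real.log x := by linarith
  have hE : 0 ≤ e1 * Real.log x - e2 := by
    have h9 := mul_le_mul_of_nonneg_left (show (2.9:ℝ) ≤ Real.log x by linarith) he1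
    linarith
  rw [hn, Finset.sum_sub_distrib, Finset.sum_sub_distrib, Finset.sum_sub_distrib]
  simp only [Finset.sum_const, nsmul_eq_mul, ← Finset.mul_sum]
  have e3 : ∑ m ∈ Uf M, (1 - ε) * x / (m:ℝ) = (1 - ε) * x * ∑ m ∈ Uf M, (1:ℝ) / m := by
    rw [Finset.mul_sum]; refine Finset.sum_congr rfl fun m _ => by ring
  rw [e3]
  set σn := ∑ m ∈ Uf n, (1:ℝ) / m
  set σM := ∑ m ∈ Uf M, (1:ℝ) / m
  have hYn : Y < n + 1 := by rw [← hn]; exact Nat.lt_floor_add_one Y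
  have hcY : ((st n).c : ℝ) / (n + 1) ≤ (Uf n).card * (1 / Y) := by
    rw [mul_one_div]
    exact div_le_div₀ (Nat.cast_nonneg _) (by exact_mod_cast hc) (by linarith) hYn.le
  have h1 := mul_le_mul_of_nonneg_right hcM hE
  have h2 := mul_le_mul_of_nonneg_left hG hl
  set a : ℝ := M * e1 + (st M).G with ha
  have M0 : (0:ℝ) ≤ M := Nat.cast_nonneg _
  have G0 : (0:ℝ) ≤ (st M).G := Nat.cast_nonneg _
  have a0 : 0 ≤ a := by positivity
  have h3 := log_lin (b := M * e2) T0 hx a0 (by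
    have := mul_le_mul_of_nonneg_left he2 M0
    have h4 : a * 2.9 ≤ a * (Real.log T - 1) := mul_le_mul_of_nonneg_left (by linarith) a0
    have h9 : a * 2.9 = M * e1 * 2.9 + (st M).G * 2.9 := by rw [ha]; ring
    clear_value a
    linarith)
  have r0 : 0 < x / T := by apply div_pos _ T0; linarith
  have h4 : (a * Real.log T - M * e2) * (x / T) ≤ (a * (2.9 + 1.0987 * n) - M * e2) * (x / T) :=
    mul_le_mul_of_nonneg_right (by linarith [mul_le_mul_of_nonneg_left hTu a0]) r0.le
  have n1 : (0:ℝ) < n + 1 := by positivity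
  have h5 : ((st n).S - (st M).S) * T + ε * T * (st M).S + (a * (2.9 + 1.0987 * n) - M * e2) * 10 ^ 9 ≤ (st n).c / (n + 1) * T * 10 ^ 9 := by
    rw [div_mul_eq_mul_div, div_mul_eq_mul_div, le_div_iff₀ n1]
    linarith
  have h6 : (10:ℝ) ^ 9 * ((σn - σM) * T + ε * T * σM + (a * (2.9 + 1.0987 * n) - M * e2)) ≤ 10 ^ 9 * ((Uf n).card * (1 / Y) * T) := by
    have k1 := mul_le_mul_of_nonneg_right hS1 T0.le
    have k2 := mul_le_mul_of_nonneg_left hS0 (mul_nonneg hε T0.le)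
    have k3 := mul_le_mul_of_nonneg_right hcY T0.le
    linarith
  have h7 := le_of_mul_le_mul_left h6 (by positivity)
  have h8 := mul_le_mul_of_nonneg_right h7 r0.le
  have hxe : x = T * (x / T) := by field_simp
  set r := x / T
  have e1' : (σn - σM) * T * r = (σn - σM) * x := by rw [mul_assoc, ← hxe]
  have e2' : ε * T * σM * r = ε * σM * x := by rw [hxe]; ring
  have e4' : (Uf n).card * (1 / Y) * T * r = (Uf n).card * (1 / Y) * x := by rw [mul_assoc, ← hxe]
  rw [add_mul, add_mul, e1', e2', e4'] at h8
  linarith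

theorem low_small (x Y : ℝ) (n : ℕ) (hn1 : 1 ≤ n) (hn60 : n < 60) (hY : 1 ≤ Y) (hn : ⌊Y⌋₊ = n) (hx : 18 * 3 ^ n ≤ x)
    (y : ℝ) (hy : 1 ≤ y) (hyY : y ≤ Y) :
    (x / Real.log x) * ∫ v in (1 : ℝ)..y, (countU v : ℝ) / v ^ 2 ≤ (countU x : ℝ) := by
  have hM : ∀ n, 1 ≤ n → n < 60 → ∃ M ≤ n, (n, M) ∈ tab ∧ M * 30 ≤ 18 * 3 ^ n := by
    intro n h1 h2
    have h : ∀ t ∈ tab, t.2 ≤ t.1 ∧ t.2 * 30 ≤ 18 * 3 ^ t.1 := by decide +kernel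
    have h' : ∀ n < 60, 1 ≤ n → ∃ t ∈ tab, t.1 = n := by decide +kernel
    obtain ⟨t, ht, rfl⟩ := h' n h2 h1
    exact ⟨t.2, (h t ht).1, ht, (h t ht).2⟩
  obtain ⟨M, hMn, ht, hM⟩ := hM n hn1 hn60
  have hM' : (M:ℝ) * 30 ≤ 18 * 3 ^ n := by exact_mod_cast hM
  have hx0 : 0 < x := lt_of_lt_of_le (by positivity) hx
  refine low x Y n M hn1 hMn hY hn hx 0.0788 5 5.8 (by norm_num) (by norm_num) (by norm_num) ?_ ?_ y hy hyY
  · intro m hm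
    rw [Finset.mem_Icc] at hm
    have m1 : (1:ℝ) ≤ m := by exact_mod_cast hm.1
    have mM : (m:ℝ) ≤ M := by exact_mod_cast hm.2
    have h30 : 30 ≤ x / m := by rw [le_div_iff₀ (by linarith)]; linarith
    have h1 := psi30 h30
    have h2 := Real.log_le_log (by linarith) (div_le_self hx0.le m1)
    rw [mul_div_assoc]
    linarith
  · have h := run0' n M ht
    rw [ineq0, Nat.ble_eq] at h
    have h' : (((n + 1) * ((st n).S * (18 * 3 ^ n) * 10000 + 788 * (18 * 3 ^ n) * (st M).S + (M * (5 * (29000 + 10987 * n)) + (29000 + 10987 * n) * (st M).G) * 1000000000) : ℕ) : ℝ)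
      ≤ (((st n).c * (18 * 3 ^ n) * 10000000000000 + (n + 1) * ((st M).S * (18 * 3 ^ n) * 10000 + M * 58000 * 1000000000) : ℕ) : ℝ) := by exact_mod_cast h
    push_cast at h'
    set T : ℝ := 18 * 3 ^ n
    have : (10000:ℝ) * ((n + 1) * (((st n).S - (st M).S) * T + 0.0788 * T * (st M).S +
      ((M * 5 + (st M).G) * (2.9 + 1.0987 * n) - M * 5.8) * 10 ^ 9)) ≤ 10000 * ((st n).c * T * (10:ℝ) ^ 9) := by
      linarith
    linarith

theorem low_mid (x Y : ℝ) (n : ℕ) (hn1 : 60 ≤ n) (hn2 : n ≤ 8208) (hY : 1 ≤ Y) (hn : ⌊Y⌋₊ = n) (hx : 18 * 3 ^ n ≤ x)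
    (y : ℝ) (hy : 1 ≤ y) (hyY : y ≤ Y) :
    (x / Real.log x) * ∫ v in (1 : ℝ)..y, (countU v : ℝ) / v ^ 2 ≤ (countU x : ℝ) := by
  have hx0 : 0 < x := lt_of_lt_of_le (by positivity) hx
  refine low x Y n n (by omega) le_rfl hY hn hx 0.0481 190 0 (by norm_num) (by norm_num) (by norm_num) ?_ ?_ y hy hyY
  · intro m hm
    rw [Finset.mem_Icc] at hm
    have m1 : (1:ℝ) ≤ m := by exact_mod_cast hm.1
    have mM : (m:ℝ) ≤ 8208 := by exact_mod_cast hm.2.trans hn2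
    have h60 : (3:ℝ) ^ 60 ≤ 3 ^ n := pow_le_pow_right₀ (by norm_num) hn1
    have h30 : 27720 ≤ x / m := by
      rw [le_div_iff₀ (by linarith)]
      norm_num at h60
      linarith
    have h1 := psi27 h30
    have h2 := Real.log_le_log (by linarith) (div_le_self hx0.le m1)
    rw [mul_div_assoc]
    linarith
  · have h := ineq8_ok n hn1 hn2
    rw [ineq8, Nat.ble_eq] at h
    have h0 : (n + 1) * (481 * (18 * 3 ^ n * (st n).S) + (29000 + 10987 * n) * 1000000000 * (190 * n + (st n).G))
       ≤ (st n).c * (18 * 3 ^ n * 10000000000000) := h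
    have h' : (((n + 1) * (481 * (18 * 3 ^ n * (st n).S) + (29000 + 10987 * n) * 1000000000 * (190 * n + (st n).G)) : ℕ) : ℝ)
       ≤ (((st n).c * (18 * 3 ^ n * 10000000000000) : ℕ) : ℝ) := by exact_mod_cast h0
    push_cast at h'
    set T : ℝ := 18 * 3 ^ n
    have : (10000:ℝ) * ((n + 1) * (((st n).S - (st n).S) * T + 0.0481 * T * (st n).S +
      ((n * 190 + (st n).G) * (2.9 + 1.0987 * n) - n * 0) * 10 ^ 9)) ≤ 10000 * ((st n).c * T * (10:ℝ) ^ 9) := by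
      linarith
    linarith
end

section
theorem sig_large (n : ℕ) (hn : 8208 ≤ n) : ∑ m ∈ Uf n, (1:ℝ) / m ≤ 6.8 + Real.log (n / 8208) := by
  induction n, hn using Nat.le_induction with
  | base =>
    have hS0 := st_S (Nat.zero_le 8208)
    have z1 : ∑ m ∈ Uf 0, (1:ℝ) / m = 0 := by simp [Uf]
    have z2 : ((st 0).S : ℝ) = 0 := by simp [st, st0]
    have h3 : ((st 8208).S : ℝ) ≤ 6800000000 := by exact_mod_cast run8'.2
    rw [z1, z2] at hS0
    push_cast
    rw [div_self (by norm_num), Real.log_one]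
    linarith
  | succ n hn ih =>
    have n0 : (8208:ℝ) ≤ n := by exact_mod_cast hn
    have h1 : (1:ℝ) / ((n + 1 : ℕ) : ℝ) ≤ Real.log (((n + 1 : ℕ) : ℝ) / 8208) - Real.log (n / 8208) := by
      push_cast
      rw [Real.log_div (by linarith) (by norm_num), Real.log_div (by linarith) (by norm_num)]
      have h := Real.log_le_sub_one_of_pos (show 0 < (n:ℝ) / (n + 1) by apply div_pos <;> linarith)
      rw [Real.log_div (by linarith) (by linarith)] at h
      have : (n:ℝ) / (n + 1) - 1 = - (1 / (n + 1)) := by field_simp; ring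
      linarith
    have h2 : (0:ℝ) ≤ 1 / ((n + 1 : ℕ) : ℝ) := by positivity
    rw [Uf_succ]
    split_ifs
    · rw [Finset.sum_insert (not_mem_Uf n)]; linarith
    · linarith

theorem cnt_large (M : ℕ) (hM : 8000 ≤ M) : 1.919 * (M:ℝ) / Real.log M - 60 ≤ (Uf M).card := by
  have h := count_lower M (Nat.cast_nonneg M) 4
  have e : countU (M:ℝ) = (Uf M).card := by rw [countU, Nat.floor_natCast, Uf]
  rw [e] at h
  have hU : (Finset.Icc 1 4).filter (fun m => memU m) = Finset.Icc 1 4 := by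
    refine Finset.filter_true_of_mem fun m hm => good_spec m ?_
    revert m; decide +kernel
  rw [hU] at h
  refine le_trans ?_ h
  have M0 : (8000:ℝ) ≤ M := by exact_mod_cast hM
  have hl : 0 < Real.log M := Real.log_pos (by linarith)
  have key : ∀ m ∈ Finset.Icc (1:ℕ) 4, 0.9212 * (M:ℝ) / Real.log M * (1 / m) - 5 ≤ Nat.primeCounting ⌊(M:ℝ) / m⌋₊ := by
    intro m hm
    rw [Finset.mem_Icc] at hm
    have m1 : (1:ℝ) ≤ m := by exact_mod_cast hm.1
    have m4 : (m:ℝ) ≤ 4 := by exact_mod_cast hm.2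
    have t30 : 30 ≤ (M:ℝ) / m := by rw [le_div_iff₀ (by linarith)]; linarith
    have h1 := psi30 t30
    have h2 := Real.log_le_log (by linarith) (div_le_self (by linarith) m1)
    have h3 := Chebyshev.psi_le_primeCounting_mul_log' ((M:ℝ) / m)
    have h4 := mul_le_mul_of_nonneg_left h2 (Nat.cast_nonneg (α := ℝ) (Nat.primeCounting ⌊(M:ℝ) / m⌋₊))
    have e1 : 0.9212 * (M:ℝ) / Real.log M * (1 / m) - 5 = (0.9212 * (M / m) - 5 * Real.log M) / Real.log M := by
      field_simp
    rw [e1, div_le_iff₀ hl]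
    linarith
  have k1 := key 1 (by decide)
  have k2 := key 2 (by decide)
  have k3 := key 3 (by decide)
  have k4 := key 4 (by decide)
  have g1 : gm 1 = 1 := by decide +kernel
  have g2 : gm 2 = 3 := by decide +kernel
  have g3 : gm 3 = 11 := by decide +kernel
  have g4 : gm 4 = 25 := by decide +kernel
  rw [show Finset.Icc 1 4 = {1, 2, 3, 4} by decide]
  rw [Finset.sum_insert (by decide), Finset.sum_insert (by decide), Finset.sum_insert (by decide), Finset.sum_singleton, g1, g2, g3, g4]
  have q : 0 ≤ (M:ℝ) / Real.log M := by positivity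
  rw [mul_div_assoc] at k1 k2 k3 k4 ⊢
  push_cast at k1 k2 k3 k4 ⊢
  linarith

theorem G_large (M : ℕ) (hM : 1 ≤ M) : ∑ m ∈ Uf M, (gm m : ℝ) ≤ M ^ 2 * Real.exp (1.074 * M + 4 * Real.log M ^ 2) := by
  have M1 : (1:ℝ) ≤ M := by exact_mod_cast hM
  have h1 : ∀ m ∈ Finset.Icc 1 M, (gm m : ℝ) ≤ M * Real.exp (1.074 * M + 4 * Real.log M ^ 2) := by
    intro m hm
    rw [Finset.mem_Icc] at hm
    have h2 : gm m ≤ m * Nat.lcmUpto m := by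
      rw [gm]
      refine (Finset.sum_le_card_nsmul _ _ (Nat.lcmUpto m) fun k _ => Nat.div_le_self _ _).trans ?_
      simp
    have h3 : (Nat.lcmUpto m : ℝ) ≤ Real.exp (1.074 * M + 4 * Real.log M ^ 2) := by
      rw [← Real.exp_log (show (0:ℝ) < Nat.lcmUpto m by exact_mod_cast Nat.lcmUpto_pos m), ← Chebyshev.psi_eq_log_lcmUpto]
      refine Real.exp_le_exp.2 ?_
      refine le_trans (Chebyshev.psi_mono (by exact_mod_cast hm.2)) (psi_up M1)
    have h2' : (gm m : ℝ) ≤ m * Nat.lcmUpto m := by exact_mod_cast h2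
    refine h2'.trans ?_
    have : (m:ℝ) ≤ M := by exact_mod_cast hm.2
    gcongr
  calc ∑ m ∈ Uf M, (gm m : ℝ) ≤ ∑ m ∈ Finset.Icc 1 M, (gm m : ℝ) :=
        Finset.sum_le_sum_of_subset_of_nonneg (Finset.filter_subset _ _) fun _ _ _ => Nat.cast_nonneg _
    _ ≤ ∑ m ∈ Finset.Icc 1 M, (M * Real.exp (1.074 * M + 4 * Real.log M ^ 2) : ℝ) := Finset.sum_le_sum h1
    _ = _ := by simp; ring

theorem poly1 (r : ℝ) (hr1 : 1 ≤ r) : 4 * (5.011 + 4 * r) ^ 2 + 4 * (5.011 + 4 * r) ≤ 174.5 + 201.5 * r ^ 4 := by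
  obtain ⟨d, rfl⟩ : ∃ d, r = 1 + d := ⟨r - 1, by ring⟩
  have d0 : 0 ≤ d := by linarith
  have := pow_nonneg d0 2
  have := pow_nonneg d0 3
  have := pow_nonneg d0 4
  ring_nf; linarith

theorem poly2 (r : ℝ) (hr1 : 1 ≤ r) : (224.70656 * r ^ 2 * (2.8 + 4 * r) + 65) * (5.011 + 4 * r) ≤ 1.919 * (8192 * r ^ 4 - 161) := by
  obtain ⟨d, rfl⟩ : ∃ d, r = 1 + d := ⟨r - 1, by ring⟩
  have d0 : 0 ≤ d := by linarith
  have := pow_nonneg d0 2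
  have := pow_nonneg d0 3
  have := pow_nonneg d0 4
  ring_nf; linarith

set_option maxHeartbeats 1000000 in
theorem large (x Y : ℝ) (hY : 8209 ≤ Y) (hx : Real.log x = Real.log 18 + Y * Real.log 3) (hx1 : 1 < x)
    (y : ℝ) (hy : 1 ≤ y) (hyY : y ≤ Y) :
    (x / Real.log x) * ∫ v in (1 : ℝ)..y, (countU v : ℝ) / v ^ 2 ≤ (countU x : ℝ) := by
  obtain ⟨n, hn⟩ : ∃ n, ⌊Y⌋₊ = n := ⟨_, rfl⟩
  have hn1 : 8209 ≤ n := by rw [← hn]; exact Nat.le_floor (by exact_mod_cast hY)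
  have hnY : (n:ℝ) ≤ Y := by rw [← hn]; exact Nat.floor_le (by linarith)
  have hYn : Y < n + 1 := by rw [← hn]; exact Nat.lt_floor_add_one Y
  obtain ⟨M, hnM⟩ : ∃ M, n = M + 160 := ⟨n - 160, by omega⟩
  have hnM' : (n:ℝ) = M + 160 := by rw [hnM]; push_cast; rfl
  have hM : 8049 ≤ M := by omega
  rw [hnM'] at hnY hYn
  have M0 : (8049:ℝ) ≤ M := by exact_mod_cast hM
  clear hn1
  obtain ⟨r, hr0, hr⟩ : ∃ r : ℝ, 0 ≤ r ∧ r ^ 4 = Y / 8192 := by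
    refine ⟨√(√(Y / 8192)), by positivity, ?_⟩
    rw [show √(√(Y / 8192)) ^ 4 = (√(√(Y / 8192)) ^ 2) ^ 2 by ring, Real.sq_sqrt (by positivity), Real.sq_sqrt (by positivity)]
  have hYr : Y = 8192 * r ^ 4 := by rw [hr]; ring
  have hr1 : 1 ≤ r := by
    by_contra h
    push Not at h
    have := pow_lt_one₀ hr0 h (show 4 ≠ 0 by norm_num)
    linarith
  have hl : Real.log Y ≤ 5.011 + 4 * r := by
    rw [hYr, Real.log_mul (by norm_num) (by positivity), Real.log_pow, show (8192:ℝ) = 2 ^ 13 by norm_num, Real.log_pow]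
    have h1 := Real.log_le_sub_one_of_pos (show 0 < r by linarith)
    have h2 := Real.log_two_lt_d9
    push_cast; linarith
  have hl0 : 8 ≤ Real.log Y := by
    have : Real.log (2 ^ 13) ≤ Real.log Y := Real.log_le_log (by norm_num) (by norm_num; linarith)
    rw [Real.log_pow] at this
    have h2 := Real.log_two_gt_d9
    push_cast at this; linarith
  have h18 : 2.89 ≤ Real.log 18 := by
    rw [show (18:ℝ) = 2 * 3 ^ 2 by norm_num, Real.log_mul (by norm_num) (by norm_num), Real.log_pow]
    have h1 := Real.log_two_gt_d9
    have h2 := Real.log_three_gt_d9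
    push_cast; linarith
  have hX1 : 1.0986 * Y + 2.89 ≤ Real.log x := by
    rw [hx]
    have h2 := Real.log_three_gt_d9
    nlinarith
  have hX2 : Real.log x ≤ 1.2 * Y := by
    rw [hx]
    nlinarith [log18_up, log3_up]
  set l := Real.log Y with hldef
  have hr4 : 4 * r ≤ 3 + r ^ 4 := by nlinarith [sq_nonneg (r - 1), sq_nonneg (r ^ 2 - 1)]
  have hx0 : 0 < x := by linarith
  have Y0 : 0 < Y := by linarith
  have hrp : 0 < r := by linarith
  refine master x Y (by linarith) hx1 M (0.02743 / r ^ 2) 0 ?_ ?_ y hy hyY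
  · intro m hm
    rw [Finset.mem_Icc] at hm
    have m1 : (1:ℝ) ≤ m := by exact_mod_cast hm.1
    have mM : (m:ℝ) ≤ Y := by
      have : (m:ℝ) ≤ M := by exact_mod_cast hm.2
      linarith
    have t0 : 0 < x / m := by positivity
    have hlt : Real.log x - l ≤ Real.log (x / m) := by
      rw [Real.log_div (by linarith) (by linarith)]
      have := Real.log_le_log (by linarith) mM
      linarith
    have hV : 8999.9 ≤ Real.log (x / m) := by linarith
    have hV2 : 8987.04 * r ^ 4 ≤ Real.log (x / m) := by linarith
    set u := Real.log (x / m) with hu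
    set Z := √(√u) with hZ
    have Z0 : 0 ≤ Z := by positivity
    have hZ2 : Z ^ 2 = √u := Real.sq_sqrt (by positivity)
    have hZ4 : Z ^ 4 = u := by
      rw [show Z ^ 4 = (Z ^ 2) ^ 2 by ring, hZ2, Real.sq_sqrt (by linarith)]
    have hZ1 : 9.74 ≤ Z := by
      by_contra h
      push Not at h
      have := pow_le_pow_left₀ Z0 h.le 4
      norm_num at this
      linarith
    have h1 := psi_lower hZ1
    rw [hZ4, hu, Real.exp_log t0] at h1
    refine le_trans ?_ h1
    have h2 : 94.8 * r ^ 2 ≤ Z ^ 2 := by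
      rw [hZ2]
      refine Real.le_sqrt_of_sq_le ?_
      nlinarith
    have h3 : 2.6 / Z ^ 2 ≤ 0.02743 / r ^ 2 := by
      rw [div_le_div_iff₀ (by positivity) (by positivity)]
      nlinarith [sq_nonneg r]
    rw [mul_div_assoc, sub_zero]
    exact mul_le_mul_of_nonneg_right (by linarith) t0.le
  · rw [hn]
    have hsub : Uf M ⊆ Uf n := Finset.filter_subset_filter _ (Finset.Icc_subset_Icc le_rfl (by omega))
    have hD : ∑ m ∈ Uf n \ Uf M, (1 / (m:ℝ) - 1 / Y) ≤ 4 / Y := by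
      have hb : ∀ m ∈ Uf n \ Uf M, (1 / (m:ℝ) - 1 / Y) ≤ 161 / (8049 * Y) := by
        intro m hm
        simp only [Uf, Finset.mem_sdiff, Finset.mem_filter, Finset.mem_Icc] at hm
        have hm2 : M ≤ m := by
          by_contra hh
          exact hm.2 ⟨⟨hm.1.1.1, by omega⟩, hm.1.2⟩
        have hm3 : (M:ℝ) ≤ m := by exact_mod_cast hm2
        have h1 : 1 / (m:ℝ) ≤ 1 / M := one_div_le_one_div_of_le (by linarith) hm3
        have h2 : 1 / (M:ℝ) - 1 / Y = (Y - M) / (M * Y) := by field_simp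
        have h3 : (Y - M) / (M * Y) ≤ 161 / (8049 * Y) := by
          apply div_le_div₀ (by norm_num) (by linarith) (by positivity)
          exact mul_le_mul_of_nonneg_right M0 Y0.le
        linarith
      have hc : (Uf n \ Uf M).card ≤ 160 := by
        have : Uf n \ Uf M ⊆ Finset.Ioc M n := by
          intro m hm
          simp only [Uf, Finset.mem_sdiff, Finset.mem_filter, Finset.mem_Icc] at hm
          rw [Finset.mem_Ioc]
          refine ⟨?_, hm.1.1.2⟩
          by_contra hh
          exact hm.2 ⟨⟨hm.1.1.1, by omega⟩, hm.1.2⟩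
        have := Finset.card_le_card this
        simp only [Nat.card_Ioc] at this
        omega
      refine (Finset.sum_le_card_nsmul _ _ _ hb).trans ?_
      rw [nsmul_eq_mul]
      have hc' : ((Uf n \ Uf M).card : ℝ) ≤ 160 := by exact_mod_cast hc
      refine (mul_le_mul_of_nonneg_right hc' (by positivity)).trans ?_
      rw [← mul_div_assoc, div_le_div_iff₀ (by positivity) Y0]
      nlinarith
    rw [← Finset.sum_sdiff hsub, Finset.sum_sub_distrib (s := Uf M), Finset.sum_sub_distrib, Finset.sum_sub_distrib]
    simp only [Finset.sum_const, nsmul_eq_mul, ← Finset.mul_sum, mul_zero, sub_zero]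
    have e3 : ∑ m ∈ Uf M, (1 - 0.02743 / r ^ 2) * x / (m:ℝ) = (1 - 0.02743 / r ^ 2) * x * ∑ m ∈ Uf M, (1:ℝ) / m := by
      rw [Finset.mul_sum]; refine Finset.sum_congr rfl fun m _ => by ring
    rw [e3]
    have hσ : ∑ m ∈ Uf M, (1:ℝ) / m ≤ 2.8 + 4 * r := by
      have h1 := sig_large n (by omega)
      have h2 : ∑ m ∈ Uf M, (1:ℝ) / m ≤ ∑ m ∈ Uf n, (1:ℝ) / m :=
        Finset.sum_le_sum_of_subset_of_nonneg hsub fun _ _ _ => by positivity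
      have h3 : Real.log ((n : ℝ) / 8208) ≤ Real.log (r ^ 4) := by
        refine Real.log_le_log (by rw [hnM']; positivity) ?_
        rw [hr]
        apply div_le_div₀ (by linarith) (by linarith) (by norm_num) (by norm_num)
      rw [Real.log_pow] at h3
      have h4 := Real.log_le_sub_one_of_pos hrp
      push_cast at h3 h1; linarith
    have hcnt := cnt_large M (by omega)
    have hGM := G_large M (by omega)
    set σ := ∑ m ∈ Uf M, (1:ℝ) / m
    set c : ℝ := ((Uf M).card : ℝ)
    set G := ∑ m ∈ Uf M, (gm m : ℝ)
    have hlM : Real.log M ≤ l := Real.log_le_log (by linarith) (by linarith)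
    have hlM0 : 0 < Real.log M := Real.log_pos (by linarith)
    have hXG : Real.log x * G * Y ≤ x := by
      have h1 : (M:ℝ) ^ 2 ≤ Y ^ 2 := by gcongr; linarith
      have h2 : 1.074 * (M:ℝ) + 4 * Real.log M ^ 2 ≤ 1.074 * (Y - 160) + 4 * l ^ 2 := by
        have : Real.log M ^ 2 ≤ l ^ 2 := by gcongr
        linarith
      have h3 : G ≤ Y ^ 2 * Real.exp (1.074 * (Y - 160) + 4 * l ^ 2) :=
        hGM.trans (mul_le_mul h1 (Real.exp_le_exp.2 h2) (Real.exp_pos _).le (by positivity))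
      have h4 : Real.log x * G ≤ 1.2 * Y * (Y ^ 2 * Real.exp (1.074 * (Y - 160) + 4 * l ^ 2)) :=
        mul_le_mul hX2 h3 (Finset.sum_nonneg fun _ _ => Nat.cast_nonneg _) (by positivity)
      have h5 : Real.log x * G * Y ≤ 1.2 * (Y ^ 4 * Real.exp (1.074 * (Y - 160) + 4 * l ^ 2)) := by
        have := mul_le_mul_of_nonneg_right h4 Y0.le
        linarith
      have h6 : (1.2:ℝ) ≤ Real.exp 0.2 := by linarith [Real.add_one_le_exp (0.2:ℝ)]
      have h7 : Y ^ 4 = Real.exp (4 * l) := by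
        rw [mul_comm, Real.exp_mul, hldef, Real.exp_log Y0]; norm_cast
      refine h5.trans ?_
      rw [h7, ← Real.exp_add]
      refine (mul_le_mul_of_nonneg_right h6 (Real.exp_pos _).le).trans ?_
      rw [← Real.exp_add]
      conv_rhs => rw [← Real.exp_log hx0]
      refine Real.exp_le_exp.2 (le_trans ?_ hX1)
      have hl2 : l ^ 2 ≤ (5.011 + 4 * r) ^ 2 := by gcongr
      have : 4 * (5.011 + 4 * r) ^ 2 + 4 * (5.011 + 4 * r) ≤ 174.5 + 201.5 * r ^ 4 := by
        exact poly1 r hr1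
      linarith
    have hfin : 0.02743 / r ^ 2 * Y * σ + 5 ≤ c := by
      have h1 : 0.02743 / r ^ 2 * Y = 224.70656 * r ^ 2 := by
        rw [hYr]; field_simp; ring
      rw [h1]
      have h2 : 224.70656 * r ^ 2 * σ ≤ 224.70656 * r ^ 2 * (2.8 + 4 * r) := mul_le_mul_of_nonneg_left hσ (by positivity)
      refine le_trans ?_ hcnt
      rw [le_sub_iff_add_le, le_div_iff₀ hlM0]
      have h3 : (224.70656 * r ^ 2 * σ + 5 + 60) * Real.log M ≤ (224.70656 * r ^ 2 * (2.8 + 4 * r) + 65) * (5.011 + 4 * r) :=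
        mul_le_mul (by linarith) (by linarith) hlM0.le (by positivity)
      refine h3.trans ?_
      have h4 : 1.919 * (8192 * r ^ 4 - 161) ≤ 1.919 * (M:ℝ) := by rw [← hYr]; linarith
      refine le_trans ?_ h4
      exact poly2 r hr1
    have hA := mul_le_mul_of_nonneg_left hD hx0.le
    have hB : x / Y * (0.02743 / r ^ 2 * Y * σ + 5) ≤ x / Y * c := mul_le_mul_of_nonneg_left hfin (by positivity)
    have hC : Real.log x * G ≤ x / Y := by rw [le_div_iff₀ Y0]; exact hXG
    have e5 : x / Y * (0.02743 / r ^ 2 * Y * σ + 5) = x * (0.02743 / r ^ 2) * σ + 5 * (x / Y) := by field_simp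
    have e6 : x * (4 / Y) = 4 * (x / Y) := by ring
    have e7 : x / Y * c = x * (c * (1 / Y)) := by ring
    rw [e5, e7] at hB
    rw [e6, Finset.sum_sub_distrib] at hA
    simp only [Finset.sum_const, nsmul_eq_mul] at hA
    linarith
end

theorem countU_recursive (x y : ℝ) (hy : 1 ≤ y) (hx : 18 * (3 : ℝ) ^ y ≤ x) :
    (x / Real.log x) * ∫ v in (1 : ℝ)..y, (countU v : ℝ) / v ^ 2 ≤ (countU x : ℝ) := by
  have l3 : 0 < Real.log 3 := Real.log_pos (by norm_num)
  have h3y : (0:ℝ) < 3 ^ y := Real.rpow_pos_of_pos (by norm_num) y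
  have hx0 : 0 < x := by linarith
  obtain ⟨Y, hYd⟩ : ∃ Y, Y = Real.log (x / 18) / Real.log 3 := ⟨_, rfl⟩
  have hYe : Y * Real.log 3 = Real.log (x / 18) := by rw [hYd]; field_simp
  have hyY : y ≤ Y := by
    rw [hYd, le_div_iff₀ l3, ← Real.log_rpow (by norm_num)]
    exact Real.log_le_log h3y (by rw [le_div_iff₀ (by norm_num)]; linarith)
  have hY : 1 ≤ Y := hy.trans hyY
  have hlog : Real.log x = Real.log 18 + Y * Real.log 3 := by
    rw [hYe, Real.log_div hx0.ne' (by norm_num)]; ring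
  have hxY : x = 18 * (3:ℝ) ^ Y := by
    rw [Real.rpow_def_of_pos (by norm_num), mul_comm (Real.log 3), hYe, Real.exp_log (by positivity)]; ring
  have hfl : (18:ℝ) * 3 ^ ⌊Y⌋₊ ≤ x := by
    rw [hxY, ← Real.rpow_natCast]
    have := Real.rpow_le_rpow_of_exponent_le (show (1:ℝ) ≤ 3 by norm_num) (Nat.floor_le (show 0 ≤ Y by linarith))
    linarith
  have hn1 : 1 ≤ ⌊Y⌋₊ := Nat.le_floor (by exact_mod_cast hY)
  rcases lt_or_ge ⌊Y⌋₊ 60 with h | h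
  · exact low_small x Y _ hn1 h hY rfl hfl y hy hyY
  rcases le_or_gt ⌊Y⌋₊ 8208 with h' | h'
  · exact low_mid x Y _ h h' hY rfl hfl y hy hyY
  · refine large x Y ?_ hlog ?_ y hy hyY
    · have := (Nat.le_floor_iff (show 0 ≤ Y by linarith)).1 (show 8209 ≤ ⌊Y⌋₊ from h')
      exact_mod_cast this
    · have : (1:ℝ) ≤ 3 ^ ⌊Y⌋₊ := one_le_pow₀ (by norm_num)
      linarith
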